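/- arXiv:1611.01079 — 4 statements merged into one kernel-verified Lean document; each statement's English description precedes it below -/
import Mathlib

section
/- Assume the sparsity condition (H_n is bounded as n → ∞ and max_{i∈[n]} Σ_{j=1}^n p_{i,j}(log p_{i,j})² = o(log n)) and the non-degeneracy condition (lim_{ε→0⁺} limsup_{n→∞} (1/n)·#{(i,j) : p_{i,j} > 1−ε} = 0). Then for every fixed ε > 0 and every sequence of times t_n = Θ(log n), the random variable max_{i∈[n]} Q_i( ρ(t_n) ∉ [e^{−(1+ε)H_n t_n}, e^{−(1−ε)H_n t_n}] ) converges to 0 in probability as n → ∞. -/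
open Filter
open scoped BigOperators Classical

/-- The random environment: `n` permutations of `[n]`. -/
abbrev Env (n : ℕ) := Fin n → Equiv.Perm (Fin n)

/-- The random stochastic matrix `P_σ(i,j) = p_{i, σ_i⁻¹(j)}`. -/
noncomputable def Pmat (n : ℕ) (p : Fin n → Fin n → ℝ) (σ : Env n) (i j : Fin n) : ℝ :=
  p i ((σ i).symm j)

/-- Probability of an event under the uniform measure on environments. -/
noncomputable def Pr (n : ℕ) (E : Env n → Prop) : ℝ :=
  (∑ σ : Env n, if E σ then (1 : ℝ) else 0) / (Fintype.card (Env n) : ℝ)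

/-- The average row entropy `H_n`. -/
noncomputable def avgEntropy (n : ℕ) (p : Fin n → Fin n → ℝ) : ℝ :=
  -(1 / (n : ℝ)) * ∑ i : Fin n, ∑ j : Fin n, p i j * Real.log (p i j)

/-- Weight `ρ(t)` of a trajectory `x = (x_0, …, x_t)`. -/
noncomputable def pathWeight (n t : ℕ) (P : Fin n → Fin n → ℝ)
    (x : Fin (t + 1) → Fin n) : ℝ :=
  ∏ s : Fin t, P (x s.castSucc) (x s.succ)

/-- Quenched probability `Q_i(A)` for a property `A` of length-`t` trajectories. -/
noncomputable def quenched (n t : ℕ) (P : Fin n → Fin n → ℝ) (i : Fin n)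
    (A : (Fin (t + 1) → Fin n) → Prop) : ℝ :=
  ∑ x : Fin (t + 1) → Fin n, if x 0 = i ∧ A x then pathWeight n t P x else 0

namespace SparseWalk

/-- Finite partial information on the environment: the triple `(x, j, y)` records `σ_x(j) = y`. -/
abbrev Info (n : ℕ) := Finset (Fin n × Fin n × Fin n)

variable {n : ℕ}

/-- The environment `σ` agrees with the information `R`. -/
def Agrees (σ : Env n) (R : Info n) : Prop := ∀ e ∈ R, σ e.1 e.2.1 = e.2.2

/-- Sum of `f` over the environments that agree with `R`. -/
noncomputable def esum (R : Info n) (f : Env n → ℝ) : ℝ :=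
  ∑ σ : Env n, if Agrees σ R then f σ else 0

/-- Number of environments that agree with `R`. -/
noncomputable def cnt (R : Info n) : ℝ := esum R (fun _ => 1)

lemma agrees_insert {σ : Env n} {R : Info n} {x j y : Fin n} :
    Agrees σ (insert (x, j, y) R) ↔ σ x j = y ∧ Agrees σ R := by
  simp [Agrees]

lemma esum_mono {R : Info n} {f g : Env n → ℝ} (h : ∀ σ, Agrees σ R → f σ ≤ g σ) :
    esum R f ≤ esum R g := by
  unfold esum
  refine Finset.sum_le_sum fun σ _ => ?_
  split_ifs with hσ
  · exact h σ hσ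
  · exact le_rfl

lemma esum_congr {R : Info n} {f g : Env n → ℝ} (h : ∀ σ, Agrees σ R → f σ = g σ) :
    esum R f = esum R g :=
  le_antisymm (esum_mono fun σ hσ => (h σ hσ).le) (esum_mono fun σ hσ => (h σ hσ).ge)

lemma esum_nonneg {R : Info n} {f : Env n → ℝ} (h : ∀ σ, Agrees σ R → 0 ≤ f σ) :
    0 ≤ esum R f := by
  unfold esum
  refine Finset.sum_nonneg fun σ _ => ?_
  split_ifs with hσ
  · exact h σ hσ
  · exact le_rfl

lemma esum_mul_right (R : Info n) (f : Env n → ℝ) (c : ℝ) :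
    esum R (fun σ => f σ * c) = esum R f * c := by
  simp only [esum, Finset.sum_mul, ite_mul, zero_mul]

lemma esum_mul_left (R : Info n) (f : Env n → ℝ) (c : ℝ) :
    esum R (fun σ => c * f σ) = c * esum R f := by
  simp only [esum, Finset.mul_sum, mul_ite, mul_zero]

lemma esum_const (R : Info n) (c : ℝ) : esum R (fun _ => c) = cnt R * c := by
  rw [cnt, ← esum_mul_right]; simp

lemma esum_add (R : Info n) (f g : Env n → ℝ) :
    esum R (fun σ => f σ + g σ) = esum R f + esum R g := by
  simp only [esum, ← Finset.sum_add_distrib]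
  refine Finset.sum_congr rfl fun σ _ => ?_
  split_ifs <;> simp

lemma esum_sum {ι : Type*} (s : Finset ι) (R : Info n) (f : ι → Env n → ℝ) :
    esum R (fun σ => ∑ a ∈ s, f a σ) = ∑ a ∈ s, esum R (f a) := by
  simp only [esum]
  rw [Finset.sum_comm]
  refine Finset.sum_congr rfl fun σ _ => ?_
  split_ifs <;> simp

lemma cnt_nonneg (R : Info n) : 0 ≤ cnt R := esum_nonneg fun _ _ => zero_le_one

lemma cnt_empty : cnt (∅ : Info n) = (Fintype.card (Env n) : ℝ) := by
  simp [cnt, esum, Agrees]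

lemma sum_esum_insert (R : Info n) (x j : Fin n) (f : Fin n → Env n → ℝ) :
    ∑ y, esum (insert (x, j, y) R) (f y) = esum R (fun σ => f (σ x j) σ) := by
  simp only [esum]
  rw [Finset.sum_comm]
  refine Finset.sum_congr rfl fun σ _ => ?_
  simp only [agrees_insert]
  by_cases h : Agrees σ R <;> simp [h]

lemma sum_esum_insert_of_mem {R : Info n} {x j y₀ : Fin n} (h : (x, j, y₀) ∈ R)
    (f : Fin n → Env n → ℝ) :
    ∑ y, esum (insert (x, j, y) R) (f y) = esum R (f y₀) := by
  rw [sum_esum_insert]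
  refine esum_congr fun σ hσ => ?_
  rw [show σ x j = y₀ from hσ _ h]

lemma sum_cnt_insert (R : Info n) (x j : Fin n) :
    ∑ y, cnt (insert (x, j, y) R) = cnt R := by
  unfold cnt
  rw [sum_esum_insert R x j (fun _ _ => 1)]

/-- Permuting the values of a single row. -/
def rowSwap (x y y' : Fin n) (σ : Env n) : Env n :=
  Function.update σ x ((σ x).trans (Equiv.swap y y'))

lemma rowSwap_involutive (x y y' : Fin n) : Function.Involutive (rowSwap x y y') := by
  intro σ
  unfold rowSwap
  funext z
  by_cases hz : z = x
  · subst hz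
    ext a
    simp
  · simp [hz]

lemma rowSwap_apply (x y y' : Fin n) (σ : Env n) (a b : Fin n) :
    rowSwap x y y' σ a b = if a = x then Equiv.swap y y' (σ a b) else σ a b := by
  unfold rowSwap
  by_cases ha : a = x
  · subst ha
    simp
  · simp [ha]

lemma cnt_insert_le_cnt_insert {R : Info n} {x j y y' : Fin n}
    (hy : ∀ i, (x, i, y) ∉ R) (hy' : ∀ i, (x, i, y') ∉ R) :
    cnt (insert (x, j, y) R) ≤ cnt (insert (x, j, y') R) := by
  unfold cnt esum
  rw [← Equiv.sum_comp (Function.Involutive.toPerm _ (rowSwap_involutive x y y'))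
    (fun σ => if Agrees σ (insert (x, j, y') R) then (1 : ℝ) else 0)]
  refine Finset.sum_le_sum fun σ _ => ?_
  by_cases h : Agrees σ (insert (x, j, y) R)
  · rw [if_pos h, if_pos]
    rw [agrees_insert] at h ⊢
    rw [Function.Involutive.coe_toPerm]
    refine ⟨by simp [rowSwap_apply, h.1], ?_⟩
    rintro ⟨a, b, c⟩ he
    have hc := h.2 _ he
    simp only at hc
    simp only [rowSwap_apply]
    by_cases ha : a = x
    · subst ha
      have h1 : c ≠ y := fun hcy => hy b (hcy ▸ he)
      have h2 : c ≠ y' := fun hcy => hy' b (hcy ▸ he)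
      simp [hc, Equiv.swap_apply_of_ne_of_ne h1 h2]
    · simp [ha, hc]
  · rw [if_neg h]
    split_ifs <;> norm_num

/-- Entries of `R` in row `x`. -/
def rowInfo (R : Info n) (x : Fin n) : Info n := R.filter (fun e => e.1 = x)

lemma cnt_insert_mul_le {R : Info n} {x j : Fin n} (hj : ∀ y, (x, j, y) ∉ R) (y : Fin n) :
    cnt (insert (x, j, y) R) * ((n : ℝ) - (rowInfo R x).card) ≤ cnt R := by
  by_cases hy : ∃ i, (x, i, y) ∈ R
  · obtain ⟨i, hi⟩ := hy
    have h0 : cnt (insert (x, j, y) R) = 0 := by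
      unfold cnt esum
      refine Finset.sum_eq_zero fun σ _ => if_neg ?_
      rw [agrees_insert]
      rintro ⟨h1, h2⟩
      have h3 : σ x i = y := h2 _ hi
      have : i = j := (σ x).injective (h3.trans h1.symm)
      exact hj y (this ▸ hi)
    rw [h0, zero_mul]
    exact cnt_nonneg R
  · push Not at hy
    set T : Finset (Fin n) := (rowInfo R x).image (fun e => e.2.2) with hT
    have hTc : T.card ≤ (rowInfo R x).card := Finset.card_image_le
    have hTm : ∀ y', y' ∈ Tᶜ → ∀ i, (x, i, y') ∉ R := by
      intro y' hy' i hi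
      rw [Finset.mem_compl] at hy'
      exact hy' (Finset.mem_image.2 ⟨(x, i, y'), by simp [rowInfo, hi], rfl⟩)
    have hle : (n : ℝ) - (rowInfo R x).card ≤ (Tᶜ.card : ℝ) := by
      rw [Finset.card_compl, Fintype.card_fin, Nat.cast_sub]
      · have : (T.card : ℝ) ≤ (rowInfo R x).card := by exact_mod_cast hTc
        linarith
      · simpa using Finset.card_le_univ T
    calc cnt (insert (x, j, y) R) * ((n : ℝ) - (rowInfo R x).card)
        ≤ cnt (insert (x, j, y) R) * (Tᶜ.card : ℝ) :=
          mul_le_mul_of_nonneg_left hle (cnt_nonneg _)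
      _ = ∑ y' ∈ Tᶜ, cnt (insert (x, j, y) R) := by
          rw [Finset.sum_const, nsmul_eq_mul, mul_comm]
      _ ≤ ∑ y' ∈ Tᶜ, cnt (insert (x, j, y') R) :=
          Finset.sum_le_sum fun y' hy' => cnt_insert_le_cnt_insert hy (hTm y' hy')
      _ ≤ ∑ y', cnt (insert (x, j, y') R) :=
          Finset.sum_le_sum_of_subset_of_nonneg (Finset.subset_univ _)
            fun _ _ _ => cnt_nonneg _
      _ = cnt R := sum_cnt_insert R x j

lemma cnt_insert_le_div {R : Info n} {x j : Fin n} (hj : ∀ y, (x, j, y) ∉ R) (y : Fin n)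
    {m : ℝ} (hm : ((rowInfo R x).card : ℝ) ≤ m) (hmn : m < n) :
    cnt (insert (x, j, y) R) ≤ cnt R / (n - m) := by
  rw [le_div_iff₀ (by linarith)]
  refine le_trans ?_ (cnt_insert_mul_le hj y)
  exact mul_le_mul_of_nonneg_left (by linarith) (cnt_nonneg _)

lemma card_rowInfo_le (R : Info n) (x : Fin n) : (rowInfo R x).card ≤ R.card :=
  Finset.card_filter_le _ _

/-- Sum over the trajectories of length `r` from `x`, weighted by their quenched probability, of
`f` evaluated at the accumulated information and the accumulated weight, which start at `R`
and `ρ`. -/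
noncomputable def walkSum (p : Fin n → Fin n → ℝ) (σ : Env n) (f : Info n → ℝ → ℝ) :
    ℕ → Fin n → Info n → ℝ → ℝ
  | 0, _, R, ρ => f R ρ
  | r + 1, x, R, ρ =>
      ∑ j, p x j * walkSum p σ f r (σ x j) (insert (x, j, σ x j) R) (ρ * p x j)

section walkSum

variable {p : Fin n → Fin n → ℝ}

lemma walkSum_mono (hp : ∀ i j, 0 ≤ p i j) {σ : Env n} {f g : Info n → ℝ → ℝ}
    (h : ∀ R ρ, f R ρ ≤ g R ρ) (r : ℕ) (x : Fin n) (R : Info n) (ρ : ℝ) :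
    walkSum p σ f r x R ρ ≤ walkSum p σ g r x R ρ := by
  induction r generalizing x R ρ with
  | zero => exact h R ρ
  | succ r ih => exact Finset.sum_le_sum fun j _ => mul_le_mul_of_nonneg_left (ih _ _ _) (hp x j)

lemma walkSum_const (hrow : ∀ i, ∑ j, p i j = 1) (σ : Env n) (c : ℝ) (r : ℕ) (x : Fin n)
    (R : Info n) (ρ : ℝ) : walkSum p σ (fun _ _ => c) r x R ρ = c := by
  induction r generalizing x R ρ with
  | zero => rfl
  | succ r ih => simp only [walkSum, ih, ← Finset.sum_mul, hrow, one_mul]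

lemma walkSum_le (hp : ∀ i j, 0 ≤ p i j) (hrow : ∀ i, ∑ j, p i j = 1) {σ : Env n}
    {f : Info n → ℝ → ℝ} {c : ℝ} (h : ∀ R ρ, f R ρ ≤ c) (r : ℕ) (x : Fin n) (R : Info n) (ρ : ℝ) :
    walkSum p σ f r x R ρ ≤ c :=
  (walkSum_mono hp h r x R ρ).trans (walkSum_const hrow σ c r x R ρ).le

lemma walkSum_nonneg (hp : ∀ i j, 0 ≤ p i j) {σ : Env n} {f : Info n → ℝ → ℝ}
    (h : ∀ R ρ, 0 ≤ f R ρ) (r : ℕ) (x : Fin n) (R : Info n) (ρ : ℝ) :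
    0 ≤ walkSum p σ f r x R ρ := by
  induction r generalizing x R ρ with
  | zero => exact h R ρ
  | succ r ih => exact Finset.sum_nonneg fun j _ => mul_nonneg (hp x j) (ih _ _ _)

lemma walkSum_info (σ : Env n) (g : ℝ → ℝ) (r : ℕ) (x : Fin n) (R R' : Info n) (ρ : ℝ) :
    walkSum p σ (fun _ => g) r x R ρ = walkSum p σ (fun _ => g) r x R' ρ := by
  induction r generalizing x R R' ρ with
  | zero => rfl
  | succ r ih =>
    exact Finset.sum_congr rfl fun j _ => by rw [ih _ _ (insert (x, j, σ x j) R')]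

lemma walkSum_mul (σ : Env n) (f : Info n → ℝ → ℝ) (c : ℝ) (r : ℕ) (x : Fin n)
    (R : Info n) (ρ : ℝ) :
    walkSum p σ (fun R ρ => f R ρ * c) r x R ρ = walkSum p σ f r x R ρ * c := by
  induction r generalizing x R ρ with
  | zero => rfl
  | succ r ih => simp only [walkSum, ih, Finset.sum_mul, mul_assoc]

lemma walkSum_add (σ : Env n) (f g : Info n → ℝ → ℝ) (r : ℕ) (x : Fin n)
    (R : Info n) (ρ : ℝ) :
    walkSum p σ (fun R ρ => f R ρ + g R ρ) r x R ρ =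
      walkSum p σ f r x R ρ + walkSum p σ g r x R ρ := by
  induction r generalizing x R ρ with
  | zero => rfl
  | succ r ih => simp only [walkSum, ih, mul_add, Finset.sum_add_distrib]

lemma esum_walkSum_succ (f : Env n → Info n → ℝ → ℝ) (r : ℕ) (x : Fin n) (R : Info n) (ρ : ℝ) :
    esum R (fun σ => walkSum p σ (f σ) (r + 1) x R ρ) =
      ∑ j, p x j * ∑ y, esum (insert (x, j, y) R)
        (fun σ => walkSum p σ (f σ) r y (insert (x, j, y) R) (ρ * p x j)) := by
  simp only [walkSum]
  rw [esum_sum]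
  refine Finset.sum_congr rfl fun j _ => ?_
  rw [esum_mul_left, sum_esum_insert R x j
    (fun y σ => walkSum p σ (f σ) r y (insert (x, j, y) R) (ρ * p x j))]

lemma esum_walkSum_le_of_le (hp : ∀ i j, 0 ≤ p i j) {m : ℕ} {f : Env n → Info n → ℝ → ℝ}
    {b : Info n → ℝ → ℝ}
    (h : ∀ R ρ, R.card ≤ m → esum R (fun σ => f σ R ρ) ≤ cnt R * b R ρ)
    (r : ℕ) (x : Fin n) (R : Info n) (ρ : ℝ) (hR : R.card + r ≤ m) :
    esum R (fun σ => walkSum p σ (f σ) r x R ρ) ≤ esum R (fun σ => walkSum p σ b r x R ρ) := by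
  induction r generalizing x R ρ with
  | zero => simpa only [walkSum, esum_const] using h R ρ (by omega)
  | succ r ih =>
    rw [esum_walkSum_succ, esum_walkSum_succ (fun _ => b)]
    refine Finset.sum_le_sum fun j _ => mul_le_mul_of_nonneg_left
      (Finset.sum_le_sum fun y _ => ih _ _ _ ?_) (hp x j)
    have := Finset.card_insert_le (x, j, y) R
    omega

end walkSum

/-- Number of entries of `R` beyond those of a tree rooted at `i`. -/
def excess (i : Fin n) (R : Info n) : ℕ :=
  R.card - ((R.image (fun e => e.2.2)).erase i).card

lemma card_erase_image_le (i : Fin n) (R : Info n) :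
    ((R.image (fun e => e.2.2)).erase i).card ≤ R.card :=
  (Finset.card_erase_le).trans Finset.card_image_le

lemma excess_insert_of_mem {i : Fin n} {R : Info n} {x j y : Fin n} (he : (x, j, y) ∉ R)
    (hy : y ∈ insert i (R.image (fun e => e.2.2))) :
    excess i (insert (x, j, y) R) = excess i R + 1 := by
  have h1 : ((insert (x, j, y) R).image (fun e => e.2.2)).erase i =
      (R.image (fun e => e.2.2)).erase i := by
    rw [Finset.image_insert]
    ext z
    simp only [Finset.mem_erase, Finset.mem_insert] at hy ⊢
    constructor
    · rintro ⟨hz, rfl | hz'⟩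
      · exact ⟨hz, hy.resolve_left hz⟩
      · exact ⟨hz, hz'⟩
    · rintro ⟨hz, hz'⟩
      exact ⟨hz, Or.inr hz'⟩
  have h2 := card_erase_image_le i R
  unfold excess
  rw [h1, Finset.card_insert_of_notMem he]
  omega

lemma excess_insert_of_notMem {i : Fin n} {R : Info n} {x j y : Fin n}
    (hy : y ∉ insert i (R.image (fun e => e.2.2))) :
    excess i (insert (x, j, y) R) = excess i R := by
  rw [Finset.mem_insert, not_or] at hy
  have he : (x, j, y) ∉ R := fun h => hy.2 (Finset.mem_image.2 ⟨_, h, rfl⟩)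
  have h1 : ((insert (x, j, y) R).image (fun e => e.2.2)).erase i =
      insert y ((R.image (fun e => e.2.2)).erase i) := by
    rw [Finset.image_insert, Finset.erase_insert_of_ne hy.1]
  unfold excess
  rw [h1, Finset.card_insert_of_notMem he, Finset.card_insert_of_notMem
    (fun h => hy.2 (Finset.mem_of_mem_erase h))]
  omega

lemma excess_le_insert (i : Fin n) (R : Info n) (x j y : Fin n) :
    excess i R ≤ excess i (insert (x, j, y) R) := by
  by_cases he : (x, j, y) ∈ R
  · rw [Finset.insert_eq_of_mem he]
  by_cases hy : y ∈ insert i (R.image (fun e => e.2.2))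
  · rw [excess_insert_of_mem he hy]; omega
  · rw [excess_insert_of_notMem hy]

/-- Bound on the probability of reaching excess two within `L` steps, when each step increases
the excess with probability at most `q` and the current excess is `c`. -/
def excessBound (q : ℝ) (L : ℕ) : ℕ → ℝ
  | 0 => (L * q) ^ 2
  | 1 => L * q
  | _ + 2 => 1

lemma excessBound_nonneg {q : ℝ} (hq : 0 ≤ q) (L c : ℕ) : 0 ≤ excessBound q L c := by
  rcases c with _ | _ | c <;> simp only [excessBound] <;> positivity

lemma excessBound_mono {q : ℝ} (hq : 0 ≤ q) {L L' : ℕ} (h : L ≤ L') (c : ℕ) :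
    excessBound q L c ≤ excessBound q L' c := by
  rcases c with _ | _ | c <;> simp only [excessBound] <;> gcongr

lemma sum_excessBound_le {m : ℕ} {q : ℝ} (hmn : m < n) (hq : (m + 1 : ℝ) / (n - m) ≤ q)
    (i : Fin n) {R : Info n} (hR : R.card ≤ m) {x j : Fin n} (hj : ∀ y, (x, j, y) ∉ R) (L : ℕ) :
    ∑ y, cnt (insert (x, j, y) R) * excessBound q L (excess i (insert (x, j, y) R)) ≤
      cnt R * excessBound q (L + 1) (excess i R) := by
  have hmn' : (m : ℝ) < n := by exact_mod_cast hmn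
  have hq0 : 0 ≤ q := le_trans (div_nonneg (by positivity) (by linarith)) hq
  by_cases h2 : 2 ≤ excess i R
  · have key : ∀ c, 2 ≤ c → ∀ L, excessBound q L c = 1 := by
      intro c hc L
      obtain ⟨d, rfl⟩ := Nat.exists_eq_add_of_le' hc
      rfl
    rw [key _ h2, mul_one, ← sum_cnt_insert R x j]
    refine (Finset.sum_congr rfl fun y _ => ?_).le
    rw [key _ (h2.trans (excess_le_insert i R x j y)), mul_one]
  have hstep : excessBound q L (excess i R) + q * excessBound q L (excess i R + 1) ≤
      excessBound q (L + 1) (excess i R) := by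
    have h3 : excess i R = 0 ∨ excess i R = 1 := by omega
    rcases h3 with h3 | h3 <;> rw [h3] <;> simp only [excessBound] <;> push_cast
    · nlinarith [sq_nonneg q, mul_nonneg (Nat.cast_nonneg (α := ℝ) L) (sq_nonneg q)]
    · linarith
  set C : Finset (Fin n) := insert i (R.image (fun e => e.2.2)) with hC
  have hCc : C.card ≤ m + 1 :=
    (Finset.card_insert_le _ _).trans
      (by have := Finset.card_image_le (s := R) (f := fun e => e.2.2); omega)
  have hB := excessBound_nonneg hq0 L (excess i R)
  have hB' := excessBound_nonneg hq0 L (excess i R + 1)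
  calc ∑ y, cnt (insert (x, j, y) R) * excessBound q L (excess i (insert (x, j, y) R))
      ≤ ∑ y, (cnt (insert (x, j, y) R) * excessBound q L (excess i R) +
          if y ∈ C then cnt R / (n - m) * excessBound q L (excess i R + 1) else 0) := by
        refine Finset.sum_le_sum fun y _ => ?_
        by_cases hy : y ∈ C
        · rw [if_pos hy, excess_insert_of_mem (hj y) hy]
          have h1 := cnt_insert_le_div hj y (m := m)
            (by exact_mod_cast (card_rowInfo_le R x).trans hR) hmn'
          have h2 := mul_le_mul_of_nonneg_right h1 hB'
          have h3 := mul_nonneg (cnt_nonneg (insert (x, j, y) R)) hB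
          linarith
        · rw [if_neg hy, excess_insert_of_notMem hy, add_zero]
    _ = cnt R * excessBound q L (excess i R) +
          C.card * (cnt R / (n - m) * excessBound q L (excess i R + 1)) := by
        rw [Finset.sum_add_distrib, ← Finset.sum_mul, sum_cnt_insert, Finset.sum_ite_mem,
          Finset.univ_inter, Finset.sum_const, nsmul_eq_mul]
    _ ≤ cnt R * excessBound q L (excess i R) +
          cnt R * (q * excessBound q L (excess i R + 1)) := by
        have h1 : (C.card : ℝ) ≤ m + 1 := by exact_mod_cast hCc
        have h2 : (C.card : ℝ) / (n - m) ≤ q :=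
          le_trans (div_le_div_of_nonneg_right h1 (by linarith)) hq
        have h3 : (C.card : ℝ) * (cnt R / (n - m) * excessBound q L (excess i R + 1)) =
          cnt R * ((C.card : ℝ) / (n - m) * excessBound q L (excess i R + 1)) := by ring
        rw [h3]
        have := cnt_nonneg R
        gcongr
    _ ≤ _ := by
        rw [← mul_add]
        exact mul_le_mul_of_nonneg_left hstep (cnt_nonneg R)

lemma esum_walkSum_excessBound_le {p : Fin n → Fin n → ℝ} (hp : ∀ i j, 0 ≤ p i j)
    (hrow : ∀ i, ∑ j, p i j = 1) {m : ℕ} {q : ℝ} (hmn : m < n)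
    (hq : (m + 1 : ℝ) / (n - m) ≤ q) (i : Fin n) (L r : ℕ) (x : Fin n) (R : Info n) (ρ : ℝ)
    (hR : R.card + r ≤ m) :
    esum R (fun σ => walkSum p σ (fun R _ => excessBound q L (excess i R)) r x R ρ) ≤
      cnt R * excessBound q (L + r) (excess i R) := by
  have hmn' : (m : ℝ) < n := by exact_mod_cast hmn
  have hq0 : 0 ≤ q := le_trans (div_nonneg (by positivity) (by linarith)) hq
  induction r generalizing x R ρ with
  | zero => simp only [walkSum, esum_const]; exact le_rfl
  | succ r ih =>
    rw [esum_walkSum_succ (fun _ R _ => excessBound q L (excess i R))]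
    calc _ ≤ ∑ j, p x j * (cnt R * excessBound q (L + r + 1) (excess i R)) := by
          refine Finset.sum_le_sum fun j _ => mul_le_mul_of_nonneg_left ?_ (hp x j)
          have h1 : ∀ y, esum (insert (x, j, y) R) (fun σ => walkSum p σ
              (fun R _ => excessBound q L (excess i R)) r y (insert (x, j, y) R) (ρ * p x j)) ≤
              cnt (insert (x, j, y) R) * excessBound q (L + r) (excess i (insert (x, j, y) R)) :=
            fun y => ih _ _ _ (by have := Finset.card_insert_le (x, j, y) R; omega)
          by_cases hj : ∀ y, (x, j, y) ∉ R
          · exact (Finset.sum_le_sum fun y _ => h1 y).trans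
              (sum_excessBound_le hmn hq i (by omega) hj (L + r))
          · push Not at hj
            obtain ⟨y₀, hy₀⟩ := hj
            have h2 := h1 y₀
            rw [Finset.insert_eq_of_mem hy₀] at h2
            rw [sum_esum_insert_of_mem hy₀ (fun y σ => walkSum p σ
              (fun R _ => excessBound q L (excess i R)) r y (insert (x, j, y) R) (ρ * p x j)),
              Finset.insert_eq_of_mem hy₀]
            exact h2.trans (mul_le_mul_of_nonneg_left
              (excessBound_mono hq0 (Nat.le_succ _) _) (cnt_nonneg R))
      _ = _ := by rw [← Finset.sum_mul, hrow, one_mul]; rfl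

/-- Chebyshev-type bound on the probability that a walk through unexplored vertices, with current
weight `ρ` and `r` remaining steps, ends with logarithmic weight at distance more than `a`
from `T`. -/
noncomputable def chebyshevBound (Θ q H V a T : ℝ) (r : ℕ) (ρ : ℝ) : ℝ :=
  Θ ^ r * (((-Real.log ρ - (T - r * H)) ^ 2 + r * V) / a ^ 2 + r * q)

/-- The same bound for a walk whose current vertex `x` is specified. -/
noncomputable def vertexBound (p : Fin n → Fin n → ℝ) (Θ q H V a T : ℝ) :
    ℕ → Fin n → ℝ → ℝ
  | 0, _, ρ => chebyshevBound Θ q H V a T 0 ρ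
  | r + 1, x, ρ => q + Θ * ∑ j, p x j * chebyshevBound Θ q H V a T r (ρ * p x j)

section annealed

variable {p : Fin n → Fin n → ℝ} {Θ q H V a T : ℝ}

lemma chebyshevBound_nonneg (hΘ : 0 ≤ Θ) (hq : 0 ≤ q) (hV : 0 ≤ V) (r : ℕ) (ρ : ℝ) :
    0 ≤ chebyshevBound Θ q H V a T r ρ := by
  unfold chebyshevBound
  positivity

lemma vertexBound_nonneg (hp : ∀ i j, 0 ≤ p i j) (hΘ : 0 ≤ Θ) (hq : 0 ≤ q) (hV : 0 ≤ V) (r : ℕ)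
    (x : Fin n) (ρ : ℝ) : 0 ≤ vertexBound p Θ q H V a T r x ρ := by
  cases r with
  | zero => exact chebyshevBound_nonneg hΘ hq hV 0 ρ
  | succ r =>
    exact add_nonneg hq (mul_nonneg hΘ (Finset.sum_nonneg fun j _ =>
      mul_nonneg (hp x j) (chebyshevBound_nonneg hΘ hq hV r _)))

lemma sum_vertexBound_le (hrow : ∀ i, ∑ j, p i j = 1)
    (hΘ : 1 ≤ Θ) (hq : 0 ≤ q) (hH : ∑ x, ∑ j, p x j * Real.log (p x j) = -(n * H))
    (hV : ∀ x, ∑ j, p x j * Real.log (p x j) ^ 2 ≤ V) (r : ℕ) {ρ : ℝ} (hρ : 0 < ρ) :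
    ∑ x, vertexBound p Θ q H V a T r x ρ ≤ n * chebyshevBound Θ q H V a T r ρ := by
  cases r with
  | zero => simp [vertexBound]
  | succ r =>
    simp only [vertexBound]
    set D : ℝ := -Real.log ρ - (T - (r + 1 : ℕ) * H) with hD
    have h1 : ∀ x j, p x j * chebyshevBound Θ q H V a T r (ρ * p x j) =
        Θ ^ r * (((D - H) ^ 2 + r * V) / a ^ 2 + r * q) * p x j +
        Θ ^ r / a ^ 2 * (-2 * (D - H)) * (p x j * Real.log (p x j)) +
        Θ ^ r / a ^ 2 * (p x j * Real.log (p x j) ^ 2) := by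
      intro x j
      by_cases h0 : p x j = 0
      · simp [h0]
      · rw [chebyshevBound, Real.log_mul hρ.ne' h0, hD]
        push_cast
        ring
    have h2 : ∑ x, (q + Θ * ∑ j, p x j * chebyshevBound Θ q H V a T r (ρ * p x j)) =
        n * q + Θ * (Θ ^ r * (((D - H) ^ 2 + r * V) / a ^ 2 + r * q) * n +
        Θ ^ r / a ^ 2 * (-2 * (D - H)) * (-(n * H)) +
        Θ ^ r / a ^ 2 * ∑ x, (∑ j, p x j * Real.log (p x j) ^ 2)) := by
      simp only [h1, Finset.sum_add_distrib, ← Finset.mul_sum, hrow, hH]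
      simp
    have h3 : ∑ x, (∑ j, p x j * Real.log (p x j) ^ 2) ≤ n * V := by
      refine (Finset.sum_le_sum fun x _ => hV x).trans ?_
      simp
    have hΘr : (1 : ℝ) ≤ Θ ^ (r + 1) := one_le_pow₀ hΘ
    rw [h2, chebyshevBound, ← hD]
    have h4 : Θ * (Θ ^ r / a ^ 2 * ∑ x, (∑ j, p x j * Real.log (p x j) ^ 2)) ≤
        Θ * (Θ ^ r / a ^ 2 * (n * V)) := by
      have : 0 ≤ Θ := by linarith
      gcongr
    have h5 : n * q ≤ n * (Θ ^ (r + 1) * q) :=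
      mul_le_mul_of_nonneg_left (le_mul_of_one_le_left hq hΘr) (Nat.cast_nonneg n)
    have h6 : 0 ≤ (n : ℝ) * (Θ ^ (r + 1) * (H ^ 2 / a ^ 2)) := by
      have : 0 ≤ Θ := by linarith
      positivity
    have h7 : n * (Θ ^ (r + 1) * ((D ^ 2 + (r + 1 : ℕ) * V) / a ^ 2 + (r + 1 : ℕ) * q)) =
        n * (Θ ^ (r + 1) * q) + Θ * (Θ ^ r * (((D - H) ^ 2 + r * V) / a ^ 2 + r * q) * n +
        Θ ^ r / a ^ 2 * (-2 * (D - H)) * (-(n * H))) + Θ * (Θ ^ r / a ^ 2 * (n * V)) +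
        n * (Θ ^ (r + 1) * (H ^ 2 / a ^ 2)) := by
      push_cast
      ring
    rw [h7, mul_add Θ]
    linarith

/-- One step of a walk along an entry that is not yet revealed. -/
lemma sum_esum_unrevealed_le (hp : ∀ i j, 0 ≤ p i j) (hrow : ∀ i, ∑ j, p i j = 1) {m : ℕ}
    (hmn : m < n) (hΘ : Θ = n / (n - m)) (hq : q = (m + 1) / (n - m))
    (hH : ∑ x, ∑ j, p x j * Real.log (p x j) = -(n * H))
    (hV : ∀ x, ∑ j, p x j * Real.log (p x j) ^ 2 ≤ V) {f : ℝ → ℝ} (hf1 : ∀ ρ, f ρ ≤ 1)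
    (hf : ∀ ρ, 0 < ρ → f ρ ≤ (-Real.log ρ - T) ^ 2 / a ^ 2) (r : ℕ) {R : Info n}
    (hR : R.card + (r + 1) ≤ m) {x j : Fin n} (hj : ∀ y, (x, j, y) ∉ R) {ρ : ℝ} (hρ : 0 < ρ) :
    ∑ y, esum (insert (x, j, y) R)
        (fun σ => walkSum p σ (fun _ => f) r y (insert (x, j, y) R) ρ) ≤
      cnt R * (q + Θ * chebyshevBound Θ q H V a T r ρ) := by
  have hmn' : (m : ℝ) < n := by exact_mod_cast hmn
  have hm0 : (0 : ℝ) ≤ m := Nat.cast_nonneg m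
  have hq0 : 0 ≤ q := by rw [hq]; exact div_nonneg (by positivity) (by linarith)
  have hΘ1 : 1 ≤ Θ := by rw [hΘ, le_div_iff₀ (by linarith)]; linarith
  have hΘ0 : 0 ≤ Θ := by linarith
  have hV0 : 0 ≤ V := (Finset.sum_nonneg fun j _ => mul_nonneg (hp x j) (sq_nonneg _)).trans (hV x)
  induction r generalizing R x j ρ with
  | zero =>
    have h1 : ∀ y, esum (insert (x, j, y) R)
        (fun σ => walkSum p σ (fun _ => f) 0 y (insert (x, j, y) R) ρ) =
        cnt (insert (x, j, y) R) * f ρ := fun y => by simp only [walkSum, esum_const]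
    simp only [h1, ← Finset.sum_mul, sum_cnt_insert]
    refine mul_le_mul_of_nonneg_left ?_ (cnt_nonneg R)
    have h2 := hf ρ hρ
    have h3 : chebyshevBound Θ q H V a T 0 ρ = (-Real.log ρ - T) ^ 2 / a ^ 2 := by
      simp [chebyshevBound]
    rw [h3]
    have : 0 ≤ (-Real.log ρ - T) ^ 2 / a ^ 2 := by positivity
    nlinarith
  | succ r ih =>
    set C : Finset (Fin n) := insert x (R.image (fun e => e.1)) with hC
    have hCc : C.card ≤ m + 1 := (Finset.card_insert_le _ _).trans
      (by have := Finset.card_image_le (s := R) (f := fun e => e.1); omega)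
    have hC' : (C.card : ℝ) ≤ m + 1 := by exact_mod_cast hCc
    have hnm : 0 < (n : ℝ) - m := by linarith
    have hins : ∀ y, cnt (insert (x, j, y) R) ≤ cnt R / (n - m) := fun y =>
      cnt_insert_le_div hj y (by exact_mod_cast (card_rowInfo_le R x).trans (by omega)) hmn'
    have hcn := cnt_nonneg R
    calc _ ≤ ∑ y, ((if y ∈ C then cnt R / (n - m) else 0) +
            cnt R / (n - m) * vertexBound p Θ q H V a T (r + 1) y ρ) := by
          refine Finset.sum_le_sum fun y _ => ?_
          have hv := vertexBound_nonneg (H := H) (a := a) (T := T) hp hΘ0 hq0 hV0 (r + 1) y ρ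
          by_cases hy : y ∈ C
          · rw [if_pos hy]
            have h1 : esum (insert (x, j, y) R) (fun σ => walkSum p σ (fun _ => f) (r + 1) y
                (insert (x, j, y) R) ρ) ≤ cnt (insert (x, j, y) R) :=
              esum_mono fun σ _ => walkSum_le hp hrow (fun _ => hf1) _ _ _ _
            have h2 : 0 ≤ cnt R / (n - m) * vertexBound p Θ q H V a T (r + 1) y ρ := by positivity
            linarith [hins y]
          · rw [if_neg hy, zero_add, esum_walkSum_succ (fun _ _ => f)]
            rw [hC, Finset.mem_insert, not_or] at hy
            have hnew : ∀ j' z, (y, j', z) ∉ insert (x, j, y) R := by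
              intro j' z h
              rcases Finset.mem_insert.1 h with h | h
              · exact hy.1 (congrArg Prod.fst h)
              · exact hy.2 (Finset.mem_image.2 ⟨_, h, rfl⟩)
            have hcard := Finset.card_insert_le (x, j, y) R
            calc _ ≤ ∑ j', p y j' * (cnt (insert (x, j, y) R) *
                  (q + Θ * chebyshevBound Θ q H V a T r (ρ * p y j'))) := by
                  refine Finset.sum_le_sum fun j' _ => ?_
                  rcases (hp y j').eq_or_lt with h0 | h0
                  · rw [← h0, zero_mul, zero_mul]
                  · exact mul_le_mul_of_nonneg_left
                      (ih (by omega) (hnew j') (mul_pos hρ h0)) h0.le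
              _ = cnt (insert (x, j, y) R) * vertexBound p Θ q H V a T (r + 1) y ρ := by
                  have : ∀ j', p y j' * (cnt (insert (x, j, y) R) *
                      (q + Θ * chebyshevBound Θ q H V a T r (ρ * p y j'))) =
                      cnt (insert (x, j, y) R) * (q * p y j' +
                      Θ * (p y j' * chebyshevBound Θ q H V a T r (ρ * p y j'))) := by
                    intro j'; ring
                  simp only [this, ← Finset.mul_sum, Finset.sum_add_distrib, hrow, mul_one,
                    vertexBound]
              _ ≤ _ := mul_le_mul_of_nonneg_right (hins y) hv
      _ = C.card * (cnt R / (n - m)) +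
            cnt R / (n - m) * ∑ y, vertexBound p Θ q H V a T (r + 1) y ρ := by
          rw [Finset.sum_add_distrib, ← Finset.mul_sum, Finset.sum_ite_mem,
            Finset.univ_inter, Finset.sum_const, nsmul_eq_mul]
      _ ≤ (m + 1) * (cnt R / (n - m)) +
            cnt R / (n - m) * (n * chebyshevBound Θ q H V a T (r + 1) ρ) := by
          have := sum_vertexBound_le (a := a) (T := T) hrow hΘ1 hq0 hH hV (r + 1) hρ
          gcongr
      _ = _ := by
          have h8 : ((n : ℝ) - m) ≠ 0 := hnm.ne'
          generalize chebyshevBound Θ q H V a T (r + 1) ρ = X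
          rw [hq, hΘ]
          field_simp

end annealed

/-- Adjacency matrix, with multiplicities, of the multigraph of the revealed transitions. -/
def infoMatrix (R : Info n) : Matrix (Fin n) (Fin n) ℕ :=
  fun x y => (R.filter fun e => e.1 = x ∧ e.2.2 = y).card

lemma infoMatrix_pow_succ (R : Info n) (s : ℕ) (i v : Fin n) :
    (infoMatrix R ^ (s + 1)) i v =
      ∑ e ∈ R.filter (fun e => e.2.2 = v), (infoMatrix R ^ s) i e.1 := by
  rw [pow_succ, Matrix.mul_apply]
  simp only [infoMatrix, Finset.card_filter, Finset.mul_sum]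
  rw [Finset.sum_comm, Finset.sum_filter]
  refine Finset.sum_congr rfl fun e _ => ?_
  by_cases hv : e.2.2 = v <;> simp [hv]

section injective

variable {R : Info n} {i : Fin n}

lemma infoMatrix_pow_le_one (h : Set.InjOn (fun e : Fin n × Fin n × Fin n => e.2.2) R)
    (s : ℕ) (v : Fin n) : (infoMatrix R ^ s) i v ≤ 1 := by
  induction s generalizing v with
  | zero =>
    rw [pow_zero, Matrix.one_apply]
    split_ifs <;> simp
  | succ s ih =>
    rw [infoMatrix_pow_succ]
    refine (Finset.sum_le_card_nsmul _ _ 1 fun e _ => ih e.1).trans ?_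
    rw [smul_eq_mul, mul_one, Finset.card_le_one]
    intro a ha b hb
    simp only [Finset.mem_filter] at ha hb
    exact h ha.1 hb.1 (ha.2.trans hb.2.symm)

end injective

section almostInjective

variable {R : Info n} {i u : Fin n}

/-- The vertex `v` is the endpoint of a walk of length `s` from `i`, along the transitions of
`R`, that avoids `u`. -/
def AvoidReach (R : Info n) (i u : Fin n) : ℕ → Fin n → Prop
  | 0, v => v = i
  | s + 1, v => v ≠ u ∧ ∃ e ∈ R, e.2.2 = v ∧ AvoidReach R i u s e.1

lemma infoMatrix_pow_of_unique (huniq : ∀ e ∈ R, ∀ e' ∈ R, e.2.2 = e'.2.2 → e.2.2 ≠ u → e = e')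
    (s : ℕ) {e : Fin n × Fin n × Fin n} (he : e ∈ R) (hu : e.2.2 ≠ u) :
    (infoMatrix R ^ (s + 1)) i e.2.2 = (infoMatrix R ^ s) i e.1 := by
  rw [infoMatrix_pow_succ, Finset.sum_eq_single_of_mem e (by simp [he])]
  intro b hb hbe
  rw [Finset.mem_filter] at hb
  exact absurd (huniq e he b hb.1 hb.2.symm hu).symm hbe

lemma infoMatrix_pow_of_avoidReach (hi : ∀ e ∈ R, e.2.2 ≠ i)
    (huniq : ∀ e ∈ R, ∀ e' ∈ R, e.2.2 = e'.2.2 → e.2.2 ≠ u → e = e') {d : ℕ} {v : Fin n}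
    (hv : AvoidReach R i u d v) (s : ℕ) :
    (infoMatrix R ^ s) i v = if s = d then 1 else 0 := by
  induction d generalizing v s with
  | zero =>
    obtain rfl : v = i := hv
    cases s with
    | zero => simp
    | succ s =>
      rw [infoMatrix_pow_succ, Finset.filter_false_of_mem hi]
      simp
  | succ d ih =>
    obtain ⟨hvu, e, he, rfl, hd⟩ := hv
    cases s with
    | zero => simp [(hi e he).symm]
    | succ s =>
      rw [infoMatrix_pow_of_unique huniq s he hvu, ih hd]
      simp

lemma infoMatrix_pow_le_of_two (hi : ∀ e ∈ R, e.2.2 ≠ i)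
    (huniq : ∀ e ∈ R, ∀ e' ∈ R, e.2.2 = e'.2.2 → e.2.2 ≠ u → e = e')
    {e₁ e₂ : Fin n × Fin n × Fin n} (htwo : ∀ e ∈ R, e.2.2 = u → e = e₁ ∨ e = e₂)
    {d : ℕ} (hd : AvoidReach R i u d e₁.1) (s : ℕ) (v : Fin n) :
    (infoMatrix R ^ s) i v ≤ s + 1 := by
  induction s generalizing v with
  | zero =>
    rw [pow_zero, Matrix.one_apply]
    split_ifs <;> simp
  | succ s ih =>
    by_cases hv : ∃ e ∈ R, e.2.2 = v
    · obtain ⟨e, he, rfl⟩ := hv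
      by_cases hu : e.2.2 = u
      · rw [infoMatrix_pow_succ]
        have hsub : R.filter (fun a => a.2.2 = e.2.2) ⊆ {e₁, e₂} := by
          intro a ha
          rw [Finset.mem_filter] at ha
          simpa using htwo a ha.1 (ha.2.trans hu)
        refine (Finset.sum_le_sum_of_subset hsub).trans ?_
        have h1 : (infoMatrix R ^ s) i e₁.1 ≤ 1 := by
          rw [infoMatrix_pow_of_avoidReach hi huniq hd]
          split_ifs <;> simp
        have h2 := ih e₂.1
        by_cases h12 : e₁ = e₂
        · subst h12
          simp only [Finset.insert_eq_of_mem, Finset.mem_singleton, Finset.sum_singleton]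
          omega
        · rw [Finset.sum_pair h12]
          omega
      · rw [infoMatrix_pow_of_unique huniq s he hu]
        exact (ih e.1).trans (by omega)
    · push Not at hv
      rw [infoMatrix_pow_succ, Finset.filter_false_of_mem hv]
      simp

end almostInjective

lemma infoMatrix_pow_le {R : Info n} {i : Fin n} (hR : excess i R ≤ 1) (s : ℕ) (v : Fin n) :
    (infoMatrix R ^ s) i v ≤ s + 1 := by
  by_cases hinj : Set.InjOn (fun e : Fin n × Fin n × Fin n => e.2.2) R
  · exact (infoMatrix_pow_le_one hinj s v).trans (by omega)
  rw [Set.InjOn] at hinj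
  push Not at hinj
  obtain ⟨e₁, he₁, e₂, he₂, h12, hne⟩ := hinj
  simp only [Finset.mem_coe] at he₁ he₂ h12
  have key : ∀ a ∈ R, ∀ b ∈ R, a.2.2 = b.2.2 → a ≠ b →
      Set.InjOn (fun e : Fin n × Fin n × Fin n => e.2.2) (R.erase a) ∧
        ∀ e ∈ R.erase a, e.2.2 ≠ i := by
    intro a ha b hb hab hne
    have himg : (R.erase a).image (fun e => e.2.2) = R.image (fun e => e.2.2) := by
      refine (Finset.image_subset_image (Finset.erase_subset _ _)).antisymm ?_
      intro z hz
      obtain ⟨e, he, rfl⟩ := Finset.mem_image.1 hz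
      by_cases hea : e = a
      · subst hea
        exact Finset.mem_image.2 ⟨b, by simp [hb, hne.symm], hab.symm⟩
      · exact Finset.mem_image.2 ⟨e, by simp [hea, he], rfl⟩
    have hc1 : ((R.image (fun e => e.2.2)).erase i).card ≤ (R.image (fun e => e.2.2)).card :=
      Finset.card_erase_le
    have hc2 : ((R.erase a).image (fun e => e.2.2)).card ≤ (R.erase a).card :=
      Finset.card_image_le
    have hc3 := Finset.card_erase_add_one ha
    rw [himg] at hc2
    unfold excess at hR
    constructor
    · refine Finset.card_image_iff.1 ?_
      rw [himg]
      omega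
    · intro e he hei
      have hmem : i ∈ R.image (fun e => e.2.2) := by
        rw [← himg]
        exact Finset.mem_image.2 ⟨e, he, hei⟩
      have := Finset.card_erase_lt_of_mem hmem
      omega
  obtain ⟨hj₁, hi₁⟩ := key e₁ he₁ e₂ he₂ h12 hne
  have hi : ∀ e ∈ R, e.2.2 ≠ i := by
    intro e he
    by_cases hee : e = e₁
    · rw [hee, h12]
      exact hi₁ e₂ (by simp [he₂, Ne.symm hne])
    · exact hi₁ e (by simp [he, hee])
  have huniq : ∀ e ∈ R, ∀ e' ∈ R, e.2.2 = e'.2.2 → e.2.2 ≠ e₂.2.2 → e = e' := by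
    intro e he e' he' hee hu
    refine hj₁ ?_ ?_ hee
    · have : e ≠ e₁ := fun h => hu (h ▸ h12)
      simp [this, he]
    · have : e' ≠ e₁ := fun h => hu (hee.trans (h ▸ h12))
      simp [this, he']
  have htwo : ∀ e ∈ R, e.2.2 = e₂.2.2 → e = e₁ ∨ e = e₂ := by
    intro e he heu
    by_cases hee : e = e₁
    · exact Or.inl hee
    · exact Or.inr (hj₁ (by simp [hee, he]) (by simp [he₂, Ne.symm hne]) heu)
  by_cases hd₁ : ∃ d, AvoidReach R i e₂.2.2 d e₁.1
  · exact infoMatrix_pow_le_of_two hi huniq htwo hd₁.choose_spec s v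
  by_cases hd₂ : ∃ d, AvoidReach R i e₂.2.2 d e₂.1
  · exact infoMatrix_pow_le_of_two hi huniq (fun e he h => (htwo e he h).symm)
      hd₂.choose_spec s v
  have hreach : ∀ s v, 0 < (infoMatrix R ^ s) i v → AvoidReach R i e₂.2.2 s v := by
    intro s
    induction s with
    | zero =>
      intro v hv
      by_contra hne
      rw [pow_zero, Matrix.one_apply, if_neg (Ne.symm hne)] at hv
      exact lt_irrefl _ hv
    | succ s ih =>
      intro v hv
      rw [infoMatrix_pow_succ] at hv
      obtain ⟨e, he, hpos⟩ := Finset.exists_ne_zero_of_sum_ne_zero hv.ne'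
      rw [Finset.mem_filter] at he
      have hs := ih e.1 (Nat.pos_of_ne_zero hpos)
      refine ⟨?_, e, he.1, he.2, hs⟩
      intro hvu
      rcases htwo e he.1 (he.2.trans hvu) with rfl | rfl
      · exact hd₁ ⟨s, hs⟩
      · exact hd₂ ⟨s, hs⟩
  rcases Nat.eq_zero_or_pos ((infoMatrix R ^ s) i v) with h | h
  · omega
  · rw [infoMatrix_pow_of_avoidReach hi huniq (hreach s v h)]
    split_ifs <;> omega

lemma sum_infoMatrix_pow_le {R : Info n} {i : Fin n} (hR : excess i R ≤ 1) (s : ℕ) :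
    ∑ v, (infoMatrix R ^ s) i v ≤ (s + 1) * (R.card + 1) := by
  have hsub : ∑ v ∈ insert i (R.image (fun e => e.2.2)), (infoMatrix R ^ s) i v =
      ∑ v, (infoMatrix R ^ s) i v := by
    refine Finset.sum_subset (Finset.subset_univ _) fun v _ hv => ?_
    simp only [Finset.mem_insert, Finset.mem_image, not_or, not_exists, not_and] at hv
    cases s with
    | zero => simp [Ne.symm hv.1]
    | succ s =>
      rw [infoMatrix_pow_succ, Finset.filter_false_of_mem hv.2]
      simp
  rw [← hsub]
  refine (Finset.sum_le_card_nsmul _ _ (s + 1) fun v _ => infoMatrix_pow_le hR s v).trans ?_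
  rw [smul_eq_mul, mul_comm]
  gcongr
  exact (Finset.card_insert_le _ _).trans (Nat.succ_le_succ Finset.card_image_le)

/-- Quenched probability that a walk from `x` with current weight `ρ` uses only entries of `R`
during `u` steps, or until its weight drops below `κ`. -/
noncomputable def killSum (p : Fin n → Fin n → ℝ) (R : Info n) (κ : ℝ) : ℕ → Fin n → ℝ → ℝ
  | 0, _, _ => 1
  | u + 1, x, ρ =>
      if ρ < κ then 1
      else ∑ j, p x j * ∑ y, if (x, j, y) ∈ R then killSum p R κ u y (ρ * p x j) else 0

/-- Every trajectory of length `u` from `x`, with initial weight `ρ`, has weight at most `w`. -/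
def WalksLe (p : Fin n → Fin n → ℝ) (σ : Env n) (w : ℝ) : ℕ → Fin n → ℝ → Prop
  | 0, _, ρ => ρ ≤ w
  | u + 1, x, ρ => ∀ j, WalksLe p σ w u (σ x j) (ρ * p x j)

section killSum

variable {p : Fin n → Fin n → ℝ} {R : Info n} {κ : ℝ}

lemma killSum_nonneg (hp : ∀ i j, 0 ≤ p i j) (u : ℕ) (x : Fin n) (ρ : ℝ) :
    0 ≤ killSum p R κ u x ρ := by
  induction u generalizing x ρ with
  | zero => exact zero_le_one
  | succ u ih =>
    rw [killSum]
    split_ifs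
    · exact zero_le_one
    · refine Finset.sum_nonneg fun j _ => mul_nonneg (hp x j) (Finset.sum_nonneg fun y _ => ?_)
      split_ifs
      · exact ih _ _
      · exact le_rfl

/-- Number of walks of length `s` from `x` along the entries of `R`. -/
def walkCount (R : Info n) (s : ℕ) (x : Fin n) : ℕ := ∑ v, (infoMatrix R ^ s) x v

lemma walkCount_zero (R : Info n) (x : Fin n) : walkCount R 0 x = 1 := by
  simp [walkCount, Matrix.one_apply]

lemma walkCount_succ (R : Info n) (s : ℕ) (x : Fin n) :
    walkCount R (s + 1) x = ∑ j, ∑ y, if (x, j, y) ∈ R then walkCount R s y else 0 := by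
  have h1 : ∀ y, infoMatrix R x y = ∑ j, if (x, j, y) ∈ R then 1 else 0 := by
    intro y
    rw [← Finset.card_filter, infoMatrix]
    refine Finset.card_bij' (fun e _ => e.2.1) (fun j _ => (x, j, y)) ?_ ?_ ?_ ?_
    · rintro ⟨a, b, c⟩ h
      simp only [Finset.mem_filter] at h
      obtain ⟨h, rfl, rfl⟩ := h
      simpa using h
    · intro j h
      simpa using h
    · rintro ⟨a, b, c⟩ h
      simp only [Finset.mem_filter] at h
      obtain ⟨h, rfl, rfl⟩ := h
      rfl
    · intro j _
      rfl
  unfold walkCount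
  simp only [pow_succ', Matrix.mul_apply]
  rw [Finset.sum_comm]
  simp only [← Finset.mul_sum]
  rw [Finset.sum_comm (f := fun j y => if (x, j, y) ∈ R then _ else 0)]
  refine Finset.sum_congr rfl fun y _ => ?_
  rw [h1, Finset.sum_mul]
  simp

lemma mul_killSum_le (hp : ∀ i j, 0 ≤ p i j) (hκ : 0 ≤ κ) {w : ℝ} {σ : Env n}
    (hσ : Agrees σ R) (u : ℕ) (x : Fin n) {ρ : ℝ} (hρ : 0 ≤ ρ) (hw : WalksLe p σ w u x ρ) :
    ρ * killSum p R κ u x ρ ≤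
      κ * ∑ s ∈ Finset.range u, (walkCount R s x : ℝ) + w * walkCount R u x := by
  induction u generalizing x ρ with
  | zero =>
    simpa [killSum, walkCount_zero] using show ρ ≤ w from hw
  | succ u ih =>
    have hw0 : 0 ≤ w := by
      clear ih
      induction u generalizing x ρ with
      | zero => exact (mul_nonneg hρ (hp x x)).trans (hw x)
      | succ u ih => exact ih (σ x x) (mul_nonneg hρ (hp x x)) (hw x)
    rw [killSum]
    split_ifs with hlt
    · rw [Finset.sum_range_succ', walkCount_zero]
      have h1 : 0 ≤ κ * ∑ s ∈ Finset.range u, (walkCount R (s + 1) x : ℝ) := by positivity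
      have h2 : 0 ≤ w * walkCount R (u + 1) x := by positivity
      push_cast
      nlinarith
    · have hcast : ∀ s, (walkCount R (s + 1) x : ℝ) =
          ∑ j, ∑ y, if (x, j, y) ∈ R then (walkCount R s y : ℝ) else 0 := by
        intro s
        rw [walkCount_succ]
        push_cast
        rfl
      have hstep : ρ * ∑ j, p x j *
          ∑ y, (if (x, j, y) ∈ R then killSum p R κ u y (ρ * p x j) else 0) ≤
          ∑ j, ∑ y, if (x, j, y) ∈ R then
            (κ * ∑ s ∈ Finset.range u, (walkCount R s y : ℝ) + w * walkCount R u y) else 0 := by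
        rw [Finset.mul_sum]
        refine Finset.sum_le_sum fun j _ => ?_
        rw [← mul_assoc, Finset.mul_sum]
        refine Finset.sum_le_sum fun y _ => ?_
        split_ifs with hmem
        · refine ih y (mul_nonneg hρ (hp x j)) ?_
          have := hw j
          rwa [show σ x j = y from hσ _ hmem] at this
        · simp
      refine hstep.trans ?_
      rw [Finset.sum_range_succ', mul_add κ, add_assoc]
      simp only [hcast]
      have heq : (∑ j, ∑ y, if (x, j, y) ∈ R then
            (κ * ∑ s ∈ Finset.range u, (walkCount R s y : ℝ) + w * walkCount R u y) else 0) =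
          κ * ∑ s ∈ Finset.range u, ∑ j, ∑ y,
            (if (x, j, y) ∈ R then (walkCount R s y : ℝ) else 0) +
          w * ∑ j, ∑ y, if (x, j, y) ∈ R then (walkCount R u y : ℝ) else 0 := by
        rw [Finset.sum_comm (s := Finset.range u)]
        simp only [Finset.mul_sum, ← Finset.sum_add_distrib]
        refine Finset.sum_congr rfl fun j _ => ?_
        rw [Finset.sum_comm (s := Finset.range u), ← Finset.sum_add_distrib]
        refine Finset.sum_congr rfl fun y _ => ?_
        split_ifs <;> simp
      rw [heq]
      have : 0 ≤ κ * (walkCount R 0 x : ℝ) := by positivity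
      linarith

lemma killSum_le_of_excess (hp : ∀ i j, 0 ≤ p i j) (hκ : 0 ≤ κ) {w : ℝ} (hw0 : 0 ≤ w) {σ : Env n}
    (hσ : Agrees σ R) {h : ℕ} {i : Fin n} (hw : WalksLe p σ w h i 1) (hR : excess i R ≤ 1) :
    killSum p R κ h i 1 ≤ (h + 1) * (R.card + 1) * (h * κ + w) := by
  have h1 := mul_killSum_le hp hκ hσ h i zero_le_one hw
  rw [one_mul] at h1
  have h2 : ∀ s ≤ h, (walkCount R s i : ℝ) ≤ (h + 1) * (R.card + 1) := by
    intro s hs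
    have h3 : walkCount R s i ≤ (h + 1) * (R.card + 1) :=
      (sum_infoMatrix_pow_le hR s).trans (by gcongr)
    exact_mod_cast h3
  have h3 : ∑ s ∈ Finset.range h, (walkCount R s i : ℝ) ≤ h * ((h + 1) * (R.card + 1)) := by
    refine (Finset.sum_le_card_nsmul _ _ _ fun s hs =>
      h2 s (Finset.mem_range.1 hs).le).trans ?_
    simp
  calc _ ≤ κ * ∑ s ∈ Finset.range h, (walkCount R s i : ℝ) + w * walkCount R h i := h1
    _ ≤ κ * (h * ((h + 1) * (R.card + 1))) + w * ((h + 1) * (R.card + 1)) := by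
      gcongr
      exact h2 h le_rfl
    _ = _ := by ring

end killSum

lemma neg_log_sub_sq_le {ρ a c κ H : ℝ} {s h : ℕ} (hκ : 0 < κ) (hρ : κ ≤ ρ) (hρ1 : ρ ≤ 1)
    (ha : a ≠ 0) (hc : c = -Real.log (ρ * a) - (s + 1) * H) (hH : 0 ≤ H) (hs : s + 1 ≤ h) :
    c ^ 2 ≤ 3 * (Real.log κ ^ 2 + Real.log a ^ 2 + (h * H) ^ 2) := by
  have h1 : Real.log κ ≤ Real.log ρ := Real.log_le_log hκ hρ
  have h2 : Real.log ρ ≤ 0 := Real.log_nonpos (hκ.le.trans hρ) hρ1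
  have h3 : Real.log ρ ^ 2 ≤ Real.log κ ^ 2 := by nlinarith
  have h4 : ((s : ℝ) + 1) * H ≤ h * H := by
    have : ((s : ℝ) + 1) ≤ h := by exact_mod_cast hs
    gcongr
  have h5 : (((s : ℝ) + 1) * H) ^ 2 ≤ (h * H) ^ 2 := by gcongr
  rw [hc, Real.log_mul (hκ.trans_le hρ).ne' ha]
  nlinarith [sq_nonneg (Real.log ρ - Real.log a), sq_nonneg (Real.log ρ - (s + 1) * H),
    sq_nonneg (Real.log a - (s + 1) * H)]

section killing

variable {p : Fin n → Fin n → ℝ} {Θ q H V a κ : ℝ}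

lemma esum_walkSum_le_killSum (hp : ∀ i j, 0 ≤ p i j) (hrow : ∀ i, ∑ j, p i j = 1) {m : ℕ}
    (hmn : m < n) (hΘ : Θ = n / (n - m)) (hq : q = (m + 1) / (n - m))
    (hH : ∑ x, ∑ j, p x j * Real.log (p x j) = -(n * H)) (hH0 : 0 ≤ H)
    (hV : ∀ x, ∑ j, p x j * Real.log (p x j) ^ 2 ≤ V) {f : ℝ → ℝ} (hf1 : ∀ ρ, f ρ ≤ 1)
    {t h r : ℕ} (ht : h + r = t)
    (hf : ∀ ρ, 0 < ρ → f ρ ≤ (-Real.log ρ - t * H) ^ 2 / a ^ 2) (hκ : 0 < κ) {R : Info n}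
    {s u : ℕ} (hsu : s + u = h) (hR : R.card + (u + r) ≤ m) {x : Fin n} {ρ : ℝ} (hρ : 0 < ρ)
    (hρ1 : ρ ≤ 1) :
    esum R (fun σ => walkSum p σ (fun _ => f) (u + r) x R ρ) ≤
      cnt R * (killSum p R κ u x ρ +
        (q + Θ ^ t * ((3 * (Real.log κ ^ 2 + (h * H) ^ 2) + t * V) / a ^ 2 + t * q)) +
        u * (3 * Θ ^ t * V / a ^ 2)) := by
  have hmn' : (m : ℝ) < n := by exact_mod_cast hmn
  have hm0 : (0 : ℝ) ≤ m := Nat.cast_nonneg m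
  have hq0 : 0 ≤ q := by rw [hq]; exact div_nonneg (by positivity) (by linarith)
  have hΘ1 : 1 ≤ Θ := by rw [hΘ, le_div_iff₀ (by linarith)]; linarith
  have hΘ0 : 0 ≤ Θ := by linarith
  have hV0 : 0 ≤ V := (Finset.sum_nonneg fun j _ => mul_nonneg (hp x j) (sq_nonneg _)).trans (hV x)
  have hp1 : ∀ x j, p x j ≤ 1 := fun x j =>
    (Finset.single_le_sum (fun j _ => hp x j) (Finset.mem_univ j)).trans (hrow x).le
  set c₁ := q + Θ ^ t * ((3 * (Real.log κ ^ 2 + (h * H) ^ 2) + t * V) / a ^ 2 + t * q) with hc₁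
  have hc₁0 : 0 ≤ c₁ := by positivity
  have htriv : ∀ u x ρ, esum R (fun σ => walkSum p σ (fun _ => f) (u + r) x R ρ) ≤ cnt R * 1 := by
    intro u x ρ
    rw [← esum_const]
    exact esum_mono fun σ _ => walkSum_le hp hrow (fun _ => hf1) _ _ _ _
  induction u generalizing s x ρ with
  | zero =>
    refine (htriv _ _ _).trans (mul_le_mul_of_nonneg_left ?_ (cnt_nonneg R))
    simp only [killSum]
    push_cast
    linarith
  | succ u ih =>
    by_cases hlt : ρ < κ
    · refine (htriv _ _ _).trans (mul_le_mul_of_nonneg_left ?_ (cnt_nonneg R))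
      rw [killSum, if_pos hlt]
      have : 0 ≤ ((u + 1 : ℕ) : ℝ) * (3 * Θ ^ t * V / a ^ 2) := by positivity
      linarith
    rw [killSum, if_neg hlt, show u + 1 + r = (u + r) + 1 by ring,
      esum_walkSum_succ (fun _ _ => f)]
    have hterm : ∀ j, p x j * ∑ y, esum (insert (x, j, y) R)
        (fun σ => walkSum p σ (fun _ => f) (u + r) y (insert (x, j, y) R) (ρ * p x j)) ≤
        cnt R * (p x j * (∑ y, if (x, j, y) ∈ R then killSum p R κ u y (ρ * p x j) else 0) +
          p x j * (c₁ + u * (3 * Θ ^ t * V / a ^ 2)) +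
          3 * Θ ^ t / a ^ 2 * (p x j * Real.log (p x j) ^ 2)) := by
      intro j
      rcases (hp x j).eq_or_lt with h0 | hpos
      · simp [← h0]
      have hρp : 0 < ρ * p x j := mul_pos hρ hpos
      have hK : 0 ≤ ∑ y, if (x, j, y) ∈ R then killSum p R κ u y (ρ * p x j) else 0 := by
        refine Finset.sum_nonneg fun y _ => ?_
        split_ifs
        · exact killSum_nonneg hp _ _ _
        · exact le_rfl
      have hlog : 0 ≤ 3 * Θ ^ t / a ^ 2 * Real.log (p x j) ^ 2 := by positivity
      have hu : 0 ≤ (u : ℝ) * (3 * Θ ^ t * V / a ^ 2) := by positivity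
      suffices hs : ∑ y, esum (insert (x, j, y) R)
          (fun σ => walkSum p σ (fun _ => f) (u + r) y (insert (x, j, y) R) (ρ * p x j)) ≤
          cnt R * ((∑ y, if (x, j, y) ∈ R then killSum p R κ u y (ρ * p x j) else 0) +
            (c₁ + u * (3 * Θ ^ t * V / a ^ 2)) + 3 * Θ ^ t / a ^ 2 * Real.log (p x j) ^ 2) by
        refine (mul_le_mul_of_nonneg_left hs hpos.le).trans (le_of_eq ?_)
        ring
      by_cases hj : ∀ y, (x, j, y) ∉ R
      · refine (sum_esum_unrevealed_le hp hrow hmn hΘ hq hH hV hf1 hf (u + r) (by omega) hj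
          hρp).trans (mul_le_mul_of_nonneg_left ?_ (cnt_nonneg R))
        have hcast : (t : ℝ) * H - ((u + r : ℕ) : ℝ) * H = (s + 1) * H := by
          have : (t : ℝ) = s + (u + 1) + r := by rw [← ht, ← hsu]; push_cast; ring
          rw [this]; push_cast; ring
        have hsq := neg_log_sub_sq_le hκ (not_lt.1 hlt) hρ1 hpos.ne' rfl hH0
          (show s + 1 ≤ h by omega)
        have hpow : Θ * Θ ^ (u + r) ≤ Θ ^ t := by
          rw [← pow_succ']
          exact pow_le_pow_right₀ hΘ1 (by omega)
        have hrt : ((u + r : ℕ) : ℝ) ≤ t := by exact_mod_cast (by omega)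
        have hcheb : Θ * chebyshevBound Θ q H V a (t * H) (u + r) (ρ * p x j) ≤
            Θ ^ t * ((3 * (Real.log κ ^ 2 + Real.log (p x j) ^ 2 + (h * H) ^ 2) + t * V) / a ^ 2 +
              t * q) := by
          rw [chebyshevBound, hcast, ← mul_assoc]
          gcongr
        have hsplit : Θ ^ t * ((3 * (Real.log κ ^ 2 + Real.log (p x j) ^ 2 + (h * H) ^ 2) +
              t * V) / a ^ 2 + t * q) =
            (c₁ - q) + 3 * Θ ^ t / a ^ 2 * Real.log (p x j) ^ 2 := by
          rw [hc₁]; ring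
        linarith
      · push Not at hj
        obtain ⟨y₀, hy₀⟩ := hj
        rw [sum_esum_insert_of_mem hy₀ (fun y σ =>
          walkSum p σ (fun _ => f) (u + r) y (insert (x, j, y) R) (ρ * p x j)),
          Finset.insert_eq_of_mem hy₀]
        refine (ih (s := s + 1) (by omega) (by omega) hρp
          (mul_le_one₀ hρ1 hpos.le (hp1 x j))).trans
          (mul_le_mul_of_nonneg_left ?_ (cnt_nonneg R))
        have hle : killSum p R κ u y₀ (ρ * p x j) ≤
            ∑ y, if (x, j, y) ∈ R then killSum p R κ u y (ρ * p x j) else 0 := by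
          refine le_trans (by rw [if_pos hy₀]) (Finset.single_le_sum (f := fun y =>
            if (x, j, y) ∈ R then killSum p R κ u y (ρ * p x j) else 0) (fun y _ => ?_)
            (Finset.mem_univ y₀))
          split_ifs
          · exact killSum_nonneg hp _ _ _
          · exact le_rfl
        linarith
    refine (Finset.sum_le_sum fun j _ => hterm j).trans ?_
    rw [← Finset.mul_sum]
    refine mul_le_mul_of_nonneg_left ?_ (cnt_nonneg R)
    rw [Finset.sum_add_distrib, Finset.sum_add_distrib, ← Finset.sum_mul, hrow, ← Finset.mul_sum]
    have h4 : 3 * Θ ^ t / a ^ 2 * ∑ j, p x j * Real.log (p x j) ^ 2 ≤ 3 * Θ ^ t / a ^ 2 * V :=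
      mul_le_mul_of_nonneg_left (hV x) (by positivity)
    have h5 : 3 * Θ ^ t / a ^ 2 * V = 3 * Θ ^ t * V / a ^ 2 := by ring
    push_cast
    linarith

end killing

section trajectories

variable {p : Fin n → Fin n → ℝ} {σ : Env n}

/-- Endpoint of the trajectory from `x` that reads the column labels `J`. -/
def walkEnd (σ : Env n) : Fin n → List (Fin n) → Fin n
  | x, [] => x
  | x, j :: J => walkEnd σ (σ x j) J

/-- Vertices visited, endpoint excluded, by the trajectory from `x` that reads `J`. -/
def sources (σ : Env n) : Fin n → List (Fin n) → List (Fin n)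
  | _, [] => []
  | x, j :: J => x :: sources σ (σ x j) J

/-- Weight of the trajectory from `x` that reads `J`. -/
def labelWeight (p : Fin n → Fin n → ℝ) (σ : Env n) : Fin n → List (Fin n) → ℝ
  | _, [] => 1
  | x, j :: J => p x j * labelWeight p σ (σ x j) J

lemma sources_append (x : Fin n) (J J' : List (Fin n)) :
    sources σ x (J ++ J') = sources σ x J ++ sources σ (walkEnd σ x J) J' := by
  induction J generalizing x with
  | nil => rfl
  | cons j J ih => exact congrArg (x :: ·) (ih _)

lemma labelWeight_append (x : Fin n) (J J' : List (Fin n)) :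
    labelWeight p σ x (J ++ J') = labelWeight p σ x J * labelWeight p σ (walkEnd σ x J) J' := by
  induction J generalizing x with
  | nil => simp [labelWeight, walkEnd]
  | cons j J ih => simp only [List.cons_append, labelWeight, walkEnd, ih, mul_assoc]

lemma labelWeight_nonneg (hp : ∀ i j, 0 ≤ p i j) (x : Fin n) (J : List (Fin n)) :
    0 ≤ labelWeight p σ x J := by
  induction J generalizing x with
  | nil => exact zero_le_one
  | cons j J ih => exact mul_nonneg (hp x j) (ih _)

lemma labelWeight_le_one (hp : ∀ i j, 0 ≤ p i j) (hp1 : ∀ i j, p i j ≤ 1) (x : Fin n)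
    (J : List (Fin n)) : labelWeight p σ x J ≤ 1 := by
  induction J generalizing x with
  | nil => exact le_rfl
  | cons j J ih => exact mul_le_one₀ (hp1 x j) (labelWeight_nonneg hp _ _) (ih _)

lemma exists_append_of_mem_sources {x z : Fin n} {J : List (Fin n)} (h : z ∈ sources σ x J) :
    ∃ C D, J = C ++ D ∧ walkEnd σ x C = z ∧ D ≠ [] := by
  induction J generalizing x with
  | nil => simp [sources] at h
  | cons j J ih =>
    rw [sources, List.mem_cons] at h
    rcases h with rfl | h
    · exact ⟨[], j :: J, rfl, rfl, by simp⟩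
    · obtain ⟨C, D, rfl, hz, hD⟩ := ih h
      exact ⟨j :: C, D, rfl, hz, hD⟩

lemma exists_simple_cycle {x : Fin n} {J : List (Fin n)} (h : ¬ (sources σ x J).Nodup) :
    ∃ A C D, J = A ++ (C ++ D) ∧ C ≠ [] ∧
      walkEnd σ (walkEnd σ x A) C = walkEnd σ x A ∧ (sources σ (walkEnd σ x A) C).Nodup := by
  induction J generalizing x with
  | nil => simp [sources] at h
  | cons j J ih =>
    by_cases hJ : (sources σ (σ x j) J).Nodup
    · rw [sources, List.nodup_cons, not_and_or, not_not] at h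
      obtain ⟨C, D, rfl, hz, hD⟩ := exists_append_of_mem_sources (h.resolve_right (not_not.2 hJ))
      refine ⟨[], j :: C, D, rfl, by simp, hz, ?_⟩
      rw [sources_append, List.nodup_append] at hJ
      refine List.nodup_cons.2 ⟨fun hx => ?_, hJ.1⟩
      obtain ⟨d, D, rfl⟩ := List.exists_cons_of_ne_nil hD
      exact hJ.2.2 _ hx (walkEnd σ (σ x j) C) (by simp [sources]) hz.symm
    · obtain ⟨A, C, D, rfl, hC, hcl, hnd⟩ := ih hJ
      exact ⟨j :: A, C, D, rfl, hC, hcl, hnd⟩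

lemma labelWeight_pow_le (hp : ∀ i j, 0 ≤ p i j) (hp1 : ∀ i j, p i j ≤ 1) {β L : ℕ} (hL : 0 < L)
    (hcycle : ∀ x J, J ≠ [] → J.length ≤ L → walkEnd σ x J = x → (sources σ x J).Nodup →
      labelWeight p σ x J ^ β ≤ Real.exp (-(J.length : ℝ)))
    (hpath : ∀ x J, J.length = L → (sources σ x J).Nodup →
      labelWeight p σ x J ^ β ≤ Real.exp (-(L : ℝ))) (x : Fin n) (J : List (Fin n)) :
    labelWeight p σ x J ^ β ≤ Real.exp ((L : ℝ) - J.length) := by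
  induction hN : J.length using Nat.strong_induction_on generalizing J x with
  | _ N ih =>
    subst hN
    by_cases hlt : J.length < L
    · refine (pow_le_one₀ (labelWeight_nonneg hp x J) (labelWeight_le_one hp hp1 x J)).trans ?_
      have : (J.length : ℝ) ≤ L := by exact_mod_cast hlt.le
      exact Real.one_le_exp (by linarith)
    have htake : (J.take L).length = L := by simp; omega
    have hsplit : J = J.take L ++ J.drop L := (List.take_append_drop L J).symm
    by_cases hnd : (sources σ x (J.take L)).Nodup
    · have h1 := hpath x (J.take L) htake hnd
      have hlen : (J.drop L).length < J.length := by simp; omega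
      have h2 := ih _ hlen (walkEnd σ x (J.take L)) (J.drop L) rfl
      have h3 : (J.length : ℝ) = L + (J.drop L).length := by
        have : J.length = L + (J.drop L).length := by simp; omega
        exact_mod_cast this
      conv_lhs => rw [hsplit]
      rw [labelWeight_append, mul_pow]
      refine (mul_le_mul h1 h2 (pow_nonneg (labelWeight_nonneg hp _ _) _)
        (Real.exp_pos _).le).trans ?_
      rw [← Real.exp_add, h3]
      exact Real.exp_le_exp.2 (by linarith)
    · obtain ⟨A, C, D, hACD, hC, hcl, hC'⟩ := exists_simple_cycle hnd
      have hJ : J = A ++ (C ++ (D ++ J.drop L)) := by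
        rw [hACD] at hsplit
        simpa using hsplit
      have hlen : A.length + (C.length + D.length) = L := by
        rw [← htake, hACD]; simp
      have hC0 : 0 < C.length := List.length_pos_iff.2 hC
      have hJlen : J.length = A.length + (C.length + (D ++ J.drop L).length) := by
        conv_lhs => rw [hJ]
        simp
      have h1 := hcycle (walkEnd σ x A) C hC (by omega) hcl hC'
      have h2 := ih (A ++ (D ++ J.drop L)).length
        (by rw [List.length_append]; omega) x (A ++ (D ++ J.drop L)) rfl
      have h3 : (J.length : ℝ) = C.length + (A ++ (D ++ J.drop L)).length := by
        have : J.length = C.length + (A ++ (D ++ J.drop L)).length := by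
          rw [List.length_append]; omega
        exact_mod_cast this
      have h4 : labelWeight p σ x J = labelWeight p σ (walkEnd σ x A) C *
          labelWeight p σ x (A ++ (D ++ J.drop L)) := by
        conv_lhs => rw [hJ]
        rw [labelWeight_append, labelWeight_append, hcl, labelWeight_append (σ := σ) x A]
        ring
      rw [h4, mul_pow]
      refine (mul_le_mul h1 h2 (pow_nonneg (labelWeight_nonneg hp _ _) _)
        (Real.exp_pos _).le).trans ?_
      rw [← Real.exp_add, h3]
      exact Real.exp_le_exp.2 (by linarith)

lemma walksLe_of_labelWeight {w : ℝ} (u : ℕ) (x : Fin n) (ρ : ℝ)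
    (h : ∀ J : List (Fin n), J.length = u → ρ * labelWeight p σ x J ≤ w) :
    WalksLe p σ w u x ρ := by
  induction u generalizing x ρ with
  | zero =>
    show ρ ≤ w
    simpa [labelWeight] using h [] rfl
  | succ u ih =>
    intro j
    refine ih _ _ fun J hJ => ?_
    have := h (j :: J) (by simp [hJ])
    rwa [labelWeight, ← mul_assoc] at this

/-- Sum over the self-avoiding trajectories of length `ℓ` from `x`, whose sources avoid `S`, of
the `β`-th power of the weight times the value of `g` at the endpoint. -/
noncomputable def avoidSum (p : Fin n → Fin n → ℝ) (β : ℕ) (σ : Env n) (g : Fin n → ℝ) :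
    ℕ → Finset (Fin n) → Fin n → ℝ
  | 0, _, x => g x
  | l + 1, S, x =>
      if x ∈ S then 0 else ∑ j, p x j ^ β * avoidSum p β σ g l (insert x S) (σ x j)

lemma avoidSum_nonneg (hp : ∀ i j, 0 ≤ p i j) {β : ℕ} {g : Fin n → ℝ} (hg : ∀ x, 0 ≤ g x)
    (l : ℕ) (S : Finset (Fin n)) (x : Fin n) : 0 ≤ avoidSum p β σ g l S x := by
  induction l generalizing S x with
  | zero => exact hg x
  | succ l ih =>
    rw [avoidSum]
    split_ifs
    · exact le_rfl
    · exact Finset.sum_nonneg fun j _ => mul_nonneg (pow_nonneg (hp x j) _) (ih _ _)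

lemma labelWeight_pow_mul_le_avoidSum (hp : ∀ i j, 0 ≤ p i j) {β : ℕ} {g : Fin n → ℝ}
    (hg : ∀ x, 0 ≤ g x) (x : Fin n) (J : List (Fin n)) (S : Finset (Fin n))
    (hnd : (sources σ x J).Nodup) (hS : ∀ z ∈ sources σ x J, z ∉ S) :
    labelWeight p σ x J ^ β * g (walkEnd σ x J) ≤ avoidSum p β σ g J.length S x := by
  induction J generalizing x S with
  | nil => simp [labelWeight, walkEnd, avoidSum]
  | cons j J ih =>
    rw [sources, List.nodup_cons] at hnd
    rw [sources] at hS
    have hx : x ∉ S := hS x (by simp)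
    rw [List.length_cons, avoidSum, if_neg hx, labelWeight, walkEnd, mul_pow, mul_assoc]
    have h1 := ih (σ x j) (insert x S) hnd.2 (by
      intro z hz
      rw [Finset.mem_insert, not_or]
      exact ⟨fun hzx => hnd.1 (hzx ▸ hz), hS z (by simp [hz])⟩)
    refine (mul_le_mul_of_nonneg_left h1 (pow_nonneg (hp x j) _)).trans ?_
    exact Finset.single_le_sum (f := fun j => p x j ^ β *
      avoidSum p β σ g J.length (insert x S) (σ x j)) (fun j _ =>
      mul_nonneg (pow_nonneg (hp x j) _) (avoidSum_nonneg hp hg _ _ _)) (Finset.mem_univ j)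

/-- Average over the rows of the sum of the `β`-th powers of the entries. -/
noncomputable def powAvg (p : Fin n → Fin n → ℝ) (β : ℕ) : ℝ :=
  (∑ x, ∑ j, p x j ^ β) / n

lemma powAvg_nonneg (hp : ∀ i j, 0 ≤ p i j) (β : ℕ) : 0 ≤ powAvg p β :=
  div_nonneg (Finset.sum_nonneg fun x _ => Finset.sum_nonneg fun j _ => pow_nonneg (hp x j) _)
    (Nat.cast_nonneg n)

lemma esum_avoidSum_succ_le (hp : ∀ i j, 0 ≤ p i j) {β : ℕ} {g : Fin n → ℝ} (hg : ∀ x, 0 ≤ g x)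
    (l : ℕ) {S : Finset (Fin n)} {R : Info n} (hR : ∀ e ∈ R, e.1 ∈ S) (x : Fin n) :
    esum R (fun σ => avoidSum p β σ g (l + 1) S x) ≤
      cnt R * ((∑ j, p x j ^ β) * (powAvg p β ^ l * ((∑ y, g y) / n))) := by
  induction l generalizing S R x with
  | zero =>
    by_cases hx : x ∈ S
    · simp only [avoidSum, hx, if_true]
      rw [esum_const, mul_zero]
      exact mul_nonneg (cnt_nonneg R) (mul_nonneg (Finset.sum_nonneg fun j _ =>
        pow_nonneg (hp x j) _) (mul_nonneg (pow_nonneg (powAvg_nonneg hp β) _)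
          (div_nonneg (Finset.sum_nonneg fun y _ => hg y) (Nat.cast_nonneg n))))
    have hn : 0 < n := x.pos
    have hj : ∀ j y, (x, j, y) ∉ R := fun j y h => hx (hR _ h)
    have hrow0 : (rowInfo R x).card ≤ 0 := by
      rw [Nat.le_zero, Finset.card_eq_zero, rowInfo, Finset.filter_eq_empty_iff]
      exact fun e he hex => hx (hex ▸ hR e he)
    simp only [avoidSum, hx, if_false]
    rw [esum_sum, Finset.sum_mul, Finset.mul_sum]
    refine Finset.sum_le_sum fun j _ => ?_
    rw [esum_mul_left, ← sum_esum_insert R x j (fun y _ => g y)]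
    simp only [esum_const]
    have h1 : ∀ y, cnt (insert (x, j, y) R) * g y ≤ cnt R / n * g y := fun y => by
      refine mul_le_mul_of_nonneg_right ?_ (hg y)
      simpa using cnt_insert_le_div (hj j) y (m := 0) (by exact_mod_cast hrow0)
          (by exact_mod_cast hn)
    refine (mul_le_mul_of_nonneg_left (Finset.sum_le_sum fun y _ => h1 y)
      (pow_nonneg (hp x j) _)).trans (le_of_eq ?_)
    rw [← Finset.mul_sum]
    ring
  | succ l ih =>
    by_cases hx : x ∈ S
    · simp only [avoidSum, hx, if_true]
      rw [esum_const, mul_zero]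
      exact mul_nonneg (cnt_nonneg R) (mul_nonneg (Finset.sum_nonneg fun j _ =>
        pow_nonneg (hp x j) _) (mul_nonneg (pow_nonneg (powAvg_nonneg hp β) _)
          (div_nonneg (Finset.sum_nonneg fun y _ => hg y) (Nat.cast_nonneg n))))
    have hn : 0 < n := x.pos
    have hj : ∀ j y, (x, j, y) ∉ R := fun j y h => hx (hR _ h)
    have hrow0 : (rowInfo R x).card ≤ 0 := by
      rw [Nat.le_zero, Finset.card_eq_zero, rowInfo, Finset.filter_eq_empty_iff]
      exact fun e he hex => hx (hex ▸ hR e he)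
    have hdef : ∀ σ, avoidSum p β σ g (l + 1 + 1) S x =
        ∑ j, p x j ^ β * avoidSum p β σ g (l + 1) (insert x S) (σ x j) := fun σ => by
      rw [avoidSum, if_neg hx]
    simp only [hdef]
    rw [esum_sum, Finset.sum_mul, Finset.mul_sum]
    refine Finset.sum_le_sum fun j _ => ?_
    rw [esum_mul_left, ← sum_esum_insert R x j
      (fun y σ => avoidSum p β σ g (l + 1) (insert x S) y)]
    have hc0 : 0 ≤ powAvg p β ^ l * ((∑ y, g y) / n) :=
      mul_nonneg (pow_nonneg (powAvg_nonneg hp β) _)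
        (div_nonneg (Finset.sum_nonneg fun y _ => hg y) (Nat.cast_nonneg n))
    have h1 : ∀ y, esum (insert (x, j, y) R)
        (fun σ => avoidSum p β σ g (l + 1) (insert x S) y) ≤
        cnt R / n * ((∑ j, p y j ^ β) * (powAvg p β ^ l * ((∑ y, g y) / n))) := fun y => by
      refine (ih (S := insert x S) (R := insert (x, j, y) R) ?_ y).trans ?_
      · intro e he
        rw [Finset.mem_insert] at he
        rcases he with rfl | he
        · exact Finset.mem_insert_self _ _
        · exact Finset.mem_insert_of_mem (hR e he)
      · refine mul_le_mul_of_nonneg_right ?_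
          (mul_nonneg (Finset.sum_nonneg fun j _ => pow_nonneg (hp y j) _) hc0)
        simpa using cnt_insert_le_div (hj j) y (m := 0) (by exact_mod_cast hrow0)
          (by exact_mod_cast hn)
    refine (mul_le_mul_of_nonneg_left (Finset.sum_le_sum fun y _ => h1 y)
      (pow_nonneg (hp x j) _)).trans (le_of_eq ?_)
    rw [← Finset.mul_sum, ← Finset.sum_mul, pow_succ, powAvg]
    ring

/-- Bound on the expected number of environments with a heavy trajectory of length `2 * L`. -/
lemma esum_not_walksLe_le (hp : ∀ i j, 0 ≤ p i j) (hp1 : ∀ i j, p i j ≤ 1) (hn : 0 < n)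
    {β L : ℕ} (hβ : 0 < β) (hL : 0 < L) :
    esum ∅ (fun σ => if ∀ x, WalksLe p σ (Real.exp (-(L / β : ℝ))) (2 * L) x 1 then 0 else 1) ≤
      cnt (∅ : Info n) * (n * (Real.exp 1 * powAvg p β) ^ L +
        ∑ l ∈ Finset.range L, (Real.exp 1 * powAvg p β) ^ (l + 1)) := by
  have hn' : (n : ℝ) ≠ 0 := by positivity
  have hexp : ∀ l : ℕ, Real.exp l = Real.exp 1 ^ l := fun l => by rw [← Real.exp_nat_mul, mul_one]
  have hpt : ∀ σ : Env n,
      (if ∀ x, WalksLe p σ (Real.exp (-(L / β : ℝ))) (2 * L) x 1 then (0 : ℝ) else 1) ≤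
      Real.exp 1 ^ L * ∑ x, avoidSum p β σ (fun _ => 1) L ∅ x +
      ∑ l ∈ Finset.range L, Real.exp 1 ^ (l + 1) *
        ∑ x, avoidSum p β σ (fun y => if y = x then 1 else 0) (l + 1) ∅ x := by
    intro σ
    have hg : ∀ x y : Fin n, (0 : ℝ) ≤ if y = x then 1 else 0 := fun x y => by
      split_ifs <;> norm_num
    have hA : 0 ≤ Real.exp 1 ^ L * ∑ x, avoidSum p β σ (fun _ => 1) L ∅ x :=
      mul_nonneg (by positivity) (Finset.sum_nonneg fun x _ =>
        avoidSum_nonneg hp (fun _ => zero_le_one) _ _ _)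
    have hBt : ∀ l ∈ Finset.range L, 0 ≤ Real.exp 1 ^ (l + 1) *
        ∑ x, avoidSum p β σ (fun y => if y = x then 1 else 0) (l + 1) ∅ x := fun l _ =>
      mul_nonneg (by positivity) (Finset.sum_nonneg fun x _ =>
        avoidSum_nonneg hp (hg x) _ _ _)
    have hB := Finset.sum_nonneg hBt
    split_ifs with hG
    · linarith
    by_contra hlt
    rw [not_le] at hlt
    refine hG fun x => walksLe_of_labelWeight _ _ _ fun J hJ => ?_
    have key := labelWeight_pow_le (σ := σ) hp hp1 (β := β) hL ?_ ?_ x J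
    · rw [one_mul]
      refine le_of_pow_le_pow_left₀ hβ.ne' (Real.exp_pos _).le (key.trans ?_)
      rw [← Real.exp_nat_mul, hJ]
      refine Real.exp_le_exp.2 (le_of_eq ?_)
      have : (β : ℝ) ≠ 0 := by positivity
      push_cast
      field_simp
      ring
    · intro x J hJ hJL hcl hnd
      by_contra hbad
      rw [not_le] at hbad
      obtain ⟨l, hl⟩ := Nat.exists_eq_succ_of_ne_zero (List.length_pos_iff.2 hJ).ne'
      have h1 := labelWeight_pow_mul_le_avoidSum (σ := σ) (β := β) hp (hg x) x J ∅ hnd (by simp)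
      rw [if_pos hcl, mul_one, hl] at h1
      rw [hl, Real.exp_neg, hexp] at hbad
      have h2 : 1 < Real.exp 1 ^ (l + 1) *
          avoidSum p β σ (fun y => if y = x then 1 else 0) (l + 1) ∅ x := by
        have h3 := hbad.trans_le h1
        rwa [inv_lt_iff_one_lt_mul₀' (by positivity)] at h3
      have h3 := Finset.single_le_sum (f := fun x => avoidSum p β σ
        (fun y => if y = x then 1 else 0) (l + 1) ∅ x) (fun x _ =>
        avoidSum_nonneg hp (hg x) _ _ _) (Finset.mem_univ x)
      have h4 := Finset.single_le_sum hBt (Finset.mem_range.2 (show l < L by omega))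
      have h5 := mul_le_mul_of_nonneg_left h3 (by positivity : 0 ≤ Real.exp 1 ^ (l + 1))
      linarith
    · intro x J hJL hnd
      by_contra hbad
      rw [not_le] at hbad
      have h1 := labelWeight_pow_mul_le_avoidSum (σ := σ) (β := β) hp
        (g := fun _ => 1) (fun _ => zero_le_one) x J ∅ hnd (by simp)
      rw [mul_one, hJL] at h1
      rw [Real.exp_neg, hexp] at hbad
      have h2 : 1 < Real.exp 1 ^ L * avoidSum p β σ (fun _ => 1) L ∅ x := by
        have h3 := hbad.trans_le h1
        rwa [inv_lt_iff_one_lt_mul₀' (by positivity)] at h3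
      have h3 := Finset.single_le_sum (f := fun x => avoidSum p β σ
        (fun _ => 1) L ∅ x) (fun x _ =>
        avoidSum_nonneg hp (fun _ => zero_le_one) _ _ _) (Finset.mem_univ x)
      have h5 := mul_le_mul_of_nonneg_left h3 (by positivity : 0 ≤ Real.exp 1 ^ L)
      linarith
  refine (esum_mono fun σ _ => hpt σ).trans ?_
  rw [esum_add, esum_mul_left, esum_sum, esum_sum, mul_add, Finset.mul_sum, Finset.mul_sum]
  have hsum : ∑ x, ∑ j, p x j ^ β = n * powAvg p β := by
    rw [powAvg]; field_simp
  refine add_le_add ?_ (Finset.sum_le_sum fun l _ => ?_)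
  · obtain ⟨l, rfl⟩ := Nat.exists_eq_succ_of_ne_zero hL.ne'
    rw [← Finset.mul_sum]
    refine (mul_le_mul_of_nonneg_left (Finset.sum_le_sum fun x _ =>
      esum_avoidSum_succ_le hp (fun _ => zero_le_one) l (S := ∅) (R := ∅) (by simp) x)
      (pow_nonneg (Real.exp_pos _).le _)).trans (le_of_eq ?_)
    rw [← Finset.mul_sum, ← Finset.sum_mul, hsum]
    simp only [Finset.sum_const, Finset.card_univ, Fintype.card_fin, nsmul_eq_mul, mul_one,
      div_self hn', Nat.succ_eq_add_one]
    ring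
  · rw [esum_mul_left, esum_sum]
    have hg : ∀ x y : Fin n, (0 : ℝ) ≤ if y = x then 1 else 0 := fun x y => by
      split_ifs <;> norm_num
    refine (mul_le_mul_of_nonneg_left (Finset.sum_le_sum fun x _ =>
      esum_avoidSum_succ_le hp (hg x) l (by simp) x) (by positivity)).trans (le_of_eq ?_)
    simp only [Finset.sum_ite_eq', Finset.mem_univ, if_true]
    rw [← Finset.mul_sum, ← Finset.sum_mul, hsum]
    field_simp
    ring

end trajectories

section moments

variable {p : Fin n → Fin n → ℝ}

lemma esum_pow_le (hp : ∀ i j, 0 ≤ p i j) (hrow : ∀ i, ∑ j, p i j = 1) {m : ℕ} (hmn : m < n)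
    {q : ℝ} (hq : (m + 1 : ℝ) / (n - m) ≤ q) {f : ℝ → ℝ} (hf0 : ∀ ρ, 0 ≤ f ρ)
    (hf1 : ∀ ρ, f ρ ≤ 1) {G : Env n → Prop} {i : Fin n} {t : ℕ} {δ : ℝ} (hδ : 0 ≤ δ)
    (hone : ∀ R : Info n, R.card + t ≤ m → excess i R ≤ 1 → (∃ σ, Agrees σ R ∧ G σ) →
      esum R (fun σ => walkSum p σ (fun _ => f) t i R 1) ≤ cnt R * δ)
    (k : ℕ) (R : Info n) (hR : R.card + k * t ≤ m) :
    esum R (fun σ => if G σ then walkSum p σ (fun _ => f) t i ∅ 1 ^ k else 0) ≤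
      cnt R * (δ ^ k + excessBound q (k * t) (excess i R)) := by
  have hmn' : (m : ℝ) < n := by exact_mod_cast hmn
  have hq0 : 0 ≤ q := le_trans (div_nonneg (by positivity) (by linarith)) hq
  have hQ0 : ∀ σ, 0 ≤ walkSum p σ (fun _ => f) t i ∅ 1 := fun σ =>
    walkSum_nonneg hp (fun _ => hf0) _ _ _ _
  have hQ1 : ∀ σ, walkSum p σ (fun _ => f) t i ∅ 1 ≤ 1 := fun σ =>
    walkSum_le hp hrow (fun _ => hf1) _ _ _ _
  have htriv : ∀ (k : ℕ) (R : Info n),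
      esum R (fun σ => if G σ then walkSum p σ (fun _ => f) t i ∅ 1 ^ k else 0) ≤ cnt R := by
    intro k R
    rw [cnt]
    refine esum_mono fun σ _ => ?_
    split_ifs
    · exact pow_le_one₀ (hQ0 σ) (hQ1 σ)
    · exact zero_le_one
  induction k generalizing R with
  | zero =>
    refine (htriv 0 R).trans (le_mul_of_one_le_right (cnt_nonneg R) ?_)
    have := excessBound_nonneg hq0 (0 * t) (excess i R)
    rw [pow_zero]
    linarith
  | succ k ih =>
    have hδk : 0 ≤ δ ^ (k + 1) := pow_nonneg hδ _
    by_cases hex : 2 ≤ excess i R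
    · refine (htriv (k + 1) R).trans (le_mul_of_one_le_right (cnt_nonneg R) ?_)
      obtain ⟨c, hc⟩ := Nat.exists_eq_add_of_le hex
      rw [hc, add_comm 2 c, excessBound]
      linarith
    by_cases hG : ∃ σ, Agrees σ R ∧ G σ
    · have h1 : ∀ σ, (if G σ then walkSum p σ (fun _ => f) t i ∅ 1 ^ (k + 1) else 0) =
          walkSum p σ (fun _ ρ => f ρ *
            (if G σ then walkSum p σ (fun _ => f) t i ∅ 1 ^ k else 0)) t i R 1 := by
        intro σ
        rw [walkSum_mul σ (fun _ => f), walkSum_info σ f t i R ∅]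
        split_ifs
        · rw [pow_succ, mul_comm]
        · rw [mul_zero]
      simp only [h1]
      have h2 := esum_walkSum_le_of_le hp (m := m - k * t)
        (f := fun σ _ ρ => f ρ * (if G σ then walkSum p σ (fun _ => f) t i ∅ 1 ^ k else 0))
        (b := fun R ρ => f ρ * δ ^ k + excessBound q (k * t) (excess i R))
        (by
          intro R ρ hRm
          rw [esum_mul_left]
          have h3 := ih R (by
            have : k * t ≤ (k + 1) * t := Nat.mul_le_mul_right t (Nat.le_succ k)
            omega)
          refine (mul_le_mul_of_nonneg_left h3 (hf0 ρ)).trans ?_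
          have h4 := excessBound_nonneg hq0 (k * t) (excess i R)
          have h5 : f ρ * excessBound q (k * t) (excess i R) ≤
              excessBound q (k * t) (excess i R) := mul_le_of_le_one_left h4 (hf1 ρ)
          calc _ = cnt R * (f ρ * δ ^ k + f ρ * excessBound q (k * t) (excess i R)) := by ring
            _ ≤ _ := mul_le_mul_of_nonneg_left (by linarith) (cnt_nonneg R))
        t i R 1 (by
          have : (k + 1) * t = k * t + t := Nat.succ_mul k t
          omega)
      refine h2.trans ?_
      have hkt : (k + 1) * t = k * t + t := Nat.succ_mul k t
      have h3 : ∀ σ, walkSum p σ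
          (fun R ρ => f ρ * δ ^ k + excessBound q (k * t) (excess i R)) t i R 1 =
          walkSum p σ (fun _ => f) t i R 1 * δ ^ k +
          walkSum p σ (fun R _ => excessBound q (k * t) (excess i R)) t i R 1 := by
        intro σ
        rw [walkSum_add σ (fun _ ρ => f ρ * δ ^ k), walkSum_mul σ (fun _ => f)]
      simp only [h3]
      rw [esum_add, esum_mul_right]
      have h4 := mul_le_mul_of_nonneg_right (hone R (by omega) (by omega) hG)
        (pow_nonneg hδ k)
      have h5 := esum_walkSum_excessBound_le hp hrow hmn hq i (k * t) t i R 1 (by omega)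
      rw [hkt, pow_succ]
      linarith
    · have h0 : esum R (fun σ =>
          if G σ then walkSum p σ (fun _ => f) t i ∅ 1 ^ (k + 1) else 0) = esum R fun _ => 0 :=
        esum_congr fun σ hσ => if_neg fun h => hG ⟨σ, hσ, h⟩
      rw [h0, esum_const, mul_zero]
      exact mul_nonneg (cnt_nonneg R) (add_nonneg hδk (excessBound_nonneg hq0 _ _))

lemma walkSum_eq_sum_pathWeight (σ : Env n) (g : ℝ → ℝ) (t : ℕ) (i : Fin n) (R : Info n)
    (ρ : ℝ) :
    walkSum p σ (fun _ => g) t i R ρ =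
      ∑ x : Fin (t + 1) → Fin n, if x 0 = i then
        pathWeight n t (Pmat n p σ) x * g (ρ * pathWeight n t (Pmat n p σ) x) else 0 := by
  induction t generalizing i R ρ with
  | zero =>
    rw [← Equiv.sum_comp (Equiv.funUnique (Fin 1) (Fin n)).symm]
    simp [walkSum, pathWeight]
  | succ t ih =>
    rw [← Equiv.sum_comp (Fin.consEquiv (fun _ => Fin n)), Fintype.sum_prod_type]
    have hw : ∀ (y : Fin n) (x : Fin (t + 1) → Fin n),
        pathWeight n (t + 1) (Pmat n p σ) (Fin.cons y x : Fin (t + 2) → Fin n) =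
          Pmat n p σ y (x 0) * pathWeight n t (Pmat n p σ) x := by
      intro y x
      rw [pathWeight, Fin.prod_univ_succ]
      rfl
    have hcons : ∀ (y : Fin n) (x : Fin (t + 1) → Fin n),
        Fin.consEquiv (fun _ => Fin n) (y, x) = (Fin.cons y x : Fin (t + 2) → Fin n) :=
      fun _ _ => rfl
    simp only [hcons, Fin.cons_zero, hw]
    rw [Finset.sum_comm]
    simp only [Finset.sum_ite_eq', Finset.mem_univ, if_true, walkSum, ih, Finset.mul_sum]
    rw [Finset.sum_comm]
    refine Finset.sum_congr rfl fun x _ => ?_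
    rw [Finset.sum_eq_single_of_mem ((σ i).symm (x 0)) (Finset.mem_univ _)]
    · simp only [Equiv.apply_symm_apply, if_true, Pmat]
      rw [mul_assoc, mul_assoc]
    · intro j _ hj
      rw [if_neg, mul_zero]
      intro h
      exact hj (by rw [h, Equiv.symm_apply_apply])

lemma quenched_eq_walkSum (σ : Env n) (B : ℝ → Prop) [DecidablePred B] (t : ℕ)
    (i : Fin n) (R : Info n) :
    quenched n t (Pmat n p σ) i (fun x => B (pathWeight n t (Pmat n p σ) x)) =
      walkSum p σ (fun _ ρ => if B ρ then 1 else 0) t i R 1 := by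
  rw [walkSum_eq_sum_pathWeight, quenched]
  refine Finset.sum_congr rfl fun x _ => ?_
  rw [one_mul]
  by_cases h1 : x 0 = i <;> by_cases h2 : B (pathWeight n t (Pmat n p σ) x) <;> simp [h1, h2]

end moments

lemma Pr_le_of_esum_le {E : Env n → Prop} {Y : Env n → ℝ} {c : ℝ} (h0 : ∀ σ, 0 ≤ Y σ)
    (h1 : ∀ σ, E σ → 1 ≤ Y σ) (hc : esum ∅ Y ≤ cnt (∅ : Info n) * c) : Pr n E ≤ c := by
  have hcard : (0 : ℝ) < Fintype.card (Env n) := by exact_mod_cast Fintype.card_pos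
  rw [Pr, div_le_iff₀ hcard, ← cnt_empty, mul_comm c]
  refine le_trans ?_ hc
  simp only [esum, Agrees, Finset.notMem_empty, false_imp_iff, implies_true, if_true]
  refine Finset.sum_le_sum fun σ _ => ?_
  split_ifs with h
  · exact h1 σ h
  · exact h0 σ

section deviation

variable {p : Fin n → Fin n → ℝ} {Θ q H V κ ε : ℝ}

lemma indicator_le_of_log {t : ℕ} (ha : 0 < ε * (t * H)) {ρ : ℝ} (hρ : 0 < ρ) :
    (if ρ ∉ Set.Icc (Real.exp (-(1 + ε) * H * t)) (Real.exp (-(1 - ε) * H * t)) then (1 : ℝ)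
      else 0) ≤ (-Real.log ρ - t * H) ^ 2 / (ε * (t * H)) ^ 2 := by
  by_cases h : ρ ∈ Set.Icc (Real.exp (-(1 + ε) * H * t)) (Real.exp (-(1 - ε) * H * t))
  · rw [if_neg (not_not.2 h)]
    positivity
  · rw [if_pos h, one_le_div (by positivity)]
    rw [Set.mem_Icc, not_and_or, not_le, not_le, ← Real.log_lt_iff_lt_exp hρ,
      ← Real.lt_log_iff_exp_lt hρ] at h
    rcases h with h | h
    · have : ε * (t * H) ≤ -Real.log ρ - t * H := by linarith
      gcongr
    · rw [← neg_sq (-Real.log ρ - t * H)]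
      have : ε * (t * H) ≤ -(-Real.log ρ - t * H) := by linarith
      gcongr

/-- Quantitative form of the concentration of the quenched trajectory weight. -/
lemma Pr_quenched_le (hp : ∀ i j, 0 ≤ p i j) (hrow : ∀ i, ∑ j, p i j = 1) {m : ℕ} (hmn : m < n)
    (hΘ : Θ = n / (n - m)) (hq : q = (m + 1) / (n - m)) (hH0 : 0 < H) (hHdef : H = avgEntropy n p)
    (hV : ∀ x, ∑ j, p x j * Real.log (p x j) ^ 2 ≤ V) (hε : 0 < ε) {t k L β : ℕ} (ht : 0 < t)
    (hkt : k * t ≤ m) (hL : 0 < L) (hLt : 2 * L ≤ t) (hβ : 0 < β) (hκ : 0 < κ) {δ η : ℝ}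
    (hη : 0 < η)
    (hδ : (2 * L + 1 : ℝ) * (m + 1) * (2 * L * κ + Real.exp (-(L / β))) +
      (q + Θ ^ t * ((3 * (Real.log κ ^ 2 + (2 * L * H) ^ 2) + t * V) / (ε * (t * H)) ^ 2 + t * q)) +
      2 * L * (3 * Θ ^ t * V / (ε * (t * H)) ^ 2) ≤ δ) :
    Pr n (fun σ => ∃ i : Fin n, η < quenched n t (Pmat n p σ) i (fun x =>
        pathWeight n t (Pmat n p σ) x ∉
          Set.Icc (Real.exp (-(1 + ε) * avgEntropy n p * (t : ℝ)))
            (Real.exp (-(1 - ε) * avgEntropy n p * (t : ℝ))))) ≤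
      n * ((δ / η) ^ k + (k * t * q) ^ 2 / η ^ k) +
        (n * (Real.exp 1 * powAvg p β) ^ L +
          ∑ l ∈ Finset.range L, (Real.exp 1 * powAvg p β) ^ (l + 1)) := by
  have hmn' : (m : ℝ) < n := by exact_mod_cast hmn
  have hn : 0 < n := by omega
  have hm0 : (0 : ℝ) ≤ m := Nat.cast_nonneg m
  have hq0 : 0 ≤ q := by rw [hq]; exact div_nonneg (by positivity) (by linarith)
  have hΘ1 : 1 ≤ Θ := by rw [hΘ, le_div_iff₀ (by linarith)]; linarith
  have hΘ0 : 0 ≤ Θ := by linarith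
  have hp1 : ∀ x j, p x j ≤ 1 := fun x j =>
    (Finset.single_le_sum (fun j _ => hp x j) (Finset.mem_univ j)).trans (hrow x).le
  have hV0 : 0 ≤ V := (Finset.sum_nonneg fun j _ => mul_nonneg (hp _ j) (sq_nonneg _)).trans
    (hV ⟨0, hn⟩)
  have ha : 0 < ε * (t * H) := by positivity
  have hHsum : ∑ x, ∑ j, p x j * Real.log (p x j) = -(n * H) := by
    have : (n : ℝ) ≠ 0 := by positivity
    rw [hHdef, avgEntropy]
    field_simp
  rw [← hHdef]
  set f : ℝ → ℝ := fun ρ => if ρ ∉ Set.Icc (Real.exp (-(1 + ε) * H * t))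
    (Real.exp (-(1 - ε) * H * t)) then (1 : ℝ) else 0 with hf
  have hf0 : ∀ ρ, 0 ≤ f ρ := fun ρ => by simp only [hf]; split_ifs <;> norm_num
  have hf1 : ∀ ρ, f ρ ≤ 1 := fun ρ => by simp only [hf]; split_ifs <;> norm_num
  have hQ : ∀ (σ : Env n) (i : Fin n), quenched n t (Pmat n p σ) i (fun x =>
        pathWeight n t (Pmat n p σ) x ∉ Set.Icc (Real.exp (-(1 + ε) * H * (t : ℝ)))
            (Real.exp (-(1 - ε) * H * (t : ℝ)))) = walkSum p σ (fun _ => f) t i ∅ 1 :=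
    fun σ i => quenched_eq_walkSum σ (fun ρ => ρ ∉ Set.Icc (Real.exp (-(1 + ε) * H * (t : ℝ)))
      (Real.exp (-(1 - ε) * H * (t : ℝ)))) t i ∅
  simp only [hQ]
  obtain ⟨G, hG⟩ : ∃ G : Env n → Prop,
      ∀ σ, G σ ↔ ∀ x, WalksLe p σ (Real.exp (-(L / β : ℝ))) (2 * L) x 1 := ⟨_, fun _ => Iff.rfl⟩
  have hδ0 : 0 ≤ δ := by
    refine le_trans ?_ hδ
    positivity
  have hone : ∀ i : Fin n, ∀ R : Info n, R.card + t ≤ m → excess i R ≤ 1 →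
      (∃ σ, Agrees σ R ∧ G σ) →
      esum R (fun σ => walkSum p σ (fun _ => f) t i R 1) ≤ cnt R * δ := by
    rintro i R hR hex ⟨σ, hσ, hGσ⟩
    have h1 := esum_walkSum_le_killSum hp hrow hmn hΘ hq hHsum hH0.le hV hf1
      (a := ε * (t * H)) (h := 2 * L) (r := t - 2 * L) (t := t) (by omega)
      (fun ρ hρ => indicator_le_of_log ha hρ) hκ (R := R) (s := 0) (u := 2 * L) (by omega)
      (by omega) (x := i) zero_lt_one le_rfl
    rw [show 2 * L + (t - 2 * L) = t by omega] at h1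
    refine h1.trans (mul_le_mul_of_nonneg_left (le_trans ?_ hδ) (cnt_nonneg R))
    have h2 := killSum_le_of_excess hp hκ.le (Real.exp_pos _).le hσ ((hG σ).1 hGσ i) hex
    have hRm : (R.card : ℝ) ≤ m := by exact_mod_cast (by omega)
    have h3 : (((2 * L : ℕ) : ℝ) + 1) * (R.card + 1) *
        (((2 * L : ℕ) : ℝ) * κ + Real.exp (-(L / β))) ≤
        (2 * L + 1 : ℝ) * (m + 1) * (2 * L * κ + Real.exp (-(L / β))) := by
      push_cast
      gcongr
    push_cast at h2 h3 ⊢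
    linarith
  set Y : Env n → ℝ := fun σ =>
    (∑ i, (if G σ then walkSum p σ (fun _ => f) t i ∅ 1 ^ k else 0) * (η ^ k)⁻¹) +
      if G σ then 0 else 1 with hY
  have hnn : ∀ (σ : Env n), ∀ i ∈ Finset.univ,
      0 ≤ (if G σ then walkSum p σ (fun _ => f) t i ∅ 1 ^ k else 0) * (η ^ k)⁻¹ := by
    intro σ i _
    refine mul_nonneg ?_ (by positivity)
    split_ifs
    · exact pow_nonneg (walkSum_nonneg hp (fun _ => hf0) _ _ _ _) _
    · exact le_rfl
  have hY0 : ∀ σ, 0 ≤ Y σ := fun σ =>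
    add_nonneg (Finset.sum_nonneg (hnn σ)) (by positivity)
  have hY1 : ∀ σ, (∃ i, η < walkSum p σ (fun _ => f) t i ∅ 1) → 1 ≤ Y σ := by
    rintro σ ⟨i, hi⟩
    simp only [hY]
    by_cases hGσ : G σ
    · refine le_add_of_le_of_nonneg (le_trans ?_ (Finset.single_le_sum (hnn σ)
        (Finset.mem_univ i))) (by positivity)
      rw [if_pos hGσ, ← div_eq_mul_inv, one_le_div (by positivity)]
      gcongr
    · rw [if_neg hGσ]
      exact le_add_of_nonneg_left (Finset.sum_nonneg (hnn σ))
  have hbad := esum_not_walksLe_le hp hp1 hn hβ hL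
  simp only [← hG] at hbad
  have hmom : ∀ i : Fin n, esum ∅ (fun σ =>
      (if G σ then walkSum p σ (fun _ => f) t i ∅ 1 ^ k else 0) * (η ^ k)⁻¹) ≤
      cnt (∅ : Info n) * ((δ / η) ^ k + (k * t * q) ^ 2 / η ^ k) := by
    intro i
    rw [esum_mul_right]
    have h1 := esum_pow_le hp hrow hmn hq.ge hf0 hf1 hδ0 (hone i) k ∅ (by simpa using hkt)
    have hex : excess i (∅ : Info n) = 0 := by simp [excess]
    rw [hex, excessBound] at h1
    refine (mul_le_mul_of_nonneg_right h1
      (inv_nonneg.2 (pow_nonneg hη.le k))).trans (le_of_eq ?_)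
    rw [div_pow]
    push_cast
    ring
  refine Pr_le_of_esum_le hY0 hY1 ?_
  simp only [hY]
  rw [esum_add, esum_sum, mul_add]
  refine add_le_add ?_ hbad
  refine (Finset.sum_le_sum fun i _ => hmom i).trans (le_of_eq ?_)
  simp only [Finset.sum_const, Finset.card_univ, Fintype.card_fin, nsmul_eq_mul]
  ring

end deviation

section asymptotics

variable {p : Fin n → Fin n → ℝ} {ε η H C c K δ α V φ ℓ : ℝ}

lemma div_sub_pow_le_exp {m t : ℕ} (hmn : m < n) :
    ((n : ℝ) / (n - m)) ^ t ≤ Real.exp (t * (m / (n - m))) := by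
  have h : (0 : ℝ) < n - m := by
    have : (m : ℝ) < n := by exact_mod_cast hmn
    linarith
  have h1 : (n : ℝ) / (n - m) = m / (n - m) + 1 := by field_simp; ring
  rw [h1, Real.exp_nat_mul]
  exact pow_le_pow_left₀ (by positivity) (Real.add_one_le_exp _) _

lemma two_mul_lt_of_le_log_sq {m : ℕ} (hn : Real.exp ℓ = n) (hl : 1 ≤ ℓ) (hC : 1 ≤ C)
    (hm : (m : ℝ) ≤ 2 * C * ℓ ^ 2) (h : 18 * C ^ 2 * (ℓ ^ 3 * Real.exp (-1 * ℓ)) ≤ 1 / 4) :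
    2 * (m : ℝ) < n := by
  have hn0 : (0 : ℝ) < n := hn ▸ Real.exp_pos ℓ
  have hE : Real.exp (-1 * ℓ) = (n : ℝ)⁻¹ := by rw [← hn, neg_one_mul, Real.exp_neg]
  rw [hE, ← div_eq_mul_inv, mul_div_assoc', div_le_iff₀ hn0] at h
  have : C * ℓ ^ 2 ≤ C ^ 2 * ℓ ^ 3 := by
    have : 1 * 1 ≤ C * ℓ := mul_le_mul hC hl (by norm_num) (by linarith)
    nlinarith [mul_nonneg (show 0 ≤ C by linarith) (sq_nonneg ℓ)]
  nlinarith

lemma revisit_le {q : ℝ} {m : ℕ} (hn : Real.exp ℓ = n) (hl : 1 ≤ ℓ) (hC : 1 ≤ C)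
    (hm : (m : ℝ) ≤ 2 * C * ℓ ^ 2) (h2m : 2 * (m : ℝ) < n) (hq : q = (m + 1) / (n - m)) :
    q ≤ 6 * C * (ℓ ^ 2 * Real.exp (-1 * ℓ)) := by
  have hn0 : (0 : ℝ) < n := hn ▸ Real.exp_pos ℓ
  have hE : Real.exp (-1 * ℓ) = (n : ℝ)⁻¹ := by rw [← hn, neg_one_mul, Real.exp_neg]
  have h1 : 1 ≤ C * ℓ ^ 2 := by
    have := one_le_pow₀ hl (n := 2)
    nlinarith
  have hm0 : (0 : ℝ) ≤ m := m.cast_nonneg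
  calc q ≤ (3 * (C * ℓ ^ 2)) / (n / 2) := by
        rw [hq]
        exact div_le_div₀ (by positivity) (by linarith) (by positivity) (by linarith)
    _ = _ := by rw [hE]; field_simp; ring

/-- The total error in one exploration phase is at most `δ`. -/
lemma phase_error_le {Θ q κ CH H₀ V₂ : ℝ} {m t L β : ℕ}
    (hΘ : Θ = n / (n - m)) (hq : q = (m + 1) / (n - m)) (hn : Real.exp ℓ = n) (hl : 1 ≤ ℓ)
    (hC : 1 ≤ C) (hm : (m : ℝ) ≤ 2 * C * ℓ ^ 2) (hc : 0 < c) (hct : c * ℓ ≤ t) (htC : t ≤ C * ℓ)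
    (hε : 0 < ε) (hH₀ : 0 < H₀) (hH : H₀ ≤ H) (hHC : H ≤ CH)
    (hα : 0 < α) (hα1 : α ≤ 1) (hαl : 1 ≤ α * ℓ) (hL1 : α * ℓ ≤ L) (hL2 : L ≤ α * ℓ + 1)
    (hβ : 0 < β) (hκ : κ = Real.exp (-(α * ℓ))) (hV₂ : 0 ≤ V₂) (hV : V = V₂ * ℓ) (hδ1 : δ ≤ 1)
    (h1 : 75 * C * (ℓ ^ 4 * Real.exp (-(α / β) * ℓ)) ≤ δ / 4)
    (h2 : 18 * C ^ 2 * (ℓ ^ 3 * Real.exp (-1 * ℓ)) ≤ δ / 4)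
    (h3 : 6 * α ^ 2 * (1 + 16 * CH ^ 2) ≤ δ / 4 * (ε * (c * H₀)) ^ 2)
    (h4 : (2 * C + 24) * V₂ ≤ δ / 4 * (ε * (c * H₀)) ^ 2) :
    (2 * L + 1 : ℝ) * (m + 1) * (2 * L * κ + Real.exp (-(L / β))) +
      (q + Θ ^ t * ((3 * (Real.log κ ^ 2 + (2 * L * H) ^ 2) + t * V) / (ε * (t * H)) ^ 2 + t * q)) +
      2 * L * (3 * Θ ^ t * V / (ε * (t * H)) ^ 2) ≤ δ := by
  have h2' : 18 * C ^ 2 * (ℓ ^ 3 * Real.exp (-1 * ℓ)) ≤ 1 / 4 := by linarith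
  have h2m := two_mul_lt_of_le_log_sq hn hl hC hm h2'
  have hn0 : (0 : ℝ) < n := hn ▸ Real.exp_pos ℓ
  have hm0 : (0 : ℝ) ≤ m := m.cast_nonneg
  have hnm : (0 : ℝ) < n - m := by linarith
  have hq1 := revisit_le hn hl hC hm h2m hq
  have hq0 : 0 ≤ q := by rw [hq]; positivity
  have ht0 : (0 : ℝ) ≤ t := t.cast_nonneg
  have hCl : 1 ≤ C * ℓ := one_le_mul_of_one_le_of_one_le hC hl
  set E := Real.exp (-1 * ℓ) with hE
  have hE0 : 0 < E := Real.exp_pos _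
  have htq : t * q ≤ 6 * C ^ 2 * (ℓ ^ 3 * E) := calc
    t * q ≤ (C * ℓ) * (6 * C * (ℓ ^ 2 * E)) := by gcongr
    _ = _ := by ring
  have htq0 : 0 ≤ t * q := by positivity
  have hqtq : q ≤ 6 * C ^ 2 * (ℓ ^ 3 * E) := hq1.trans <| calc
    6 * C * (ℓ ^ 2 * E) ≤ (C * ℓ) * (6 * C * (ℓ ^ 2 * E)) :=
      le_mul_of_one_le_left (by positivity) hCl
    _ = _ := by ring
  have hΘ2 : Θ ^ t ≤ 2 := by
    rw [hΘ]
    refine (div_sub_pow_le_exp (by exact_mod_cast (by linarith : (m : ℝ) < n))).trans ?_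
    have hle : t * (m / (n - m) : ℝ) ≤ 1 / 2 := by
      have : (m / (n - m) : ℝ) ≤ q := by rw [hq]; gcongr; linarith
      have := mul_le_mul_of_nonneg_left this ht0
      linarith
    refine (Real.exp_le_exp.2 hle).trans ?_
    have := Real.exp_bound_div_one_sub_of_interval (x := 1 / 2) (by norm_num) (by norm_num)
    norm_num at this ⊢
    exact this
  have hΘ0 : 0 ≤ Θ ^ t := by rw [hΘ]; positivity
  set D := ε * (c * H₀) with hD
  have hD0 : 0 < D := by positivity
  have hden : (D * ℓ) ^ 2 ≤ (ε * (t * H)) ^ 2 := by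
    refine pow_le_pow_left₀ (by positivity) ?_ 2
    calc D * ℓ = ε * ((c * ℓ) * H₀) := by rw [hD]; ring
      _ ≤ _ := by gcongr
  have hden0 : 0 < (D * ℓ) ^ 2 := by positivity
  have hL0 : (0 : ℝ) ≤ L := L.cast_nonneg
  have hLl : (L : ℝ) ≤ 2 * α * ℓ := by linarith
  have hLl' : (L : ℝ) ≤ 2 * ℓ := hLl.trans (by gcongr; linarith)
  have hβ0 : (1 : ℝ) ≤ β := by exact_mod_cast hβ
  have hκ1 : κ ≤ Real.exp (-(α / β) * ℓ) := by
    rw [hκ, Real.exp_le_exp, neg_mul, neg_le_neg_iff, div_mul_eq_mul_div]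
    exact div_le_self (by positivity) hβ0
  have hLβ : Real.exp (-(L / β)) ≤ Real.exp (-(α / β) * ℓ) := by
    rw [Real.exp_le_exp, neg_mul, neg_le_neg_iff, div_mul_eq_mul_div]
    gcongr
  set F := Real.exp (-(α / β) * ℓ) with hF
  have hF0 : 0 < F := Real.exp_pos _
  have hκ0 : 0 ≤ κ := hκ ▸ (Real.exp_pos _).le
  have hCl2 : 1 ≤ C * ℓ ^ 2 := one_le_mul_of_one_le_of_one_le hC (one_le_pow₀ hl)
  have e1 : (2 * L + 1 : ℝ) * (m + 1) * (2 * L * κ + Real.exp (-(L / β))) ≤ δ / 4 := by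
    refine le_trans ?_ h1
    calc _ ≤ (5 * ℓ) * (3 * (C * ℓ ^ 2)) * (2 * (2 * ℓ) * F + ℓ * F) := by
          gcongr ?_ * ?_ * (2 * ?_ * ?_ + ?_)
          · linarith
          · linarith
          · exact hLβ.trans (le_mul_of_one_le_left hF0.le hl)
      _ = _ := by ring
  have e2 : q + Θ ^ t * (t * q) ≤ δ / 4 := by
    have := mul_le_mul_of_nonneg_right hΘ2 htq0
    linarith
  have hlogκ : Real.log κ ^ 2 = α ^ 2 * ℓ ^ 2 := by rw [hκ, Real.log_exp]; ring
  have hLH : (2 * L * H) ^ 2 ≤ 16 * CH ^ 2 * (α ^ 2 * ℓ ^ 2) := by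
    have hH' : 0 ≤ H := by linarith
    calc _ ≤ (2 * (2 * α * ℓ) * CH) ^ 2 := by gcongr
      _ = _ := by ring
  have hV0 : 0 ≤ V := by rw [hV]; positivity
  have htV : t * V ≤ C * V₂ * ℓ ^ 2 := calc
    t * V ≤ (C * ℓ) * V := by gcongr
    _ = _ := by rw [hV]; ring
  have hLV : 2 * L * (3 * V) ≤ 12 * V₂ * ℓ ^ 2 := calc
    2 * L * (3 * V) ≤ 2 * (2 * ℓ) * (3 * V) := by gcongr
    _ = _ := by rw [hV]; ring
  have e3 : Θ ^ t * ((3 * (Real.log κ ^ 2 + (2 * L * H) ^ 2) + t * V) / (ε * (t * H)) ^ 2) +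
      2 * L * (3 * Θ ^ t * V / (ε * (t * H)) ^ 2) ≤ δ / 2 := by
    have hN : 3 * (Real.log κ ^ 2 + (2 * L * H) ^ 2) + t * V + 2 * L * (3 * V) ≤
        δ / 4 * (D * ℓ) ^ 2 := by
      have := mul_le_mul_of_nonneg_right (add_le_add h3 h4) (sq_nonneg ℓ)
      have hmV : (2 * C + 24) * V₂ * ℓ ^ 2 = 2 * (C * V₂ * ℓ ^ 2) + 2 * (12 * V₂ * ℓ ^ 2) := by ring
      have hmα : 6 * α ^ 2 * (1 + 16 * CH ^ 2) * ℓ ^ 2 =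
          6 * (α ^ 2 * ℓ ^ 2 + 16 * CH ^ 2 * (α ^ 2 * ℓ ^ 2)) := by ring
      rw [hlogκ, mul_pow]
      linarith
    calc _ = Θ ^ t * ((3 * (Real.log κ ^ 2 + (2 * L * H) ^ 2) + t * V + 2 * L * (3 * V)) /
          (ε * (t * H)) ^ 2) := by ring
      _ ≤ 2 * (δ / 4 * (D * ℓ) ^ 2 / (D * ℓ) ^ 2) := by
          gcongr
          exact le_trans (by positivity) hN
      _ = δ / 2 := by field_simp; ring
  linarith

/-- The quantitative form of the concentration of trajectory weights, with `ℓ = log n`. -/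
lemma Pr_quenched_le_exp (hp : ∀ i j, 0 ≤ p i j) (hrow : ∀ i, ∑ j, p i j = 1)
    {CH H₀ V₂ : ℝ} {t β : ℕ} (hn : Real.exp ℓ = n) (hl : 1 ≤ ℓ)
    (hC : 1 ≤ C) (hc : 0 < c) (hct : c * ℓ ≤ t) (htC : t ≤ C * ℓ)
    (hε : 0 < ε) (hη : 0 < η) (hη1 : η ≤ 1)
    (hH₀ : 0 < H₀) (hH : H₀ ≤ avgEntropy n p) (hHC : avgEntropy n p ≤ CH)
    (hα : 0 < α) (hα1 : α ≤ 1) (hαc : 4 * α ≤ c) (hαl : 1 ≤ α * ℓ) (hβ : 0 < β) (hV₂ : 0 ≤ V₂)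
    (hV : ∀ x, ∑ j, p x j * Real.log (p x j) ^ 2 ≤ V₂ * ℓ)
    (hK : K * (4 * (1 + Real.log η⁻¹)) = 1) (hδ : δ = η * Real.exp (-(2 / K)))
    (h1 : 75 * C * (ℓ ^ 4 * Real.exp (-(α / β) * ℓ)) ≤ δ / 4)
    (h2 : 18 * C ^ 2 * (ℓ ^ 3 * Real.exp (-1 * ℓ)) ≤ δ / 4)
    (h3 : 6 * α ^ 2 * (1 + 16 * CH ^ 2) ≤ δ / 4 * (ε * (c * H₀)) ^ 2)
    (h4 : (2 * C + 24) * V₂ ≤ δ / 4 * (ε * (c * H₀)) ^ 2)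
    (hφ : Real.exp 1 * powAvg p β ≤ φ) (hφα : φ ≤ Real.exp (-(2 / α))) (hφ2 : φ ≤ 1 / 2) :
    Pr n (fun σ => ∃ i : Fin n, η < quenched n t (Pmat n p σ) i (fun x =>
        pathWeight n t (Pmat n p σ) x ∉ Set.Icc (Real.exp (-(1 + ε) * avgEntropy n p * (t : ℝ)))
            (Real.exp (-(1 - ε) * avgEntropy n p * (t : ℝ))))) ≤
      2 * Real.exp (-1 * ℓ) + 144 * C ^ 4 * η⁻¹ * (ℓ ^ 8 * Real.exp (-(3 / 4) * ℓ)) + 2 * φ := by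
  have hlog : 0 ≤ Real.log η⁻¹ := Real.log_nonneg (one_le_inv_iff₀.2 ⟨hη, hη1⟩)
  have hK0 : 0 < K := by
    by_contra! h
    have := mul_nonpos_of_nonpos_of_nonneg h (show 0 ≤ 4 * (1 + Real.log η⁻¹) by linarith)
    linarith
  have hK1 : K ≤ 1 := by linarith [mul_nonneg hK0.le hlog]
  have hKlog : K * Real.log η⁻¹ ≤ 1 / 4 := by linarith
  have hδη : δ ≤ η := by
    rw [hδ]
    exact mul_le_of_le_one_right hη.le (Real.exp_le_one_iff.2 (by simp; positivity))
  have hδ0 : 0 < δ := hδ ▸ by positivity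
  have hn0 : (0 : ℝ) < n := hn ▸ Real.exp_pos ℓ
  have hE : Real.exp (-1 * ℓ) = (n : ℝ)⁻¹ := by rw [← hn, neg_one_mul, Real.exp_neg]
  obtain ⟨k, hk⟩ : ∃ k, k = ⌈K * ℓ⌉₊ := ⟨_, rfl⟩
  obtain ⟨L, hL⟩ : ∃ L, L = ⌈α * ℓ⌉₊ := ⟨_, rfl⟩
  have hk1 : K * ℓ ≤ k := hk ▸ Nat.le_ceil _
  have hk2 : k ≤ K * ℓ + 1 := hk ▸ (Nat.ceil_lt_add_one (by positivity)).le
  have hL1 : α * ℓ ≤ L := hL ▸ Nat.le_ceil _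
  have hL2 : L ≤ α * ℓ + 1 := hL ▸ (Nat.ceil_lt_add_one (by positivity)).le
  have hk3 : (k : ℝ) ≤ 2 * ℓ := by
    have := mul_le_of_le_one_left (show 0 ≤ ℓ by linarith) hK1
    linarith
  have hLpos : 0 < L := by
    have : (0 : ℝ) < L := by linarith
    exact_mod_cast this
  have htpos : 0 < t := by
    have : (0 : ℝ) < t := lt_of_lt_of_le (by positivity) hct
    exact_mod_cast this
  have hLt : 2 * L ≤ t := by
    have : (2 * L : ℝ) ≤ t := by
      have := mul_le_mul_of_nonneg_right hαc (show 0 ≤ ℓ by linarith)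
      linarith
    exact_mod_cast this
  obtain ⟨m, hm⟩ : ∃ m, m = k * t := ⟨_, rfl⟩
  have hmC : (m : ℝ) ≤ 2 * C * ℓ ^ 2 := by
    rw [hm]; push_cast
    calc (k * t : ℝ) ≤ (2 * ℓ) * (C * ℓ) := by gcongr
      _ = _ := by ring
  have h2m := two_mul_lt_of_le_log_sq hn hl hC hmC (by linarith)
  have hmn : m < n := by
    have : (m : ℝ) < n := by have : (0 : ℝ) ≤ m := m.cast_nonneg
                             linarith
    exact_mod_cast this
  have hq := revisit_le hn hl hC hmC h2m rfl
  have herr := phase_error_le (κ := Real.exp (-(α * ℓ))) (β := β) rfl rfl hn hl hC hmC hc hct htC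
    hε hH₀ hH hHC hα hα1 hαl hL1 hL2 hβ rfl hV₂ rfl (by linarith) h1 h2 h3 h4
  have hnm : (0 : ℝ) < n - m := by
    have : (0 : ℝ) ≤ m := m.cast_nonneg
    linarith
  refine (Pr_quenched_le hp hrow hmn rfl rfl (hH₀.trans_le hH) rfl hV hε htpos hm.ge hLpos hLt hβ
    (Real.exp_pos _) hη herr).trans ?_
  have b1 : n * (δ / η) ^ k ≤ Real.exp (-1 * ℓ) := by
    rw [hδ, mul_div_cancel_left₀ _ hη.ne', ← Real.exp_nat_mul, ← hn, ← Real.exp_add,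
      Real.exp_le_exp]
    have : 2 * ℓ ≤ k * (2 / K) := by
      rw [mul_div_assoc', le_div_iff₀ hK0]; linarith
    linarith
  have b2 : n * ((k * t * ((m + 1) / (n - m))) ^ 2 / η ^ k) ≤
      144 * C ^ 4 * η⁻¹ * (ℓ ^ 8 * Real.exp (-(3 / 4) * ℓ)) := by
    have hηk : (η ^ k)⁻¹ ≤ η⁻¹ * Real.exp (1 / 4 * ℓ) := by
      rw [← inv_pow, ← Real.exp_log (inv_pos.2 hη), ← Real.exp_nat_mul, ← Real.exp_add,
        Real.exp_le_exp]
      have := mul_le_mul_of_nonneg_right hk2 hlog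
      have := mul_le_mul_of_nonneg_right hKlog (show 0 ≤ ℓ by linarith)
      linarith
    calc n * ((k * t * ((m + 1) / (n - m))) ^ 2 / η ^ k : ℝ)
        ≤ Real.exp ℓ * (((2 * ℓ) * (C * ℓ) * (6 * C * (ℓ ^ 2 * Real.exp (-1 * ℓ)))) ^ 2 *
            (η⁻¹ * Real.exp (1 / 4 * ℓ))) := by
          rw [hn, div_eq_mul_inv]
          gcongr
      _ = 144 * C ^ 4 * η⁻¹ * (ℓ ^ 8 * (Real.exp ℓ * Real.exp (-1 * ℓ) ^ 2 *
            Real.exp (1 / 4 * ℓ))) := by ring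
      _ = _ := by
          rw [← Real.exp_nat_mul, ← Real.exp_add, ← Real.exp_add]
          congr 3
          push_cast; ring
  have hφ0 : 0 ≤ Real.exp 1 * powAvg p β := mul_nonneg (Real.exp_pos _).le (powAvg_nonneg hp β)
  have b3 : n * (Real.exp 1 * powAvg p β) ^ L ≤ Real.exp (-1 * ℓ) := by
    have : (Real.exp 1 * powAvg p β) ^ L ≤ Real.exp (-(2 / α)) ^ L :=
      pow_le_pow_left₀ hφ0 (hφ.trans hφα) _
    refine (mul_le_mul_of_nonneg_left this hn0.le).trans ?_
    rw [← Real.exp_nat_mul, ← hn, ← Real.exp_add, Real.exp_le_exp]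
    have : 2 * ℓ ≤ L * (2 / α) := by
      rw [mul_div_assoc', le_div_iff₀ hα]; linarith
    linarith
  have b4 : ∑ l ∈ Finset.range L, (Real.exp 1 * powAvg p β) ^ (l + 1) ≤ 2 * φ := by
    have hφ0' := hφ0.trans hφ
    calc ∑ l ∈ Finset.range L, (Real.exp 1 * powAvg p β) ^ (l + 1)
        ≤ ∑ l ∈ Finset.range L, φ * (1 / 2) ^ l := by
          refine Finset.sum_le_sum fun l _ => ?_
          rw [pow_succ']
          gcongr
          exact hφ.trans hφ2
      _ = φ * ∑ l ∈ Finset.range L, (1 / 2 : ℝ) ^ l := by rw [Finset.mul_sum]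
      _ ≤ φ * 2 := by gcongr; exact sum_geometric_two_le L
      _ = _ := by ring
  rw [mul_add]
  linarith

end asymptotics

section nondegeneracy

/-- The number of entries exceeding `1 - ε`, divided by `n`. -/
noncomputable def heavyFrac (p : Fin n → Fin n → ℝ) (ε : ℝ) : ℝ :=
  (1 / (n : ℝ)) * ∑ i : Fin n, ∑ j : Fin n, if 1 - ε < p i j then (1 : ℝ) else 0

variable {p : Fin n → Fin n → ℝ} {ε : ℝ}

lemma entry_le_one (hp : ∀ i j, 0 ≤ p i j) (hrow : ∀ i, ∑ j, p i j = 1) (i j : Fin n) :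
    p i j ≤ 1 :=
  hrow i ▸ Finset.single_le_sum (f := fun j => p i j) (fun j _ => hp i j) (Finset.mem_univ j)

lemma heavyFrac_le_two (hp : ∀ i j, 0 ≤ p i j) (hrow : ∀ i, ∑ j, p i j = 1) (hε : ε ≤ 1 / 2) :
    heavyFrac p ε ≤ 2 := by
  have h : ∑ i : Fin n, ∑ j : Fin n, (if 1 - ε < p i j then (1 : ℝ) else 0) ≤ n * 2 := by
    calc _ ≤ ∑ i : Fin n, ∑ j : Fin n, p i j * 2 := by
          gcongr with i _ j _
          have := hp i j
          split_ifs <;> linarith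
      _ = n * 2 := by simp [← Finset.sum_mul, hrow]
  rw [heavyFrac, one_div]
  calc (n : ℝ)⁻¹ * _ ≤ (n : ℝ)⁻¹ * (n * 2) := by gcongr
    _ ≤ 2 := by
      rw [← mul_assoc]
      exact mul_le_of_le_one_left (by norm_num) (inv_mul_le_one)

lemma powAvg_succ_le (hp : ∀ i j, 0 ≤ p i j) (hrow : ∀ i, ∑ j, p i j = 1) (hε : ε ≤ 1) (β : ℕ) :
    powAvg p (β + 1) ≤ heavyFrac p ε + (1 - ε) ^ β := by
  rcases Nat.eq_zero_or_pos n with rfl | hn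
  · simp [powAvg, heavyFrac, hε]
  have hn' : (0 : ℝ) < n := by exact_mod_cast hn
  rw [powAvg, div_le_iff₀ hn', heavyFrac, add_mul, mul_right_comm, one_div_mul_cancel hn'.ne',
    one_mul]
  calc ∑ x, ∑ j, p x j ^ (β + 1)
      ≤ ∑ x, ∑ j, ((if 1 - ε < p x j then (1 : ℝ) else 0) + p x j * (1 - ε) ^ β) := by
        gcongr with x _ j _
        split_ifs with h
        · exact (pow_le_one₀ (hp x j) (entry_le_one hp hrow x j)).trans
            (le_add_of_nonneg_right (mul_nonneg (hp x j) (pow_nonneg (by linarith) _)))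
        · rw [zero_add, pow_succ']
          have := hp x j
          have := not_lt.1 h
          gcongr
    _ = _ := by
        simp only [Finset.sum_add_distrib, ← Finset.sum_mul, hrow]
        simp [mul_comm]

lemma le_avgEntropy (hn : 0 < n) (hp : ∀ i j, 0 ≤ p i j) (hrow : ∀ i, ∑ j, p i j = 1)
    (hε : 0 ≤ ε) : ε * (1 - heavyFrac p ε) ≤ avgEntropy n p := by
  have hn' : (0 : ℝ) < n := by exact_mod_cast hn
  have h : ∀ i : Fin n, ε * (1 - ∑ j : Fin n, if 1 - ε < p i j then (1 : ℝ) else 0) ≤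
      -∑ j, p i j * Real.log (p i j) := fun i => by
    have e : 1 - ∑ j : Fin n, (if 1 - ε < p i j then (1 : ℝ) else 0) =
        ∑ j : Fin n, (p i j - if 1 - ε < p i j then (1 : ℝ) else 0) := by
      rw [Finset.sum_sub_distrib, hrow i]
    rw [e, Finset.mul_sum, ← Finset.sum_neg_distrib]
    gcongr with j _
    have h0 := hp i j
    have h1 := entry_le_one hp hrow i j
    rcases h0.eq_or_lt with h0' | h0'
    · rw [← h0']
      split_ifs <;> simp [hε]
    have h2 := mul_le_mul_of_nonneg_left (Real.log_le_sub_one_of_pos h0') h0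
    split_ifs with h3
    · have := mul_nonneg hε (show 0 ≤ 1 - p i j by linarith)
      have := mul_nonneg h0 (show 0 ≤ 1 - p i j by linarith)
      linarith
    · have := mul_le_mul_of_nonneg_left (not_lt.1 h3) h0
      linarith
  have h' := mul_le_mul_of_nonneg_left (Finset.sum_le_sum fun i (_ : i ∈ Finset.univ) => h i)
    (one_div_nonneg.2 hn'.le)
  rw [avgEntropy, heavyFrac]
  calc _ = 1 / (n : ℝ) *
        ∑ i : Fin n, ε * (1 - ∑ j : Fin n, if 1 - ε < p i j then (1 : ℝ) else 0) := by
        rw [← Finset.mul_sum, Finset.sum_sub_distrib]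
        simp
        field_simp
    _ ≤ _ := h'
    _ = _ := by rw [Finset.sum_neg_distrib]; ring

lemma exists_eventually_heavyFrac_lt {p : (n : ℕ) → Fin n → Fin n → ℝ}
    (hp : ∀ n (i j : Fin n), 0 ≤ p n i j) (hrow : ∀ n (i : Fin n), ∑ j : Fin n, p n i j = 1)
    (h : Tendsto (fun ε : ℝ => limsup (fun n : ℕ => heavyFrac (p n) ε) atTop)
      (nhdsWithin 0 (Set.Ioi 0)) (nhds 0)) {a : ℝ} (ha : 0 < a) :
    ∃ ε : ℝ, 0 < ε ∧ ε ≤ 1 / 2 ∧ ∀ᶠ n in atTop, heavyFrac (p n) ε < a := by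
  have h1 : ∀ᶠ ε : ℝ in nhdsWithin 0 (Set.Ioi 0), ε ≤ 1 / 2 :=
    nhdsWithin_le_nhds (eventually_le_nhds (by norm_num))
  obtain ⟨ε, hε, hε0, hε2⟩ :=
    ((h.eventually_lt_const ha).and (eventually_mem_nhdsWithin.and h1)).exists
  refine ⟨ε, hε0, hε2, eventually_lt_of_limsup_lt hε ?_⟩
  exact isBoundedUnder_of ⟨2, fun n => heavyFrac_le_two (hp n) (hrow n) hε2⟩

end nondegeneracy

lemma Pr_nonneg (E : Env n → Prop) : 0 ≤ Pr n E :=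
  div_nonneg (Finset.sum_nonneg fun σ _ => by split_ifs <;> norm_num) (Nat.cast_nonneg _)

lemma Pr_mono {E F : Env n → Prop} (h : ∀ σ, E σ → F σ) : Pr n E ≤ Pr n F := by
  unfold Pr
  gcongr with σ
  by_cases hE : E σ
  · simp [hE, h σ hE]
  · rw [if_neg hE]
    split_ifs <;> norm_num

lemma tendsto_pow_mul_exp_neg_mul (k : ℕ) {b : ℝ} (hb : 0 < b) :
    Tendsto (fun x : ℝ => x ^ k * Real.exp (-b * x)) atTop (nhds 0) := by
  simpa using tendsto_rpow_mul_exp_neg_mul_atTop_nhds_zero k b hb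

end SparseWalk

theorem stmt2
    (p : (n : ℕ) → Fin n → Fin n → ℝ)
    (hnonneg : ∀ n (i j : Fin n), 0 ≤ p n i j)
    (hrow : ∀ n (i : Fin n), ∑ j : Fin n, p n i j = 1)
    (hHbdd : ∃ C : ℝ, ∀ n : ℕ, avgEntropy n (p n) ≤ C)
    (hsparse : ∀ ε : ℝ, 0 < ε → ∀ᶠ n : ℕ in atTop, ∀ i : Fin n,
        ∑ j : Fin n, p n i j * (Real.log (p n i j)) ^ 2 ≤ ε * Real.log n)
    (hnondeg : Tendsto (fun ε : ℝ =>
        Filter.limsup (fun n : ℕ =>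
          (1 / (n : ℝ)) * ∑ i : Fin n, ∑ j : Fin n,
            if 1 - ε < p n i j then (1 : ℝ) else 0) atTop)
        (nhdsWithin 0 (Set.Ioi 0)) (nhds 0))
    (ε : ℝ) (hε : 0 < ε)
    (t : ℕ → ℕ)
    -- `t_n = Θ(log n)`
    (hθ : ∃ c C : ℝ, 0 < c ∧ ∀ᶠ n : ℕ in atTop,
        c * Real.log n ≤ (t n : ℝ) ∧ (t n : ℝ) ≤ C * Real.log n) :
    -- `max_i Q_i(ρ(t_n) ∉ [e^{-(1+ε)H t}, e^{-(1-ε)H t}])` tends to 0 in probability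
    ∀ η : ℝ, 0 < η →
      Tendsto (fun n : ℕ => Pr n (fun σ => ∃ i : Fin n,
          η < quenched n (t n) (Pmat n (p n) σ) i (fun x =>
            pathWeight n (t n) (Pmat n (p n) σ) x ∉
              Set.Icc (Real.exp (-(1 + ε) * avgEntropy n (p n) * (t n : ℝ)))
                (Real.exp (-(1 - ε) * avgEntropy n (p n) * (t n : ℝ))))))
        atTop (nhds 0) := by
  intro η' hη'
  have hfrac : Tendsto (fun ε : ℝ => limsup (fun n : ℕ => SparseWalk.heavyFrac (p n) ε) atTop)
      (nhdsWithin 0 (Set.Ioi 0)) (nhds 0) := hnondeg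
  refine tendsto_order.2 ⟨fun a ha => Eventually.of_forall fun n =>
    ha.trans_le (SparseWalk.Pr_nonneg _), fun γ hγ => ?_⟩
  obtain ⟨η, hη⟩ : ∃ η, η = min η' 1 := ⟨_, rfl⟩
  have hη0 : 0 < η := hη ▸ lt_min hη' one_pos
  have hη1 : η ≤ 1 := hη ▸ min_le_right _ _
  have hlog : 0 ≤ Real.log η⁻¹ := Real.log_nonneg (one_le_inv_iff₀.2 ⟨hη0, hη1⟩)
  obtain ⟨ε₀, hε₀, hε₀', hfrac₀⟩ := SparseWalk.exists_eventually_heavyFrac_lt hnonneg hrow hfrac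
    (show (0 : ℝ) < 1 / 2 by norm_num)
  obtain ⟨CH, hCH⟩ := hHbdd
  obtain ⟨c, C', hc, hct⟩ := hθ
  obtain ⟨C, hC⟩ : ∃ C, C = max C' 1 := ⟨_, rfl⟩
  have hC1 : 1 ≤ C := hC ▸ le_max_right _ _
  obtain ⟨K, hK⟩ : ∃ K : ℝ, K * (4 * (1 + Real.log η⁻¹)) = 1 :=
    ⟨(4 * (1 + Real.log η⁻¹))⁻¹, inv_mul_cancel₀ (by positivity)⟩
  obtain ⟨δ, hδ⟩ : ∃ δ, δ = η * Real.exp (-(2 / K)) := ⟨_, rfl⟩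
  have hδ0 : 0 < δ := hδ ▸ by positivity
  obtain ⟨B, hB⟩ : ∃ B, B = δ / 4 * (ε * (c * (ε₀ / 2))) ^ 2 := ⟨_, rfl⟩
  have hB0 : 0 < B := hB ▸ by positivity
  obtain ⟨α, hα, hα1, hαc, hαB⟩ : ∃ α : ℝ, 0 < α ∧ α ≤ 1 ∧ 4 * α ≤ c ∧
      6 * α ^ 2 * (1 + 16 * CH ^ 2) ≤ B := by
    have hpos : 0 < 6 * (1 + 16 * CH ^ 2) := by positivity
    refine ⟨min 1 (min (c / 4) (B / (6 * (1 + 16 * CH ^ 2)))), by positivity, min_le_left _ _,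
      ?_, ?_⟩
    · have := (min_le_right 1 (min (c / 4) (B / (6 * (1 + 16 * CH ^ 2))))).trans (min_le_left _ _)
      linarith
    · have h1 := min_le_left 1 (min (c / 4) (B / (6 * (1 + 16 * CH ^ 2))))
      have h2 := (min_le_right 1 (min (c / 4) (B / (6 * (1 + 16 * CH ^ 2))))).trans
        (min_le_right _ _)
      have h0 : 0 ≤ min 1 (min (c / 4) (B / (6 * (1 + 16 * CH ^ 2)))) := by positivity
      rw [le_div_iff₀ hpos] at h2
      have h3 := mul_le_mul_of_nonneg_right (pow_le_of_le_one h0 h1 two_ne_zero) hpos.le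
      linarith
  obtain ⟨V₂, hV₂, hV₂B⟩ : ∃ V₂ : ℝ, 0 < V₂ ∧ (2 * C + 24) * V₂ ≤ B :=
    ⟨B / (2 * C + 24), by positivity, (mul_div_cancel₀ _ (by positivity)).le⟩
  obtain ⟨φ, hφ0, hφα, hφ2, hφγ⟩ : ∃ φ : ℝ, 0 < φ ∧ φ ≤ Real.exp (-(2 / α)) ∧ φ ≤ 1 / 2 ∧
      φ ≤ γ / 4 :=
    ⟨min (Real.exp (-(2 / α))) (min (1 / 2) (γ / 4)), by positivity, min_le_left _ _,
      (min_le_right _ _).trans (min_le_left _ _), (min_le_right _ _).trans (min_le_right _ _)⟩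
  have hφe : 0 < φ / (2 * Real.exp 1) := by positivity
  obtain ⟨ε₁, hε₁, hε₁', hfrac₁⟩ := SparseWalk.exists_eventually_heavyFrac_lt hnonneg hrow hfrac hφe
  obtain ⟨β, hβ⟩ := exists_pow_lt_of_lt_one hφe (show 1 - ε₁ < 1 by linarith)
  have hlogn : Tendsto (fun n : ℕ => Real.log n) atTop atTop :=
    Real.tendsto_log_atTop.comp tendsto_natCast_atTop_atTop
  have hexp (A : ℝ) (k : ℕ) {b : ℝ} (hb : 0 < b) :
      Tendsto (fun n : ℕ => A * (Real.log n ^ k * Real.exp (-b * Real.log n))) atTop (nhds 0) := by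
    simpa using ((SparseWalk.tendsto_pow_mul_exp_neg_mul k hb).comp hlogn).const_mul A
  have hrest : Tendsto (fun n : ℕ => 2 * Real.exp (-1 * Real.log n) +
      144 * C ^ 4 * η⁻¹ * (Real.log n ^ 8 * Real.exp (-(3 / 4) * Real.log n))) atTop (nhds 0) := by
    simpa using (hexp 2 0 one_pos).add (hexp (144 * C ^ 4 * η⁻¹) 8 (b := 3 / 4) (by norm_num))
  filter_upwards [hfrac₀, hct, hfrac₁, hsparse V₂ hV₂, hlogn.eventually_ge_atTop 1,
    hlogn.eventually_ge_atTop α⁻¹, eventually_gt_atTop 0,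
    (hexp (75 * C) 4 (b := α / (β + 1 : ℕ)) (by positivity)).eventually_le_const
      (show 0 < δ / 4 by positivity),
    (hexp (18 * C ^ 2) 3 one_pos).eventually_le_const (show 0 < δ / 4 by positivity),
    hrest.eventually_lt_const (show 0 < γ / 2 by positivity)]
    with n hf₀ ⟨hct, htC⟩ hf₁ hV hl hαl hn h1 h2 hlast
  have hn' : (0 : ℝ) < n := by exact_mod_cast hn
  have hH := SparseWalk.le_avgEntropy hn (hnonneg n) (hrow n) hε₀.le
  have hpow := SparseWalk.powAvg_succ_le (hnonneg n) (hrow n) (show ε₁ ≤ 1 by linarith) β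
  refine (SparseWalk.Pr_mono fun σ ⟨i, hi⟩ => ⟨i, (hη ▸ min_le_left η' 1).trans_lt hi⟩).trans_lt
    ((SparseWalk.Pr_quenched_le_exp (hnonneg n) (hrow n) (Real.exp_log hn') hl hC1 hc hct
      (htC.trans ?_) hε hη0 hη1 (half_pos hε₀) (le_trans ?_ hH) (hCH n) hα hα1 hαc ?_
      β.succ_pos hV₂.le hV hK hδ h1 h2 (hB ▸ hαB) (hB ▸ hV₂B) (φ := φ) ?_ hφα hφ2).trans_lt ?_)
  · gcongr
    exact hC ▸ le_max_left _ _
  · have := mul_lt_mul_of_pos_left hf₀ hε₀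
    linarith
  · rwa [inv_le_iff_one_le_mul₀' hα] at hαl
  · calc Real.exp 1 * SparseWalk.powAvg (p n) (β + 1)
        ≤ Real.exp 1 * (φ / (2 * Real.exp 1) + φ / (2 * Real.exp 1)) := by gcongr; linarith
      _ = φ := by field_simp; ring
  · linarith
end

section
/- Let P be any n×n stochastic matrix, let t ∈ ℕ, let δ ∈ (0,1), and let i ∈ [n]. Then the probability, for the Markov chain with transition matrix P started at i, that some transition among the first t steps has probability less than δ — namely Σ_{(i_0=i,i_1,…,i_t)∈[n]^{t+1}} (∏_{s=1}^t P(i_{s-1},i_s)) · 1{min_{1≤s≤t} P(i_{s-1},i_s) < δ} — is at most (t/(log δ)²) · max_{k∈[n]} Σ_{j=1}^n P(k,j)(log P(k,j))², where 0·(log 0)² is interpreted as 0. -/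
open Filter
open scoped BigOperators Classical

/-- First-step decomposition of the quenched probability. -/
theorem quenched_succ (n t : ℕ) (P : Fin n → Fin n → ℝ) (i : Fin n)
    (A : (Fin (t + 2) → Fin n) → Prop) :
    quenched n (t + 1) P i A =
      ∑ k, P i k * quenched n t P k (fun y => A (Fin.cons i y)) := by
  have weight_cons (a : Fin n) (y : Fin (t + 1) → Fin n) :
      pathWeight n (t + 1) P (Fin.cons a y) = P a (y 0) * pathWeight n t P y := by
    simp [pathWeight, Fin.prod_univ_succ]
  unfold quenched
  rw [← (Fin.consEquiv (fun _ : Fin (t + 2) => Fin n)).sum_comp, Fintype.sum_prod_type,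
    Finset.sum_eq_single i]
  · simp_rw [Finset.mul_sum]
    rw [Finset.sum_comm]
    refine Finset.sum_congr rfl fun y _ => ?_
    rw [Finset.sum_eq_single (y 0)]
    · by_cases h : A (Fin.cons i y) <;> simp [Fin.consEquiv, h, weight_cons]
    · intro k _ hk
      simp [hk.symm]
    · simp
  · intro a _ ha
    simp [Fin.consEquiv, ha]
  · simp

theorem quenched_mono (n t : ℕ) (P : Fin n → Fin n → ℝ) (hP : ∀ i j, 0 ≤ P i j) (i : Fin n)
    {A B : (Fin (t + 1) → Fin n) → Prop} (h : ∀ x, x 0 = i → A x → B x) :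
    quenched n t P i A ≤ quenched n t P i B := by
  refine Finset.sum_le_sum fun x _ => ?_
  have hw : 0 ≤ pathWeight n t P x := Finset.prod_nonneg fun s _ => hP _ _
  split_ifs with hA hB
  · exact le_rfl
  · exact absurd ⟨hA.1, h x hA.1 hA.2⟩ hB
  · exact hw
  · exact le_rfl

theorem quenched_true (n t : ℕ) (P : Fin n → Fin n → ℝ) (hrow : ∀ i, ∑ j, P i j = 1)
    (i : Fin n) : quenched n t P i (fun _ => True) = 1 := by
  induction t generalizing i with
  | zero =>
    unfold quenched
    rw [Finset.sum_eq_single (fun _ => i)]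
    · simp [pathWeight]
    · intro x _ hx
      have : x 0 ≠ i := fun h => hx (funext fun s => by rw [Fin.fin_one_eq_zero s, ← h])
      simp [this]
    · simp
  | succ t ih => simp [quenched_succ, ih, hrow]

/-- Union bound: if from every state a single step of probability less than `δ` occurs with
probability at most `C`, then such a step occurs among the first `t` with probability at most
`t * C`. -/
theorem quenched_exists_lt_le (n t : ℕ) (P : Fin n → Fin n → ℝ) (hP : ∀ i j, 0 ≤ P i j)
    (hrow : ∀ i, ∑ j, P i j = 1) (δ C : ℝ)
    (hC : ∀ k, ∑ j, (if P k j < δ then P k j else 0) ≤ C) (i : Fin n) :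
    quenched n t P i (fun x => ∃ s : Fin t, P (x s.castSucc) (x s.succ) < δ) ≤ t * C := by
  induction t generalizing i with
  | zero => simp [quenched]
  | succ t ih =>
    have hC0 : 0 ≤ C :=
      (Finset.sum_nonneg fun j _ => by split_ifs <;> simp [hP]).trans (hC i)
    rw [quenched_succ]
    have step (k : Fin n) : P i k * quenched n t P k (fun y => ∃ s : Fin (t + 1),
        P ((Fin.cons i y : Fin (t + 2) → Fin n) s.castSucc)
          ((Fin.cons i y : Fin (t + 2) → Fin n) s.succ) < δ) ≤
        (if P i k < δ then P i k else 0) + P i k * (t * C) := by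
      split_ifs with h
      · have hone (A : (Fin (t + 1) → Fin n) → Prop) : quenched n t P k A ≤ 1 :=
          (quenched_mono n t P hP k (fun _ _ _ => trivial)).trans_eq (quenched_true n t P hrow k)
        have hpos : 0 ≤ P i k * (t * C) := mul_nonneg (hP i k) (by positivity)
        exact (mul_le_of_le_one_right (hP i k) (hone _)).trans (by linarith)
      · rw [zero_add]
        refine mul_le_mul_of_nonneg_left ((quenched_mono n t P hP k ?_).trans (ih k)) (hP i k)
        rintro y hy ⟨s, hs⟩
        induction s using Fin.cases with
        | zero => exact absurd (by simpa [hy] using hs) h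
        | succ s => exact ⟨s, by simpa [← Fin.succ_castSucc] using hs⟩
    refine (Finset.sum_le_sum fun k _ => step k).trans ?_
    rw [Finset.sum_add_distrib, ← Finset.sum_mul, hrow]
    push_cast
    linarith [hC i]

/-- Chebyshev-type bound for a single step. -/
theorem sum_ite_lt_le_div_log_sq {ι : Type*} [Fintype ι] (p : ι → ℝ) (hp : ∀ j, 0 ≤ p j) {δ : ℝ}
    (hδ : δ ∈ Set.Ioo (0 : ℝ) 1) :
    ∑ j, (if p j < δ then p j else 0) ≤
      (∑ j, p j * (Real.log (p j)) ^ 2) / (Real.log δ) ^ 2 := by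
  have hlog : Real.log δ < 0 := Real.log_neg hδ.1 hδ.2
  rw [le_div_iff₀ (sq_pos_of_neg hlog), Finset.sum_mul]
  refine Finset.sum_le_sum fun j _ => ?_
  split_ifs with h
  · rcases (hp j).eq_or_lt with h0 | h0
    · simp [← h0]
    · have := Real.log_lt_log h0 h
      exact mul_le_mul_of_nonneg_left (by nlinarith) (hp j)
  · rw [zero_mul]
    exact mul_nonneg (hp j) (sq_nonneg _)

theorem stmt3
    (n t : ℕ)
    (P : Fin n → Fin n → ℝ)
    (hnonneg : ∀ i j : Fin n, 0 ≤ P i j)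
    (hrow : ∀ i : Fin n, ∑ j : Fin n, P i j = 1)
    (δ : ℝ) (hδ : δ ∈ Set.Ioo (0 : ℝ) 1)
    (i : Fin n) :
    quenched n t P i (fun x => ∃ s : Fin t, P (x s.castSucc) (x s.succ) < δ) ≤
      ((t : ℝ) / (Real.log δ) ^ 2) *
        ⨆ k : Fin n, ∑ j : Fin n, P k j * (Real.log (P k j)) ^ 2 := by
  rw [div_mul_eq_mul_div, mul_div_assoc]
  refine quenched_exists_lt_le n t P hnonneg hrow δ _ (fun k => ?_) i
  refine (sum_ite_lt_le_div_log_sq (P k) (hnonneg k) hδ).trans ?_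
  gcongr
  exact le_ciSup (f := fun k => ∑ j, P k j * (Real.log (P k j)) ^ 2)
    (Set.finite_range _).bddAbove k
end

section
/- Consider the annealed model: σ = (σ_1,…,σ_n) are n independent uniformly distributed permutations of [n], P_σ(i,j) = p_{i,σ_i^{-1}(j)}, the starting state X_0 is uniform on [n] and independent of σ, and given σ, (X_0,X_1,…,X_t) is a Markov chain with transition matrix P_σ. Define the tree excess TX(x_0,…,x_t) = 1 + |E| − |V|, where V = {x_0,…,x_t} and E is the set of distinct directed edges {(x_0,x_1),…,(x_{t-1},x_t)}. Then for every n and every t ∈ ℕ, ℙ(TX(X_0,…,X_t) ≥ 1) ≤ t²/n and ℙ(TX(X_0,…,X_t) ≥ 2) ≤ t⁴/n². -/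
open Filter
open scoped BigOperators Classical

/-- Annealed probability: expectation over the uniform environment of the quenched
probability with uniform starting state. -/
noncomputable def annealed (n t : ℕ) (p : Fin n → Fin n → ℝ)
    (A : (Fin (t + 1) → Fin n) → Prop) : ℝ :=
  (∑ σ : Env n, (1 / (n : ℝ)) * ∑ i : Fin n, quenched n t (Pmat n p σ) i A) /
    (Fintype.card (Env n) : ℝ)

/-- Tree excess `TX(x_0,…,x_t) = 1 + |E| - |V|` of the directed graph induced
by a path (as an integer). -/
noncomputable def treeExcess (n t : ℕ) (x : Fin (t + 1) → Fin n) : ℤ :=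
  1 + ((Finset.univ.image (fun s : Fin t => (x s.castSucc, x s.succ))).card : ℤ)
    - ((Finset.univ.image x).card : ℤ)

open Finset in
/-- Among values of a nonnegative function that is constant off `N`, the share carried by `V \ N`
is at most the density of `V`. -/
theorem card_mul_sum_sdiff_le {ι : Type*} [Fintype ι] [DecidableEq ι] {N V : Finset ι} (hNV : N ⊆ V)
    {g : ι → ℝ} (hg : ∀ v, 0 ≤ g v) (hconst : ∀ v v', v ∉ N → v' ∉ N → g v = g v') :
    (Fintype.card ι : ℝ) * ∑ v ∈ V \ N, g v ≤ (V.card : ℝ) * ∑ v, g v := by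
  rcases (V \ N).eq_empty_or_nonempty with h | ⟨v₀, hv₀⟩
  · rw [h]
    simpa using mul_nonneg (Nat.cast_nonneg _) (sum_nonneg fun v _ => hg v)
  · have hv₀N := (mem_sdiff.1 hv₀).2
    have hsum : ∀ S : Finset ι, N ⊆ S →
        ∑ v ∈ S \ N, g v = ((S.card : ℝ) - N.card) * g v₀ := by
      intro S hS
      rw [sum_congr rfl fun v hv => hconst v v₀ (mem_sdiff.1 hv).2 hv₀N, sum_const,
        card_sdiff_of_subset hS, nsmul_eq_mul, Nat.cast_sub (card_le_card hS)]
    have hlow : ∑ v ∈ univ \ N, g v ≤ ∑ v, g v :=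
      sum_le_sum_of_subset_of_nonneg (subset_univ _) fun v _ _ => hg v
    rw [hsum univ (subset_univ _), card_univ] at hlow
    rw [hsum V hNV]
    have hVn : (V.card : ℝ) ≤ Fintype.card ι := by exact_mod_cast card_le_univ V
    have h1 := mul_le_mul_of_nonneg_left hlow (Nat.cast_nonneg (α := ℝ) V.card)
    have h2 := mul_nonneg (mul_nonneg (Nat.cast_nonneg (α := ℝ) N.card) (sub_nonneg.2 hVn)) (hg v₀)
    linarith

/-- The set of directed edges traversed by a path. -/
noncomputable def pathEdges {n t : ℕ} (x : Fin (t + 1) → Fin n) : Finset (Fin n × Fin n) :=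
  Finset.univ.image fun s : Fin t => (x s.castSucc, x s.succ)

/-- The set of vertices visited by a path. -/
noncomputable def pathVertices {n t : ℕ} (x : Fin (t + 1) → Fin n) : Finset (Fin n) :=
  Finset.univ.image x

/-- The out-neighbours of the endpoint of a path within the graph of the path. -/
noncomputable def endNeighbours {n t : ℕ} (x : Fin (t + 1) → Fin n) : Finset (Fin n) :=
  Finset.univ.filter fun v => (x (Fin.last t), v) ∈ pathEdges x

/-- Extend a path by one step. -/
def extendPath {n t : ℕ} (x : Fin (t + 1) → Fin n) (v : Fin n) : Fin (t + 2) → Fin n :=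
  Fin.snoc (α := fun _ => Fin n) x v

theorem extendPath_castSucc {n t : ℕ} (x : Fin (t + 1) → Fin n) (v : Fin n) (s : Fin (t + 1)) :
    extendPath x v s.castSucc = x s :=
  Fin.snoc_castSucc (α := fun _ => Fin n) v x s

theorem extendPath_last {n t : ℕ} (x : Fin (t + 1) → Fin n) (v : Fin n) :
    extendPath x v (Fin.last (t + 1)) = v :=
  Fin.snoc_last (α := fun _ => Fin n) v x

theorem sum_paths_succ {n t : ℕ} (f : (Fin (t + 2) → Fin n) → ℝ) :
    ∑ y, f y = ∑ x : Fin (t + 1) → Fin n, ∑ v : Fin n, f (extendPath x v) := by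
  rw [← (Fin.snocEquiv fun _ : Fin (t + 2) => Fin n).sum_comp, Fintype.sum_prod_type,
    Finset.sum_comm]
  rfl

theorem pathWeight_extendPath {n t : ℕ} (P : Fin n → Fin n → ℝ) (x : Fin (t + 1) → Fin n)
    (v : Fin n) :
    pathWeight n (t + 1) P (extendPath x v) = pathWeight n t P x * P (x (Fin.last t)) v := by
  unfold pathWeight
  rw [Fin.prod_univ_castSucc]
  simp only [Fin.succ_castSucc, Fin.succ_last, extendPath_castSucc, extendPath_last]

theorem pathEdges_extendPath {n t : ℕ} (x : Fin (t + 1) → Fin n) (v : Fin n) :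
    pathEdges (extendPath x v) = insert (x (Fin.last t), v) (pathEdges x) := by
  ext e
  simp [pathEdges, Fin.exists_fin_succ', Fin.succ_castSucc, extendPath_castSucc,
    extendPath_last, -Fin.castSucc_succ, eq_comm, or_comm]

theorem pathVertices_extendPath {n t : ℕ} (x : Fin (t + 1) → Fin n) (v : Fin n) :
    pathVertices (extendPath x v) = insert v (pathVertices x) := by
  ext e
  simp [pathVertices, Fin.exists_fin_succ', extendPath_castSucc, extendPath_last, eq_comm, or_comm]

theorem endNeighbours_subset {n t : ℕ} (x : Fin (t + 1) → Fin n) :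
    endNeighbours x ⊆ pathVertices x := by
  intro v hv
  simp only [endNeighbours, pathEdges, Finset.mem_filter, Finset.mem_image, Prod.mk.injEq] at hv
  obtain ⟨-, s, -, -, hs⟩ := hv
  exact Finset.mem_image.2 ⟨s.succ, Finset.mem_univ _, hs⟩

theorem card_pathVertices_le {n t : ℕ} (x : Fin (t + 1) → Fin n) :
    (pathVertices x).card ≤ t + 1 :=
  Finset.card_image_le.trans (by simp)

/-- The tree excess increases only when the last step is a new edge to an old vertex, and then
by at most one. -/
theorem of_succ_le_treeExcess_extendPath {n t : ℕ} {x : Fin (t + 1) → Fin n} {v : Fin n} {k : ℤ}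
    (h : k + 1 ≤ treeExcess n (t + 1) (extendPath x v)) :
    k + 1 ≤ treeExcess n t x ∨
      (k ≤ treeExcess n t x ∧ v ∈ pathVertices x \ endNeighbours x) := by
  have hx : treeExcess n t x = 1 + ((pathEdges x).card : ℤ) - (pathVertices x).card := rfl
  have hy : treeExcess n (t + 1) (extendPath x v) =
      1 + ((pathEdges (extendPath x v)).card : ℤ) - (pathVertices (extendPath x v)).card := rfl
  rw [hy, pathEdges_extendPath, pathVertices_extendPath] at h
  rw [hx]
  by_cases he : (x (Fin.last t), v) ∈ pathEdges x
  · have hv : v ∈ pathVertices x := endNeighbours_subset x (by simpa [endNeighbours] using he)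
    rw [Finset.insert_eq_of_mem he, Finset.insert_eq_of_mem hv] at h
    exact Or.inl h
  · rw [Finset.card_insert_of_notMem he] at h
    by_cases hv : v ∈ pathVertices x
    · rw [Finset.insert_eq_of_mem hv] at h
      refine Or.inr ⟨by push_cast at h; linarith, ?_⟩
      simpa [endNeighbours] using ⟨hv, he⟩
    · rw [Finset.card_insert_of_notMem hv] at h
      exact Or.inl (by push_cast at h; linarith)

/-- Total weight of a path over all environments. -/
noncomputable def totalWeight (n t : ℕ) (p : Fin n → Fin n → ℝ) (x : Fin (t + 1) → Fin n) : ℝ :=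
  ∑ σ : Env n, pathWeight n t (Pmat n p σ) x

/-- Total weight, over all environments, of the paths with a given property. -/
noncomputable def totalMass (n t : ℕ) (p : Fin n → Fin n → ℝ)
    (A : (Fin (t + 1) → Fin n) → Prop) : ℝ :=
  ∑ x : Fin (t + 1) → Fin n, if A x then totalWeight n t p x else 0

theorem annealed_eq (n t : ℕ) (p : Fin n → Fin n → ℝ) (A : (Fin (t + 1) → Fin n) → Prop) :
    annealed n t p A = totalMass n t p A / (n * Fintype.card (Env n)) := by
  have hq : ∀ P : Fin n → Fin n → ℝ, ∑ i, quenched n t P i A =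
      ∑ x : Fin (t + 1) → Fin n, if A x then pathWeight n t P x else 0 := by
    intro P
    unfold quenched
    rw [Finset.sum_comm]
    simp [ite_and]
  have hm : totalMass n t p A = ∑ σ : Env n, ∑ x : Fin (t + 1) → Fin n,
      if A x then pathWeight n t (Pmat n p σ) x else 0 := by
    unfold totalMass totalWeight
    rw [Finset.sum_comm]
    refine Finset.sum_congr rfl fun x _ => ?_
    split_ifs <;> simp
  unfold annealed
  simp only [hq]
  rw [← Finset.mul_sum, ← hm, one_div_mul_eq_div, div_div]

section

variable {n t : ℕ} {p : Fin n → Fin n → ℝ}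

theorem pathWeight_nonneg (hp : ∀ i j, 0 ≤ p i j) (σ : Env n) (x : Fin (t + 1) → Fin n) :
    0 ≤ pathWeight n t (Pmat n p σ) x :=
  Finset.prod_nonneg fun _ _ => hp _ _

theorem totalWeight_nonneg (hp : ∀ i j, 0 ≤ p i j) (x : Fin (t + 1) → Fin n) :
    0 ≤ totalWeight n t p x :=
  Finset.sum_nonneg fun σ _ => pathWeight_nonneg hp σ x

theorem sum_totalWeight_extendPath (hrow : ∀ i, ∑ j, p i j = 1) (x : Fin (t + 1) → Fin n) :
    ∑ v, totalWeight n (t + 1) p (extendPath x v) = totalWeight n t p x := by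
  unfold totalWeight
  rw [Finset.sum_comm]
  refine Finset.sum_congr rfl fun σ _ => ?_
  simp only [pathWeight_extendPath, ← Finset.mul_sum]
  rw [show ∑ v, Pmat n p σ (x (Fin.last t)) v = 1 from
    ((σ (x (Fin.last t))).symm.sum_comp _).trans (hrow _), mul_one]

/-- All unexplored continuations of a path have the same annealed weight. -/
theorem totalWeight_extendPath_eq (x : Fin (t + 1) → Fin n) {v v' : Fin n}
    (hv : v ∉ endNeighbours x) (hv' : v' ∉ endNeighbours x) :
    totalWeight n (t + 1) p (extendPath x v) = totalWeight n (t + 1) p (extendPath x v') := by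
  set i := x (Fin.last t) with hi
  let τ : Env n := Pi.mulSingle i (Equiv.swap v v')
  unfold totalWeight
  rw [← Equiv.sum_comp (Equiv.mulLeft τ)]
  refine Finset.sum_congr rfl fun σ _ => ?_
  have hPi : ∀ w, Pmat n p (τ * σ) i w = Pmat n p σ i (Equiv.swap v v' w) := by
    intro w
    have : (τ * σ) i = Equiv.swap v v' * σ i := by simp [τ]
    simp [Pmat, this, ← Equiv.Perm.inv_def, mul_inv_rev]
  have hPne : ∀ a w, a ≠ i → Pmat n p (τ * σ) a w = Pmat n p σ a w := by
    intro a w ha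
    have : (τ * σ) a = σ a := by simp [τ, Pi.mulSingle_eq_of_ne ha]
    simp [Pmat, this]
  rw [Equiv.coe_mulLeft, pathWeight_extendPath, pathWeight_extendPath, ← hi, hPi,
    Equiv.swap_apply_left]
  congr 1
  refine Finset.prod_congr rfl fun s _ => ?_
  by_cases hs : x s.castSucc = i
  · have hne : ∀ w, w ∉ endNeighbours x → x s.succ ≠ w := by
      rintro w hw rfl
      refine hw (Finset.mem_filter.2 ⟨Finset.mem_univ _, ?_⟩)
      exact Finset.mem_image.2 ⟨s, Finset.mem_univ _, by rw [hs]⟩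
    rw [hs, hPi, Equiv.swap_apply_of_ne_of_ne (hne v hv) (hne v' hv')]
  · exact hPne _ _ hs

theorem mul_sum_totalWeight_extendPath_le (hp : ∀ i j, 0 ≤ p i j) (hrow : ∀ i, ∑ j, p i j = 1)
    (x : Fin (t + 1) → Fin n) :
    (n : ℝ) * ∑ v ∈ pathVertices x \ endNeighbours x, totalWeight n (t + 1) p (extendPath x v) ≤
      (t + 1) * totalWeight n t p x := by
  have h := card_mul_sum_sdiff_le (endNeighbours_subset x)
    (g := fun v => totalWeight n (t + 1) p (extendPath x v))
    (fun v => totalWeight_nonneg hp _) fun v v' => totalWeight_extendPath_eq x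
  rw [Fintype.card_fin, sum_totalWeight_extendPath hrow] at h
  refine h.trans (mul_le_mul_of_nonneg_right ?_ (totalWeight_nonneg hp x))
  exact_mod_cast card_pathVertices_le x

/-- A union bound over the last step, for a property that is acquired only by entering an old
vertex through a new edge. -/
theorem mul_totalMass_succ_le (hp : ∀ i j, 0 ≤ p i j) (hrow : ∀ i, ∑ j, p i j = 1)
    {A' : (Fin (t + 2) → Fin n) → Prop} {A B : (Fin (t + 1) → Fin n) → Prop}
    (hAB : ∀ x, A x → B x)
    (hstep : ∀ x v, A' (extendPath x v) →
      A x ∨ (B x ∧ v ∈ pathVertices x \ endNeighbours x)) :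
    (n : ℝ) * totalMass n (t + 1) p A' ≤
      n * totalMass n t p A + (t + 1) * totalMass n t p B := by
  unfold totalMass
  rw [sum_paths_succ, Finset.mul_sum, Finset.mul_sum, Finset.mul_sum, ← Finset.sum_add_distrib]
  refine Finset.sum_le_sum fun x _ => ?_
  have hw : ∀ v, 0 ≤ totalWeight n (t + 1) p (extendPath x v) := fun v => totalWeight_nonneg hp _
  have hx := totalWeight_nonneg hp x
  by_cases h1 : A x
  · rw [if_pos h1, if_pos (hAB x h1)]
    have : ∑ v, (if A' (extendPath x v) then
        totalWeight n (t + 1) p (extendPath x v) else 0) ≤ totalWeight n t p x := by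
      rw [← sum_totalWeight_extendPath hrow x]
      refine Finset.sum_le_sum fun v _ => ?_
      split_ifs
      · exact le_rfl
      · exact hw v
    have h2 := mul_le_mul_of_nonneg_left this (Nat.cast_nonneg (α := ℝ) n)
    have h3 : 0 ≤ ((t : ℝ) + 1) * totalWeight n t p x := by positivity
    linarith
  · rw [if_neg h1, mul_zero, zero_add]
    by_cases h0 : B x
    · rw [if_pos h0]
      refine le_trans (mul_le_mul_of_nonneg_left ?_ (Nat.cast_nonneg n))
        (mul_sum_totalWeight_extendPath_le hp hrow x)
      rw [← Finset.sum_filter]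
      refine Finset.sum_le_sum_of_subset_of_nonneg (fun v hv => ?_) fun v _ _ => hw v
      exact ((hstep x v (Finset.mem_filter.1 hv).2).resolve_left h1).2
    · rw [if_neg h0, mul_zero, Finset.sum_eq_zero, mul_zero]
      intro v _
      refine if_neg fun h => ?_
      rcases hstep x v h with h | h
      · exact h1 h
      · exact h0 h.1

theorem sum_totalWeight (hrow : ∀ i, ∑ j, p i j = 1) :
    ∑ x, totalWeight n t p x = n * Fintype.card (Env n) := by
  induction t with
  | zero =>
    simp only [totalWeight, pathWeight, Finset.univ_eq_empty, Finset.prod_empty,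
      Finset.sum_const, Finset.card_univ, nsmul_eq_mul, mul_one]
    simp
  | succ t ih =>
    rw [sum_paths_succ, ← ih]
    exact Finset.sum_congr rfl fun x _ => sum_totalWeight_extendPath hrow x

theorem annealed_le_one (hp : ∀ i j, 0 ≤ p i j) (hrow : ∀ i, ∑ j, p i j = 1)
    (A : (Fin (t + 1) → Fin n) → Prop) : annealed n t p A ≤ 1 := by
  rw [annealed_eq, ← sum_totalWeight (t := t) hrow]
  refine div_le_one_of_le₀ (Finset.sum_le_sum fun x _ => ?_)
    (Finset.sum_nonneg fun x _ => totalWeight_nonneg hp x)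
  split_ifs
  · exact le_rfl
  · exact totalWeight_nonneg hp x

theorem annealed_succ_le (hn : 0 < n) (hp : ∀ i j, 0 ≤ p i j) (hrow : ∀ i, ∑ j, p i j = 1)
    (k : ℤ) :
    annealed n (t + 1) p (fun x => k + 1 ≤ treeExcess n (t + 1) x) ≤
      annealed n t p (fun x => k + 1 ≤ treeExcess n t x) +
        (t + 1) / n * annealed n t p (fun x => k ≤ treeExcess n t x) := by
  have hn' : (0 : ℝ) < n := by exact_mod_cast hn
  have hc : (0 : ℝ) < Fintype.card (Env n) := by exact_mod_cast Fintype.card_pos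
  have h := mul_totalMass_succ_le hp hrow
    (A' := fun x => k + 1 ≤ treeExcess n (t + 1) x) (A := fun x => k + 1 ≤ treeExcess n t x)
    (B := fun x => k ≤ treeExcess n t x) (fun x hx => by linarith)
    fun x v => of_succ_le_treeExcess_extendPath
  simp only [annealed_eq]
  rw [div_mul_div_comm, div_add_div _ _ (by positivity) (by positivity),
    div_le_div_iff₀ (by positivity) (by positivity)]
  have := mul_le_mul_of_nonneg_right h
    (by positivity : (0 : ℝ) ≤ (n * Fintype.card (Env n)) * (n * Fintype.card (Env n)))
  linarith

theorem annealed_zero_eq_zero {k : ℤ} (hk : 1 ≤ k) :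
    annealed n 0 p (fun x => k ≤ treeExcess n 0 x) = 0 := by
  rw [annealed_eq, totalMass, Finset.sum_eq_zero, zero_div]
  intro x _
  refine if_neg ?_
  have hpos : 0 < (Finset.univ.image x).card :=
    Finset.card_pos.2 (Finset.univ_nonempty.image x)
  simp only [treeExcess, Finset.univ_eq_empty, Finset.image_empty, Finset.card_empty]
  omega

theorem annealed_one_le_treeExcess (hn : 0 < n) (hp : ∀ i j, 0 ≤ p i j)
    (hrow : ∀ i, ∑ j, p i j = 1) :
    annealed n t p (fun x => 1 ≤ treeExcess n t x) ≤ (t : ℝ) ^ 2 / n := by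
  have hn' : (0 : ℝ) < n := by exact_mod_cast hn
  induction t with
  | zero => simp [annealed_zero_eq_zero]
  | succ t ih =>
    have h := annealed_succ_le (t := t) hn hp hrow 0
    rw [zero_add] at h
    have h1 := mul_le_mul_of_nonneg_left
      (annealed_le_one (t := t) hp hrow fun x => 0 ≤ treeExcess n t x)
      (by positivity : (0 : ℝ) ≤ (t + 1) / n)
    calc _ ≤ (t : ℝ) ^ 2 / n + (t + 1) / n * 1 := by linarith
      _ = ((t : ℝ) ^ 2 + (t + 1)) / n := by ring
      _ ≤ _ := by
        gcongr
        push_cast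
        nlinarith [Nat.cast_nonneg (α := ℝ) t]

theorem annealed_two_le_treeExcess (hn : 0 < n) (hp : ∀ i j, 0 ≤ p i j)
    (hrow : ∀ i, ∑ j, p i j = 1) :
    annealed n t p (fun x => 2 ≤ treeExcess n t x) ≤ (t : ℝ) ^ 4 / (n : ℝ) ^ 2 := by
  have hn' : (0 : ℝ) < n := by exact_mod_cast hn
  induction t with
  | zero => simp [annealed_zero_eq_zero]
  | succ t ih =>
    have h := annealed_succ_le (t := t) hn hp hrow 1
    rw [one_add_one_eq_two] at h
    have h1 := mul_le_mul_of_nonneg_left (annealed_one_le_treeExcess (t := t) hn hp hrow)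
      (by positivity : (0 : ℝ) ≤ (t + 1) / n)
    calc _ ≤ (t : ℝ) ^ 4 / (n : ℝ) ^ 2 + (t + 1) / n * ((t : ℝ) ^ 2 / n) := by linarith
      _ = ((t : ℝ) ^ 4 + (t + 1) * t ^ 2) / (n : ℝ) ^ 2 := by field_simp
      _ ≤ _ := by
        gcongr
        push_cast
        have ht : (0 : ℝ) ≤ t := Nat.cast_nonneg t
        have : (0 : ℝ) ≤ 3 * t ^ 3 + 5 * t ^ 2 + 4 * t + 1 := by positivity
        linarith

end

theorem stmt4
    (n t : ℕ)
    (p : Fin n → Fin n → ℝ)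
    (hnonneg : ∀ i j : Fin n, 0 ≤ p i j)
    (hrow : ∀ i : Fin n, ∑ j : Fin n, p i j = 1) :
    annealed n t p (fun x => 1 ≤ treeExcess n t x) ≤ (t : ℝ) ^ 2 / n ∧
    annealed n t p (fun x => 2 ≤ treeExcess n t x) ≤ (t : ℝ) ^ 4 / (n : ℝ) ^ 2 := by
  rcases Nat.eq_zero_or_pos n with rfl | hn
  · simp [annealed_eq]
  · exact ⟨annealed_one_le_treeExcess hn hnonneg hrow, annealed_two_le_treeExcess hn hnonneg hrow⟩
end

section
/- Assume the sparsity condition (H_n is bounded as n → ∞ and max_{i∈[n]} Σ_{j=1}^n p_{i,j}(log p_{i,j})² = o(log n)) and the non-degeneracy condition (lim_{ε→0⁺} limsup_{n→∞} (1/n)·#{(i,j) : p_{i,j} > 1−ε} = 0). Then for every sequence of times t_n = Θ(log n) and every sequence δ_n > 0 with δ_n → 0, the random variable max_{i∈[n]} Q_i( ρ(t_n) > e^{−δ_n t_n} ) converges to 0 in probability as n → ∞. -/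
open Filter
open scoped BigOperators Classical

/-- Loop erasure: a walk of length `t` either contains a simple cycle of weight at least `1`, or
can be shortened to a walk with distinct sources without decreasing its weight. -/
lemma exists_cycle_or_simple {V : Type*} (w : V → V → ℝ) (hw : ∀ a b, 0 ≤ w a b) (t : ℕ) :
    ∀ x : ℕ → V,
      (∃ l < t, ∃ y : ℕ → V, Set.InjOn y (Set.Iio (l + 1)) ∧ y (l + 1) = y 0 ∧
        1 ≤ ∏ k ∈ Finset.range (l + 1), w (y k) (y (k + 1))) ∨
      (∃ m ≤ t, ∃ y : ℕ → V, Set.InjOn y (Set.Iio m) ∧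
        ∏ k ∈ Finset.range t, w (x k) (x (k + 1)) ≤
          ∏ k ∈ Finset.range m, w (y k) (y (k + 1))) := by
  induction t using Nat.strong_induction_on with
  | _ t ih =>
  intro x
  by_cases hinj : Set.InjOn x (Set.Iio t)
  · exact Or.inr ⟨t, le_rfl, x, hinj, le_rfl⟩
  have hex : ∃ b, b < t ∧ ∃ a < b, x a = x b := by
    simp only [Set.InjOn, not_forall] at hinj
    obtain ⟨a, ha, b, hb, hab, hne⟩ := hinj
    rcases lt_or_gt_of_ne hne with h | h
    · exact ⟨b, hb, a, h, hab⟩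
    · exact ⟨a, ha, b, h, hab.symm⟩
  obtain ⟨b, ⟨hbt, a, hab, hxab⟩, hmin⟩ :
      ∃ b, (b < t ∧ ∃ a < b, x a = x b) ∧ ∀ c < b, ¬ (c < t ∧ ∃ a < c, x a = x c) :=
    ⟨Nat.find hex, Nat.find_spec hex, fun c hc => Nat.find_min hex hc⟩
  have hinjb : Set.InjOn x (Set.Iio b) := by
    intro c hc d hd hcd
    by_contra hne
    simp only [Set.mem_Iio] at hc hd
    rcases lt_or_gt_of_ne hne with h | h
    · exact hmin d hd ⟨hd.trans hbt, c, h, hcd⟩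
    · exact hmin c hc ⟨hc.trans hbt, d, h, hcd.symm⟩
  obtain ⟨l, rfl⟩ : ∃ l, b = a + (l + 1) := ⟨b - a - 1, by omega⟩
  obtain ⟨r, rfl⟩ : ∃ r, t = a + (l + 1) + r := ⟨t - (a + (l + 1)), by omega⟩
  by_cases hC : 1 ≤ ∏ k ∈ Finset.range (l + 1), w (x (a + k)) (x (a + k + 1))
  · refine Or.inl ⟨l, by omega, fun k => x (a + k), ?_, ?_, hC⟩
    · intro c hc d hd hcd
      simp only [Set.mem_Iio] at hc hd
      have := hinjb (by simp; omega) (by simp; omega) hcd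
      omega
    · simpa using hxab.symm
  · push Not at hC
    let z : ℕ → V := fun k => if k ≤ a then x k else x (k + (l + 1))
    have hz1 : ∏ k ∈ Finset.range a, w (z k) (z (k + 1)) =
        ∏ k ∈ Finset.range a, w (x k) (x (k + 1)) := by
      refine Finset.prod_congr rfl fun k hk => ?_
      have hk := Finset.mem_range.1 hk
      simp only [z, if_pos hk.le, if_pos (Nat.succ_le_of_lt hk)]
    have hz2 : ∀ k, z (a + k) = x (a + (l + 1) + k) := by
      intro k
      rcases Nat.eq_zero_or_pos k with rfl | hk
      · simp [z, hxab]
      · simp only [z, if_neg (show ¬ a + k ≤ a by omega)]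
        congr 1
        omega
    have hz : ∏ k ∈ Finset.range (a + r), w (z k) (z (k + 1)) =
        (∏ k ∈ Finset.range a, w (x k) (x (k + 1))) *
          ∏ k ∈ Finset.range r, w (x (a + (l + 1) + k)) (x (a + (l + 1) + k + 1)) := by
      rw [Finset.prod_range_add, hz1]
      congr 1
      refine Finset.prod_congr rfl fun k _ => ?_
      rw [hz2, add_assoc a k 1, hz2, add_assoc (a + (l + 1)) k 1]
    have hle : ∏ k ∈ Finset.range (a + (l + 1) + r), w (x k) (x (k + 1)) ≤
        ∏ k ∈ Finset.range (a + r), w (z k) (z (k + 1)) := by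
      rw [hz, Finset.prod_range_add, Finset.prod_range_add]
      refine mul_le_mul_of_nonneg_right ?_ (Finset.prod_nonneg fun _ _ => hw _ _)
      exact mul_le_of_le_one_right (Finset.prod_nonneg fun _ _ => hw _ _) hC.le
    rcases ih (a + r) (by omega) z with ⟨l', hl', h⟩ | ⟨m, hm, y, hy, h⟩
    · exact Or.inl ⟨l', by omega, h⟩
    · exact Or.inr ⟨m, by omega, y, hy, hle.trans h⟩

/-- The preimage of a point under a uniform permutation is uniform. -/
lemma sum_perm_symm_apply {n : ℕ} (f : Fin n → ℝ) (y : Fin n) :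
    ∑ τ : Equiv.Perm (Fin n), f (τ.symm y) =
      (Fintype.card (Equiv.Perm (Fin n)) : ℝ) * ((∑ j, f j) / n) := by
  have hn : (n : ℝ) ≠ 0 := by
    have := y.pos
    positivity
  have hconst : ∀ z : Fin n, ∑ τ : Equiv.Perm (Fin n), f (τ.symm z) =
      ∑ τ : Equiv.Perm (Fin n), f (τ.symm y) := by
    intro z
    refine Fintype.sum_equiv (Equiv.mulLeft (Equiv.swap z y)) _ _ fun τ => ?_
    change f (τ.symm z) = f (τ.symm ((Equiv.swap z y).symm y))
    simp
  have h1 : ∑ z : Fin n, ∑ τ : Equiv.Perm (Fin n), f (τ.symm z) =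
      n * ∑ τ : Equiv.Perm (Fin n), f (τ.symm y) := by
    simp [hconst]
  have h2 : ∑ z : Fin n, ∑ τ : Equiv.Perm (Fin n), f (τ.symm z) =
      (Fintype.card (Equiv.Perm (Fin n)) : ℝ) * ∑ j, f j := by
    rw [Finset.sum_comm]
    simp [Equiv.sum_comp]
  field_simp
  linarith

/-- Distinct rows of the random matrix are independent. -/
lemma sum_env_prod {n l : ℕ} (g : Fin n → Fin n → ℝ) (x y : Fin l → Fin n)
    (hx : Function.Injective x) :
    (∑ σ : Env n, ∏ k, Pmat n g σ (x k) (y k)) / (Fintype.card (Env n) : ℝ) =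
      ∏ k, (∑ j, g (x k) j) / n := by
  obtain ⟨y', hy'⟩ : ∃ y' : Fin n → Fin n, ∀ k, y' (x k) = y k :=
    ⟨Function.extend x y id, fun k => hx.extend_apply _ _ _⟩
  have key : ∀ G : Fin n → ℝ, ∏ k, G (x k) =
      ∏ i, if i ∈ Finset.univ.image x then G i else 1 := by
    intro G
    rw [Finset.prod_ite_mem, Finset.univ_inter, Finset.prod_image hx.injOn]
  have hσ : ∀ σ : Env n, ∏ k, Pmat n g σ (x k) (y k) =
      ∏ i, if i ∈ Finset.univ.image x then g i ((σ i).symm (y' i)) else 1 := by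
    intro σ
    rw [← key fun i => g i ((σ i).symm (y' i))]
    simp [Pmat, hy']
  have hcard : (Fintype.card (Env n) : ℝ) =
      ∏ _i : Fin n, (Fintype.card (Equiv.Perm (Fin n)) : ℝ) := by
    simp [Env]
  simp only [hσ]
  rw [key fun i => (∑ j, g i j) / n, ← Fintype.prod_sum
    (fun (i : Fin n) (τ : Equiv.Perm (Fin n)) =>
      if i ∈ Finset.univ.image x then g i (τ.symm (y' i)) else 1), hcard, ← Finset.prod_div_distrib]
  refine Finset.prod_congr rfl fun i _ => ?_
  have hc : (Fintype.card (Equiv.Perm (Fin n)) : ℝ) ≠ 0 := by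
    exact_mod_cast Fintype.card_ne_zero
  split_ifs with h
  · rw [sum_perm_symm_apply, mul_div_cancel_left₀ _ hc]
  · simp [hc]

lemma Pr_le_of_one_le {n : ℕ} {E : Env n → Prop} (Y : Env n → ℝ) (hY : ∀ σ, 0 ≤ Y σ)
    (h : ∀ σ, E σ → 1 ≤ Y σ) :
    Pr n E ≤ (∑ σ, Y σ) / (Fintype.card (Env n) : ℝ) := by
  unfold Pr
  gcongr with σ
  split_ifs with hE
  · exact h σ hE
  · exact hY σ

/-- Total weight of the walks with distinct sources `x` and last vertex `e x`. -/
noncomputable def simpleWeight (n : ℕ) (g : Fin n → Fin n → ℝ) (l : ℕ)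
    (e : (Fin l → Fin n) → Fin n) : ℝ :=
  ∑ x : Fin l → Fin n, if Function.Injective x then
    ∏ k : Fin l, g (x k) (if h : (k : ℕ) + 1 < l then x ⟨k + 1, h⟩ else e x) else 0

lemma simpleWeight_nonneg {n : ℕ} {g : Fin n → Fin n → ℝ} (hg : ∀ i j, 0 ≤ g i j) (l : ℕ)
    (e : (Fin l → Fin n) → Fin n) : 0 ≤ simpleWeight n g l e := by
  refine Finset.sum_nonneg fun x _ => ?_
  split_ifs
  · exact Finset.prod_nonneg fun _ _ => hg _ _
  · exact le_rfl

lemma avg_simpleWeight_le {n : ℕ} {g : Fin n → Fin n → ℝ} (hg : ∀ i j, 0 ≤ g i j) (l : ℕ)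
    (e : (Fin l → Fin n) → Fin n) :
    (∑ σ : Env n, simpleWeight n (Pmat n g σ) l e) / (Fintype.card (Env n) : ℝ) ≤
      ((∑ i, ∑ j, g i j) / n) ^ l := by
  unfold simpleWeight
  rw [Finset.sum_comm, Finset.sum_div, Finset.sum_div, Fintype.sum_pow]
  refine Finset.sum_le_sum fun x _ => ?_
  split_ifs with hx
  · exact (sum_env_prod g x _ hx).le
  · simp only [Finset.sum_const_zero, zero_div]
    exact Finset.prod_nonneg fun k _ =>
      div_nonneg (Finset.sum_nonneg fun _ _ => hg _ _) (Nat.cast_nonneg _)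

lemma one_le_simpleWeight {n : ℕ} {g : Fin n → Fin n → ℝ} (hg : ∀ i j, 0 ≤ g i j) (l : ℕ)
    (e : (Fin l → Fin n) → Fin n) (y : ℕ → Fin n) (hy : Set.InjOn y (Set.Iio l))
    (he : e (fun k => y k) = y l)
    (h1 : 1 ≤ ∏ k ∈ Finset.range l, g (y k) (y (k + 1))) : 1 ≤ simpleWeight n g l e := by
  unfold simpleWeight
  have hinj : Function.Injective (fun k : Fin l => y k) := by
    intro a b hab
    exact Fin.ext (hy a.2 b.2 hab)
  refine le_trans ?_ (Finset.single_le_sum (fun x _ => ?_)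
    (Finset.mem_univ (fun k : Fin l => y k)))
  · rw [if_pos hinj]
    refine h1.trans_eq ?_
    rw [← Fin.prod_univ_eq_prod_range (fun k => g (y k) (y (k + 1)))]
    refine Finset.prod_congr rfl fun k _ => ?_
    split_ifs with hk
    · rfl
    · rw [he, show (k : ℕ) + 1 = l by omega]
  · split_ifs
    · exact Finset.prod_nonneg fun _ _ => hg _ _
    · exact le_rfl

/-- First moment bound for the existence of a simple cycle of weight at least `1`, or a walk of
length at least `t / 2` with distinct sources and weight at least `1`. -/
lemma Pr_exists_heavy_le {n t : ℕ} {g : Fin n → Fin n → ℝ} (hg : ∀ i j, 0 ≤ g i j) {q : ℝ}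
    (hq0 : 0 ≤ q) (hq : q ≤ 1 / 2) (hgq : (∑ i, ∑ j, g i j) / n ≤ q ^ 2) {E : Env n → Prop}
    (hE : ∀ σ, E σ →
      (∃ l < t, ∃ y : ℕ → Fin n, Set.InjOn y (Set.Iio (l + 1)) ∧ y (l + 1) = y 0 ∧
        1 ≤ ∏ k ∈ Finset.range (l + 1), Pmat n g σ (y k) (y (k + 1))) ∨
      (∃ m ≤ t, t ≤ 2 * m ∧ ∃ y : ℕ → Fin n, Set.InjOn y (Set.Iio m) ∧
        1 ≤ ∏ k ∈ Finset.range m, Pmat n g σ (y k) (y (k + 1)))) :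
    Pr n E ≤ 2 * q + n * (2 * q) ^ t := by
  have hP : ∀ (σ : Env n) i j, 0 ≤ Pmat n g σ i j := fun σ i j => hg _ _
  have hM0 : 0 ≤ (∑ i, ∑ j, g i j) / n :=
    div_nonneg (Finset.sum_nonneg fun _ _ => Finset.sum_nonneg fun _ _ => hg _ _)
      (Nat.cast_nonneg _)
  let I := (Finset.range (t + 1)).filter fun m => t ≤ 2 * m
  let Y₁ : Env n → ℝ := fun σ =>
    ∑ l ∈ Finset.range t, simpleWeight n (Pmat n g σ) (l + 1) (fun x => x 0)
  let Y₂ : Env n → ℝ := fun σ =>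
    ∑ m ∈ I, ∑ z : Fin n, simpleWeight n (Pmat n g σ) m (fun _ => z)
  have hY₁ : ∀ σ, 0 ≤ Y₁ σ := fun σ =>
    Finset.sum_nonneg fun _ _ => simpleWeight_nonneg (hP σ) _ _
  have hY₂ : ∀ σ, 0 ≤ Y₂ σ := fun σ =>
    Finset.sum_nonneg fun _ _ => Finset.sum_nonneg fun _ _ => simpleWeight_nonneg (hP σ) _ _
  have hPr : Pr n E ≤ (∑ σ, (Y₁ σ + Y₂ σ)) / (Fintype.card (Env n) : ℝ) := by
    refine Pr_le_of_one_le _ (fun σ => add_nonneg (hY₁ σ) (hY₂ σ)) fun σ hσ => ?_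
    rcases hE σ hσ with ⟨l, hl, y, hy, hyl, h1⟩ | ⟨m, hm, htm, y, hy, h1⟩
    · have h2 := one_le_simpleWeight (hP σ) (l + 1) (fun x => x 0) y hy (by simp [hyl]) h1
      have h3 := Finset.single_le_sum (f := fun l =>
        simpleWeight n (Pmat n g σ) (l + 1) (fun x => x 0))
        (fun l _ => simpleWeight_nonneg (hP σ) _ _) (Finset.mem_range.2 hl)
      have h4 := hY₂ σ
      simp only [Y₁]
      linarith
    · have h2 := one_le_simpleWeight (hP σ) m (fun _ => y m) y hy rfl h1
      have h3 := Finset.single_le_sum (f := fun z =>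
        simpleWeight n (Pmat n g σ) m (fun _ => z))
        (fun l _ => simpleWeight_nonneg (hP σ) _ _) (Finset.mem_univ (y m))
      have h4 := Finset.single_le_sum (f := fun m =>
        ∑ z : Fin n, simpleWeight n (Pmat n g σ) m (fun _ => z)) (s := I)
        (fun l _ => Finset.sum_nonneg fun _ _ => simpleWeight_nonneg (hP σ) _ _)
        (Finset.mem_filter.2 ⟨Finset.mem_range.2 (Nat.lt_succ_of_le hm), htm⟩)
      have h5 := hY₁ σ
      simp only [Y₂] at h4 ⊢
      linarith
  have hA₁ : (∑ σ, Y₁ σ) / (Fintype.card (Env n) : ℝ) ≤ 2 * q := by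
    simp only [Y₁]
    rw [Finset.sum_comm, Finset.sum_div]
    have hgeo : ∑ l ∈ Finset.range t, ((1 : ℝ) / 2) ^ l ≤ 2 := by
      simpa using sum_geometric_two_le t
    calc _ ≤ ∑ l ∈ Finset.range t, q * (1 / 2) ^ l := by
          refine Finset.sum_le_sum fun l _ => (avg_simpleWeight_le hg _ _).trans ?_
          calc _ ≤ (q ^ 2) ^ (l + 1) := by gcongr
            _ ≤ q ^ (l + 1) := by
                gcongr
                nlinarith
            _ = q * q ^ l := by ring
            _ ≤ q * (1 / 2) ^ l := by gcongr
      _ ≤ 2 * q := by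
          rw [← Finset.mul_sum]
          nlinarith
  have hA₂ : (∑ σ, Y₂ σ) / (Fintype.card (Env n) : ℝ) ≤ n * (2 * q) ^ t := by
    simp only [Y₂]
    rw [Finset.sum_comm, Finset.sum_div]
    have hcard : (I.card : ℝ) ≤ 2 ^ t := by
      have h1 : I.card ≤ t + 1 := (Finset.card_filter_le _ _).trans_eq (by simp)
      have h2 : t + 1 ≤ 2 ^ t := Nat.lt_two_pow_self
      exact_mod_cast h1.trans h2
    calc _ ≤ ∑ m ∈ I, n * q ^ t := by
          refine Finset.sum_le_sum fun m hm => ?_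
          rw [Finset.sum_comm, Finset.sum_div]
          have htm : t ≤ 2 * m := (Finset.mem_filter.1 hm).2
          calc _ ≤ ∑ _z : Fin n, q ^ t := by
                refine Finset.sum_le_sum fun z _ => (avg_simpleWeight_le hg _ _).trans ?_
                calc _ ≤ (q ^ 2) ^ m := by gcongr
                  _ = q ^ (2 * m) := (pow_mul _ _ _).symm
                  _ ≤ q ^ t := pow_le_pow_of_le_one hq0 (by linarith) htm
            _ = n * q ^ t := by simp
      _ = I.card * (n * q ^ t) := by simp
      _ ≤ 2 ^ t * (n * q ^ t) := by gcongr
      _ = n * (2 * q) ^ t := by rw [mul_pow]; ring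
  calc _ ≤ _ := hPr
    _ ≤ _ := by
      rw [Finset.sum_add_distrib, add_div]
      exact add_le_add hA₁ hA₂

/-- A walk of weight greater than `exp (-d t)` yields a simple cycle or a long walk with distinct
sources whose weight is at least `1` after tilting each step. -/
lemma exists_heavy_of_pathWeight {n t s : ℕ} {p : Fin n → Fin n → ℝ}
    (h0 : ∀ i j, 0 ≤ p i j) (h1 : ∀ i j, p i j ≤ 1) {d : ℝ} (hd : 0 < d) (σ : Env n)
    (x : Fin (t + 1) → Fin n) (hx : Real.exp (-d * t) < pathWeight n t (Pmat n p σ) x) :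
    (∃ l < t, ∃ y : ℕ → Fin n, Set.InjOn y (Set.Iio (l + 1)) ∧ y (l + 1) = y 0 ∧
        1 ≤ ∏ k ∈ Finset.range (l + 1),
          Pmat n (fun i j => (Real.exp (2 * d) * p i j) ^ s) σ (y k) (y (k + 1))) ∨
      (∃ m ≤ t, t ≤ 2 * m ∧ ∃ y : ℕ → Fin n, Set.InjOn y (Set.Iio m) ∧
        1 ≤ ∏ k ∈ Finset.range m,
          Pmat n (fun i j => (Real.exp (2 * d) * p i j) ^ s) σ (y k) (y (k + 1))) := by
  let w : Fin n → Fin n → ℝ := fun i j => Real.exp (2 * d) * Pmat n p σ i j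
  have hw : ∀ i j, 0 ≤ w i j := fun i j => mul_nonneg (Real.exp_pos _).le (h0 _ _)
  have hpow : ∀ (l : ℕ) (y : ℕ → Fin n), 1 ≤ ∏ k ∈ Finset.range l, w (y k) (y (k + 1)) →
      1 ≤ ∏ k ∈ Finset.range l,
        Pmat n (fun i j => (Real.exp (2 * d) * p i j) ^ s) σ (y k) (y (k + 1)) := by
    intro l y h
    have : ∏ k ∈ Finset.range l,
        Pmat n (fun i j => (Real.exp (2 * d) * p i j) ^ s) σ (y k) (y (k + 1)) =
        (∏ k ∈ Finset.range l, w (y k) (y (k + 1))) ^ s := by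
      rw [← Finset.prod_pow]
      rfl
    rw [this]
    exact one_le_pow₀ h
  let x' : ℕ → Fin n := fun k => if h : k < t + 1 then x ⟨k, h⟩ else x 0
  have hx' : Real.exp (d * t) ≤ ∏ k ∈ Finset.range t, w (x' k) (x' (k + 1)) := by
    have : ∏ k ∈ Finset.range t, w (x' k) (x' (k + 1)) =
        Real.exp (2 * d) ^ t * pathWeight n t (Pmat n p σ) x := by
      rw [← Fin.prod_univ_eq_prod_range (fun k => w (x' k) (x' (k + 1)))]
      simp only [w, Finset.prod_mul_distrib, pathWeight, Finset.prod_const, Finset.card_univ,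
        Fintype.card_fin]
      congr 1
      refine Finset.prod_congr rfl fun k _ => ?_
      have hk := k.2
      simp only [x', dif_pos (show (k : ℕ) < t + 1 by omega),
        dif_pos (show (k : ℕ) + 1 < t + 1 by omega)]
      rfl
    rw [this]
    calc Real.exp (d * t) = Real.exp (2 * d) ^ t * Real.exp (-d * t) := by
          rw [← Real.exp_nat_mul, ← Real.exp_add]
          congr 1
          ring
      _ ≤ _ := by gcongr
  rcases exists_cycle_or_simple w hw t x' with ⟨l, hl, y, hy, hyl, h⟩ | ⟨m, hm, y, hy, h⟩
  · exact Or.inl ⟨l, hl, y, hy, hyl, hpow _ _ h⟩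
  · have h2 := hx'.trans h
    refine Or.inr ⟨m, hm, ?_, y, hy, hpow _ _ (le_trans ?_ h2)⟩
    · have h3 : ∏ k ∈ Finset.range m, w (y k) (y (k + 1)) ≤ Real.exp (2 * d) ^ m := by
        calc _ ≤ ∏ _k ∈ Finset.range m, Real.exp (2 * d) :=
              Finset.prod_le_prod (fun _ _ => hw _ _) fun k _ =>
                mul_le_of_le_one_right (Real.exp_pos _).le (h1 _ _)
          _ = _ := by simp
      have h4 := h2.trans h3
      rw [← Real.exp_nat_mul, Real.exp_le_exp] at h4
      have h5 : (t : ℝ) ≤ 2 * m := by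
        by_contra hlt
        push Not at hlt
        nlinarith
      exact_mod_cast h5
    · exact Real.one_le_exp (by positivity)

/-- Nearly deterministic entries dominate high power sums of a stochastic row. -/
lemma sum_pow_succ_le {ι : Type*} [Fintype ι] {f : ι → ℝ} (h0 : ∀ j, 0 ≤ f j)
    (h1 : ∑ j, f j = 1) {e : ℝ} (k : ℕ) :
    ∑ j, f j ^ (k + 1) ≤ |1 - e| ^ k + ∑ j, if 1 - e < f j then (1 : ℝ) else 0 := by
  have hle : ∀ j, f j ≤ 1 := fun j =>
    h1 ▸ Finset.single_le_sum (fun i _ => h0 i) (Finset.mem_univ j)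
  calc _ ≤ ∑ j, (f j * |1 - e| ^ k + if 1 - e < f j then (1 : ℝ) else 0) := by
        refine Finset.sum_le_sum fun j _ => ?_
        split_ifs with h
        · have := pow_le_one₀ (n := k + 1) (h0 j) (hle j)
          have := mul_nonneg (h0 j) (pow_nonneg (abs_nonneg (1 - e)) k)
          linarith
        · rw [pow_succ', add_zero]
          have := h0 j
          have : f j ≤ |1 - e| := (not_lt.1 h).trans (le_abs_self _)
          gcongr
    _ = _ := by rw [Finset.sum_add_distrib, ← Finset.sum_mul, h1, one_mul]

/-- Under non-degeneracy, averaged high power sums of the rows are eventually small. -/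
lemma exists_eventually_avg_pow_le {p : (n : ℕ) → Fin n → Fin n → ℝ}
    (hnonneg : ∀ n (i j : Fin n), 0 ≤ p n i j)
    (hrow : ∀ n (i : Fin n), ∑ j : Fin n, p n i j = 1)
    (hnondeg : Tendsto (fun ε : ℝ =>
        Filter.limsup (fun n : ℕ =>
          (1 / (n : ℝ)) * ∑ i : Fin n, ∑ j : Fin n,
            if 1 - ε < p n i j then (1 : ℝ) else 0) atTop)
        (nhdsWithin 0 (Set.Ioi 0)) (nhds 0)) {β : ℝ} (hβ : 0 < β) :
    ∃ s : ℕ, ∀ᶠ n : ℕ in atTop, (∑ i, ∑ j, p n i j ^ s) / n ≤ β := by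
  have hev1 := hnondeg.eventually_lt_const (half_pos hβ)
  have hev2 : ∀ᶠ ε : ℝ in nhdsWithin 0 (Set.Ioi 0), ε ∈ Set.Ioo (0 : ℝ) (1 / 2) :=
    Ioo_mem_nhdsGT (by norm_num)
  obtain ⟨ε, hlim, hε0, hε1⟩ := (hev1.and hev2).exists
  have hbdd : ∀ n : ℕ, (1 / (n : ℝ)) * ∑ i : Fin n, ∑ j : Fin n,
      (if 1 - ε < p n i j then (1 : ℝ) else 0) ≤ 2 := by
    intro n
    have : ∑ i : Fin n, ∑ j : Fin n, (if 1 - ε < p n i j then (1 : ℝ) else 0) ≤ n * 2 := by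
      calc _ ≤ ∑ i : Fin n, ∑ j : Fin n, 2 * p n i j := by
            gcongr with i _ j _
            have := hnonneg n i j
            split_ifs with h <;> linarith
        _ = n * 2 := by simp [← Finset.mul_sum, hrow]
    rcases Nat.eq_zero_or_pos n with rfl | hn
    · simp
    · have : (0 : ℝ) < n := by exact_mod_cast hn
      rw [one_div, inv_mul_le_iff₀ this]
      assumption
  have hev := Filter.eventually_lt_of_limsup_lt hlim
    (Filter.isBoundedUnder_of ⟨2, hbdd⟩)
  have habs : |1 - ε| < 1 := by
    rw [abs_lt]
    constructor <;> linarith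
  obtain ⟨k, hk⟩ := exists_pow_lt_of_lt_one (half_pos hβ) habs
  refine ⟨k + 1, ?_⟩
  filter_upwards [hev, eventually_gt_atTop 0] with n hn hn0
  have hn0' : (0 : ℝ) < n := by exact_mod_cast hn0
  calc _ ≤ (∑ i : Fin n, (|1 - ε| ^ k + ∑ j, if 1 - ε < p n i j then (1 : ℝ) else 0)) / n := by
        gcongr with i
        exact sum_pow_succ_le (hnonneg n i) (hrow n i) k
    _ = |1 - ε| ^ k + (1 / (n : ℝ)) * ∑ i : Fin n, ∑ j : Fin n,
          (if 1 - ε < p n i j then (1 : ℝ) else 0) := by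
        rw [Finset.sum_add_distrib]
        simp only [Finset.sum_const, Finset.card_univ, Fintype.card_fin, nsmul_eq_mul]
        field_simp
    _ ≤ β := by linarith

lemma natCast_mul_pow_le_inv {n t : ℕ} (hn : 0 < n) {c a : ℝ} (hc : 0 < c) (ha0 : 0 < a)
    (hac : Real.log a ≤ -(2 / c)) (ht : c * Real.log n ≤ t) : n * a ^ t ≤ (n : ℝ)⁻¹ := by
  have hn' : (0 : ℝ) < n := by exact_mod_cast hn
  rw [← Real.log_le_log_iff (by positivity) (by positivity), Real.log_inv,
    Real.log_mul hn'.ne' (by positivity), Real.log_pow]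
  have h1 : (t : ℝ) * Real.log a ≤ t * -(2 / c) := by gcongr
  have h2 : 2 * Real.log n ≤ t * (2 / c) := by
    rw [mul_div_assoc', le_div_iff₀ hc]
    linarith
  linarith

theorem stmt5
    (p : (n : ℕ) → Fin n → Fin n → ℝ)
    (hnonneg : ∀ n (i j : Fin n), 0 ≤ p n i j)
    (hrow : ∀ n (i : Fin n), ∑ j : Fin n, p n i j = 1)
    (hHbdd : ∃ C : ℝ, ∀ n : ℕ, avgEntropy n (p n) ≤ C)
    (hsparse : ∀ ε : ℝ, 0 < ε → ∀ᶠ n : ℕ in atTop, ∀ i : Fin n,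
        ∑ j : Fin n, p n i j * (Real.log (p n i j)) ^ 2 ≤ ε * Real.log n)
    (hnondeg : Tendsto (fun ε : ℝ =>
        Filter.limsup (fun n : ℕ =>
          (1 / (n : ℝ)) * ∑ i : Fin n, ∑ j : Fin n,
            if 1 - ε < p n i j then (1 : ℝ) else 0) atTop)
        (nhdsWithin 0 (Set.Ioi 0)) (nhds 0))
    (t : ℕ → ℕ)
    -- `t_n = Θ(log n)`
    (hθ : ∃ c C : ℝ, 0 < c ∧ ∀ᶠ n : ℕ in atTop,
        c * Real.log n ≤ (t n : ℝ) ∧ (t n : ℝ) ≤ C * Real.log n)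
    (δ : ℕ → ℝ) (hδpos : ∀ n, 0 < δ n) (hδ : Tendsto δ atTop (nhds 0)) :
    -- `max_i Q_i(ρ(t_n) > e^{-δ_n t_n})` tends to 0 in probability
    ∀ η : ℝ, 0 < η →
      Tendsto (fun n : ℕ => Pr n (fun σ => ∃ i : Fin n,
          η < quenched n (t n) (Pmat n (p n) σ) i (fun x =>
            Real.exp (-(δ n) * (t n : ℝ)) < pathWeight n (t n) (Pmat n (p n) σ) x)))
        atTop (nhds 0) := by
  intro η hη
  obtain ⟨c, C, hc, hct⟩ := hθ
  have hPr0 : ∀ (n : ℕ) (E : Env n → Prop), 0 ≤ Pr n E := fun n E =>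
    div_nonneg (Finset.sum_nonneg fun _ _ => by split_ifs <;> norm_num) (Nat.cast_nonneg _)
  have hle1 : ∀ n (i j : Fin n), p n i j ≤ 1 := fun n i j =>
    hrow n i ▸ Finset.single_le_sum (fun j _ => hnonneg n i j) (Finset.mem_univ j)
  refine tendsto_order.2 ⟨fun a ha => .of_forall fun n => ha.trans_le (hPr0 _ _), fun κ hκ => ?_⟩
  obtain ⟨q, hq0, hq, hqκ, hqc⟩ : ∃ q : ℝ, 0 < q ∧ q ≤ 1 / 2 ∧ 2 * q ≤ κ / 2 ∧
      Real.log (2 * q) ≤ -(2 / c) := by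
    refine ⟨min (1 / 2) (min (κ / 4) (Real.exp (-(2 / c)) / 2)), by positivity,
      min_le_left _ _, ?_, ?_⟩
    · linarith [(min_le_right (1 / 2) (min (κ / 4) (Real.exp (-(2 / c)) / 2))).trans
        (min_le_left _ _)]
    · rw [Real.log_le_iff_le_exp (by positivity)]
      linarith [(min_le_right (1 / 2) (min (κ / 4) (Real.exp (-(2 / c)) / 2))).trans
        (min_le_right _ _)]
  obtain ⟨s, hs⟩ := exists_eventually_avg_pow_le hnonneg hrow hnondeg
    (show 0 < q ^ 2 / 2 by positivity)
  have hexp : ∀ᶠ n in atTop, Real.exp (2 * δ n) ^ s < 2 := by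
    have : Tendsto (fun n => Real.exp (2 * δ n) ^ s) atTop (nhds (Real.exp (2 * 0) ^ s)) :=
      ((Real.continuous_exp.tendsto _).comp (hδ.const_mul 2)).pow s
    refine this.eventually_lt_const ?_
    simp
  have hinv : ∀ᶠ n : ℕ in atTop, (n : ℝ)⁻¹ < κ / 2 :=
    tendsto_inv_atTop_nhds_zero_nat.eventually_lt_const (half_pos hκ)
  filter_upwards [hct, hs, hexp, hinv, eventually_gt_atTop 0] with n hn hsn he hi hn0
  have hmain : Pr n (fun σ => ∃ i : Fin n,
      η < quenched n (t n) (Pmat n (p n) σ) i (fun x =>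
        Real.exp (-(δ n) * (t n : ℝ)) < pathWeight n (t n) (Pmat n (p n) σ) x)) ≤
      2 * q + n * (2 * q) ^ t n := by
    refine Pr_exists_heavy_le
      (g := fun i j => (Real.exp (2 * δ n) * p n i j) ^ s)
      (fun i j => pow_nonneg (mul_nonneg (Real.exp_pos _).le (hnonneg n i j)) s)
      hq0.le hq ?_ ?_
    · have : 0 ≤ (∑ i, ∑ j, p n i j ^ s) / n :=
        div_nonneg (Finset.sum_nonneg fun i _ => Finset.sum_nonneg fun j _ =>
          pow_nonneg (hnonneg n i j) s) (Nat.cast_nonneg _)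
      simp only [mul_pow, ← Finset.mul_sum, mul_div_assoc]
      nlinarith
    · rintro σ ⟨i, hσ⟩
      obtain ⟨x, -, hx⟩ := Finset.exists_ne_zero_of_sum_ne_zero (hη.trans hσ).ne'
      exact exists_heavy_of_pathWeight (hnonneg n) (hle1 n) (hδpos n) σ x
        (of_not_not fun h => hx (if_neg fun h' => h h'.2))
  have := natCast_mul_pow_le_inv hn0 hc (by positivity : 0 < 2 * q) hqc hn.1
  linarith
end
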